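/- arXiv:1702.01627 — 2 statements merged into one kernel-verified Lean document; each statement's English description precedes it below -/
import Mathlib

section
/- For every positive integer n with n ≡ 2 (mod 4), r_3(n) = 12·d(n/2) + 24·#{(r,s,t) ∈ ℤ³ : r > s > t > 0 and rs + rt + st = n}, where d(m) denotes the number of positive divisors of m. -/
/-- `r₃ n` is the number of ordered triples `(x,y,z) ∈ ℤ³` with `x² + y² + z² = n`. -/
noncomputable def r3 (n : ℕ) : ℕ :=
  Set.ncard {v : ℤ × ℤ × ℤ | v.1 ^ 2 + v.2.1 ^ 2 + v.2.2 ^ 2 = (n : ℤ)}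

/-- The number of integer quadruples satisfying `P`. -/
noncomputable def quadCount (P : ℤ → ℤ → ℤ → ℤ → Prop) : ℕ :=
  Set.ncard {v : ℤ × ℤ × ℤ × ℤ | P v.1 v.2.1 v.2.2.1 v.2.2.2}

theorem ncard_eq_of_inverse {α β : Type*} {A : Set α} {B : Set β} (f : α → β) (g : β → α)
    (hf : ∀ a ∈ A, f a ∈ B ∧ g (f a) = a) (hg : ∀ b ∈ B, g b ∈ A ∧ f (g b) = b) :
    A.ncard = B.ncard := by
  refine Set.ncard_congr (fun a _ => f a) (fun a ha => (hf a ha).1) ?_ ?_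
  · intro a b ha hb hab
    rw [← (hf a ha).2, ← (hf b hb).2]
    exact congrArg g hab
  · intro b hb
    exact ⟨g b, (hg b hb).1, (hg b hb).2⟩

theorem ncard_split {α : Type*} {A : Set α} (hA : A.Finite) (p : α → Prop) :
    A.ncard = {a | a ∈ A ∧ p a}.ncard + {a | a ∈ A ∧ ¬ p a}.ncard :=
  (Set.ncard_inter_add_ncard_sdiff_eq_ncard A {a | p a} hA).symm

theorem quadCount_split {P : ℤ → ℤ → ℤ → ℤ → Prop} (p : ℤ → ℤ → ℤ → ℤ → Prop)
    {C : ℤ} (hP : ∀ a b c d, P a b c d → |a| ≤ C ∧ |b| ≤ C ∧ |c| ≤ C ∧ |d| ≤ C) :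
    quadCount P = quadCount (fun a b c d => P a b c d ∧ p a b c d)
      + quadCount (fun a b c d => P a b c d ∧ ¬ p a b c d) := by
  refine ncard_split (Set.Finite.subset (Set.finite_Icc
    ((-C, -C, -C, -C) : ℤ × ℤ × ℤ × ℤ) (C, C, C, C)) ?_)
    (fun v : ℤ × ℤ × ℤ × ℤ => p v.1 v.2.1 v.2.2.1 v.2.2.2)
  rintro ⟨a, b, c, d⟩ h
  obtain ⟨h1, h2, h3, h4⟩ := hP _ _ _ _ h
  rw [abs_le] at h1 h2 h3 h4
  exact ⟨⟨h1.1, h2.1, h3.1, h4.1⟩, h1.2, h2.2, h3.2, h4.2⟩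

theorem quadCount_eq_of_inverse {P Q : ℤ → ℤ → ℤ → ℤ → Prop} (f g : ℤ × ℤ × ℤ × ℤ → ℤ × ℤ × ℤ × ℤ)
    (hf : ∀ a b c d, P a b c d → (Q (f (a, b, c, d)).1 (f (a, b, c, d)).2.1
      (f (a, b, c, d)).2.2.1 (f (a, b, c, d)).2.2.2) ∧ g (f (a, b, c, d)) = (a, b, c, d))
    (hg : ∀ a b c d, Q a b c d → (P (g (a, b, c, d)).1 (g (a, b, c, d)).2.1
      (g (a, b, c, d)).2.2.1 (g (a, b, c, d)).2.2.2) ∧ f (g (a, b, c, d)) = (a, b, c, d)) :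
    quadCount P = quadCount Q :=
  ncard_eq_of_inverse f g (fun _ h => hf _ _ _ _ h) (fun _ h => hg _ _ _ _ h)

theorem quadCount_congr {P Q : ℤ → ℤ → ℤ → ℤ → Prop} (h : ∀ a b c d, P a b c d ↔ Q a b c d) :
    quadCount P = quadCount Q := by
  have : P = Q := by
    funext a b c d
    exact propext (h a b c d)
  rw [this]

/-- Solutions of `x(y+z) + 2yz + 2w² = m`. -/
def MixedSol (m x y z w : ℤ) : Prop :=
  0 < x ∧ 0 ≤ y ∧ 0 < z ∧ x * (y + z) + 2 * y * z + 2 * w ^ 2 = m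

/-- With `B = u + 2g`: solutions of `(B-u)²/2 + hB + 2ku = m`. -/
def MinusSol (m h g u k : ℤ) : Prop :=
  0 < h ∧ 0 < u ∧ 0 < u + 2 * g ∧ u % 2 = 1 ∧ 0 ≤ k ∧
    2 * g ^ 2 + h * (u + 2 * g) + 2 * k * u = m

/-- With `B = 2g - u`: solutions of `(B+u)²/2 + hB + 2ku = m`. -/
def PlusSol (m h g u k : ℤ) : Prop :=
  0 < h ∧ 0 < u ∧ 0 < 2 * g - u ∧ u % 2 = 1 ∧ 0 ≤ k ∧
    2 * g ^ 2 + h * (2 * g - u) + 2 * k * u = m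

/-- Positive solutions of `2ax + bv + 2x² = m`. -/
def PosSol (m a x b v : ℤ) : Prop :=
  0 < a ∧ 0 < x ∧ 0 < b ∧ 0 < v ∧ 2 * a * x + b * v + 2 * x ^ 2 = m

theorem abs_le_sq_self (a : ℤ) : |a| ≤ a ^ 2 := by
  rw [← sq_abs]
  exact Int.le_self_sq _

theorem MixedSol.bound {m x y z w : ℤ} (h : MixedSol m x y z w) :
    |x| ≤ m ∧ |y| ≤ m ∧ |z| ≤ m ∧ |w| ≤ m := by
  obtain ⟨h1, h2, h3, h4⟩ := h
  have hw := abs_le_sq_self w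
  rw [abs_of_pos h1, abs_of_nonneg h2, abs_of_pos h3]
  refine ⟨?_, ?_, ?_, ?_⟩ <;> nlinarith [mul_pos h1 h3, mul_nonneg h2 h3.le, mul_nonneg h1.le h2, sq_nonneg w]

theorem MinusSol.bound {m h g u k : ℤ} (H : MinusSol m h g u k) :
    |h| ≤ 3 * m ∧ |g| ≤ 3 * m ∧ |u| ≤ 3 * m ∧ |k| ≤ 3 * m := by
  obtain ⟨h1, h2, h3, -, h4, h5⟩ := H
  have hg : |g| ≤ g ^ 2 := abs_le_sq_self g
  have := abs_nonneg g
  have := neg_abs_le g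
  have := mul_pos h1 h3
  have := mul_nonneg h4 h2.le
  have hh : h ≤ h * (u + 2 * g) := by nlinarith
  have hB : u + 2 * g ≤ h * (u + 2 * g) := by nlinarith
  have hk : k ≤ k * u := by nlinarith
  rw [abs_of_pos h1, abs_of_pos h2, abs_of_nonneg h4]
  refine ⟨?_, ?_, ?_, ?_⟩ <;> linarith

theorem PlusSol.bound {m h g u k : ℤ} (H : PlusSol m h g u k) :
    |h| ≤ 3 * m ∧ |g| ≤ 3 * m ∧ |u| ≤ 3 * m ∧ |k| ≤ 3 * m := by
  obtain ⟨h1, h2, h3, -, h4, h5⟩ := H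
  have hg : |g| ≤ g ^ 2 := abs_le_sq_self g
  have := abs_nonneg g
  have := le_abs_self g
  have := mul_pos h1 h3
  have := mul_nonneg h4 h2.le
  have hh : h ≤ h * (2 * g - u) := by nlinarith
  have hk : k ≤ k * u := by nlinarith
  rw [abs_of_pos h1, abs_of_pos h2, abs_of_nonneg h4]
  refine ⟨?_, ?_, ?_, ?_⟩ <;> linarith

theorem PosSol.bound {m a x b v : ℤ} (H : PosSol m a x b v) :
    |a| ≤ m ∧ |x| ≤ m ∧ |b| ≤ m ∧ |v| ≤ m := by
  obtain ⟨h1, h2, h3, h4, h5⟩ := H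
  rw [abs_of_pos h1, abs_of_pos h2, abs_of_pos h3, abs_of_pos h4]
  have := mul_pos h1 h2
  have := mul_pos h3 h4
  refine ⟨?_, ?_, ?_, ?_⟩ <;> nlinarith

theorem odd_mul_left {a b c m : ℤ} (hm : m % 2 = 1) (h : a * b + 2 * c = m) : a % 2 = 1 := by
  rcases Int.emod_two_eq_zero_or_one a with ha | ha
  · obtain ⟨t, rfl⟩ := Int.dvd_of_emod_eq_zero ha
    have : 2 * (t * b + c) = m := by linarith
    omega
  · exact ha

theorem odd_mul_right {a b c m : ℤ} (hm : m % 2 = 1) (h : a * b + 2 * c = m) : b % 2 = 1 :=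
  odd_mul_left (a := b) (b := a) (c := c) hm (by linarith)

theorem MixedSol.odd {m x y z w : ℤ} (hm : m % 2 = 1) (h : MixedSol m x y z w) :
    x % 2 = 1 ∧ (y + z) % 2 = 1 :=
  have h' : x * (y + z) + 2 * (y * z + w ^ 2) = m := by linarith [h.2.2.2]
  ⟨odd_mul_left hm h', odd_mul_right hm h'⟩

theorem MinusSol.odd {m h g u k : ℤ} (hm : m % 2 = 1) (H : MinusSol m h g u k) : h % 2 = 1 :=
  odd_mul_left (b := u + 2 * g) (c := g ^ 2 + k * u) hm (by linarith [H.2.2.2.2.2])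

theorem PlusSol.odd {m h g u k : ℤ} (hm : m % 2 = 1) (H : PlusSol m h g u k) : h % 2 = 1 :=
  odd_mul_left (b := 2 * g - u) (c := g ^ 2 + k * u) hm (by linarith [H.2.2.2.2.2])

theorem PosSol.odd {m a x b v : ℤ} (hm : m % 2 = 1) (H : PosSol m a x b v) :
    b % 2 = 1 ∧ v % 2 = 1 :=
  have h' : b * v + 2 * (a * x + x ^ 2) = m := by linarith [H.2.2.2.2]
  ⟨odd_mul_left hm h', odd_mul_right hm h'⟩

theorem mixed_pos_part {m : ℤ} (hm : m % 2 = 1) :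
    quadCount (fun x y z w => MixedSol m x y z w ∧ 0 < 2 * w + y - z) =
      quadCount (fun h g u k => (MinusSol m h g u k ∧ 0 < k) ∧ k ≤ u + 2 * g) := by
  refine quadCount_eq_of_inverse (fun v => (v.1, v.2.2.1 - v.2.2.2,
      2 * v.2.2.2 + v.2.1 - v.2.2.1, v.2.2.1))
    (fun v => (v.1, v.2.2.1 + 2 * v.2.1 - v.2.2.2, v.2.2.2, v.2.2.2 - v.2.1)) ?_ ?_
  · rintro x y z w ⟨H, hu⟩
    have ho := H.odd hm
    obtain ⟨h1, h2, h3, h4⟩ := H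
    refine ⟨⟨⟨⟨h1, hu, ?_, ?_, h3.le, ?_⟩, h3⟩, ?_⟩, ?_⟩
    · dsimp only; omega
    · dsimp only; omega
    · dsimp only; linear_combination h4
    · dsimp only; omega
    · ext <;> dsimp only <;> ring
  · rintro h g u k ⟨⟨⟨h1, h2, h3, h4, h5, h6⟩, h7⟩, h8⟩
    refine ⟨⟨⟨h1, ?_, h7, ?_⟩, ?_⟩, ?_⟩
    · dsimp only; omega
    · dsimp only; linear_combination h6
    · dsimp only; omega
    · ext <;> dsimp only <;> ring

theorem mixed_neg_part {m : ℤ} (hm : m % 2 = 1) :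
    quadCount (fun x y z w => MixedSol m x y z w ∧ ¬ 0 < 2 * w + y - z) =
      quadCount (fun h g u k => MinusSol m h g u k ∧ ¬ u + 2 * g ≤ k) := by
  refine quadCount_eq_of_inverse (fun v => (v.1, v.2.1 + v.2.2.2,
      v.2.2.1 - v.2.1 - 2 * v.2.2.2, v.2.1))
    (fun v => (v.1, v.2.2.2, v.2.2.1 + 2 * v.2.1 - v.2.2.2, v.2.1 - v.2.2.2)) ?_ ?_
  · rintro x y z w ⟨H, hu⟩
    have ho := H.odd hm
    obtain ⟨h1, h2, h3, h4⟩ := H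
    refine ⟨⟨⟨h1, ?_, ?_, ?_, h2, ?_⟩, ?_⟩, ?_⟩
    · dsimp only; omega
    · dsimp only; omega
    · dsimp only; omega
    · dsimp only; linear_combination h4
    · dsimp only; omega
    · ext <;> dsimp only <;> ring
  · rintro h g u k ⟨⟨h1, h2, h3, h4, h5, h6⟩, h7⟩
    refine ⟨⟨⟨h1, h5, ?_, ?_⟩, ?_⟩, ?_⟩
    · dsimp only; omega
    · dsimp only; linear_combination h6
    · dsimp only; omega
    · ext <;> dsimp only <;> ring

theorem minus_shift_pos (m : ℤ) :
    quadCount (fun h g u k => (MinusSol m h g u k ∧ 0 < k) ∧ ¬ k ≤ u + 2 * g) =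
      quadCount (fun h g u k => PlusSol m h g u k ∧ 0 < k) := by
  refine quadCount_eq_of_inverse (fun v => (v.1, v.2.1 + v.2.2.1, v.2.2.1,
      v.2.2.2 - v.2.2.1 - 2 * v.2.1))
    (fun v => (v.1, v.2.1 - v.2.2.1, v.2.2.1, v.2.2.2 + 2 * v.2.1 - v.2.2.1)) ?_ ?_
  · rintro h g u k ⟨⟨⟨h1, h2, h3, h4, h5, h6⟩, h7⟩, h8⟩
    refine ⟨⟨⟨h1, h2, ?_, h4, ?_, ?_⟩, ?_⟩, ?_⟩
    · dsimp only; omega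
    · dsimp only; omega
    · dsimp only; linear_combination h6
    · dsimp only; omega
    · ext <;> dsimp only <;> ring
  · rintro h g u k ⟨⟨h1, h2, h3, h4, h5, h6⟩, h7⟩
    refine ⟨⟨⟨⟨h1, h2, ?_, h4, ?_, ?_⟩, ?_⟩, ?_⟩, ?_⟩
    · dsimp only; omega
    · dsimp only; omega
    · dsimp only; linear_combination h6
    · dsimp only; omega
    · dsimp only; omega
    · ext <;> dsimp only <;> ring

theorem minus_shift_nonneg (m : ℤ) :
    quadCount (fun h g u k => MinusSol m h g u k ∧ u + 2 * g ≤ k) = quadCount (PlusSol m) := by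
  refine quadCount_eq_of_inverse (fun v => (v.1, v.2.1 + v.2.2.1, v.2.2.1,
      v.2.2.2 - v.2.2.1 - 2 * v.2.1))
    (fun v => (v.1, v.2.1 - v.2.2.1, v.2.2.1, v.2.2.2 + 2 * v.2.1 - v.2.2.1)) ?_ ?_
  · rintro h g u k ⟨⟨h1, h2, h3, h4, h5, h6⟩, h8⟩
    refine ⟨⟨h1, h2, ?_, h4, ?_, ?_⟩, ?_⟩
    · dsimp only; omega
    · dsimp only; omega
    · dsimp only; linear_combination h6
    · ext <;> dsimp only <;> ring
  · rintro h g u k ⟨h1, h2, h3, h4, h5, h6⟩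
    refine ⟨⟨⟨h1, h2, ?_, h4, ?_, ?_⟩, ?_⟩, ?_⟩
    · dsimp only; omega
    · dsimp only; omega
    · dsimp only; linear_combination h6
    · dsimp only; omega
    · ext <;> dsimp only <;> ring

theorem minus_pos_gap {m : ℤ} (hm : m % 2 = 1) :
    quadCount (fun h g u k => ((MinusSol m h g u k ∧ 0 < k) ∧ ¬ g = 0) ∧ 0 < g) =
      quadCount (fun a x b v => (PosSol m a x b v ∧ a < b) ∧ a % 2 = 1) := by
  refine quadCount_eq_of_inverse (fun v => (v.1, v.2.1, v.1 + 2 * v.2.2.2, v.2.2.1))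
    (fun v => (v.1, v.2.1, v.2.2.2, (v.2.2.1 - v.1) / 2)) ?_ ?_
  · rintro h g u k ⟨⟨⟨H, h7⟩, -⟩, h8⟩
    have ho := H.odd hm
    obtain ⟨h1, h2, h3, h4, h5, h6⟩ := H
    refine ⟨⟨⟨⟨h1, h8, ?_, h2, ?_⟩, ?_⟩, ho⟩, ?_⟩
    · dsimp only; omega
    · dsimp only; linear_combination h6
    · dsimp only; omega
    · ext <;> dsimp only; omega
  · rintro a x b v ⟨⟨H, h7⟩, h8⟩
    have ho := H.odd hm
    obtain ⟨h1, h2, h3, h4, h5⟩ := H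
    obtain ⟨k, hk⟩ : ∃ k, b = a + 2 * k := ⟨(b - a) / 2, by omega⟩
    have hk' : (b - a) / 2 = k := by omega
    dsimp only
    rw [hk']
    refine ⟨⟨⟨⟨⟨h1, h4, ?_, ho.2, ?_, ?_⟩, ?_⟩, ?_⟩, h2⟩, ?_⟩
    · omega
    · omega
    · subst hk; linear_combination h5
    · omega
    · omega
    · rw [← hk]

theorem minus_neg_gap {m : ℤ} (hm : m % 2 = 1) :
    quadCount (fun h g u k => ((MinusSol m h g u k ∧ 0 < k) ∧ ¬ g = 0) ∧ ¬ 0 < g) =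
      quadCount (fun a x b v => (PosSol m a x b v ∧ a < b) ∧ ¬ a % 2 = 1) := by
  refine quadCount_eq_of_inverse
    (fun v => (2 * v.2.2.2, -v.2.1, v.1 + 2 * v.2.2.2, v.2.2.1 + 2 * v.2.1))
    (fun v => (v.2.2.1 - v.1, -v.2.1, v.2.2.2 + 2 * v.2.1, v.1 / 2)) ?_ ?_
  · rintro h g u k ⟨⟨⟨H, h7⟩, h9⟩, h8⟩
    obtain ⟨h1, h2, h3, h4, h5, h6⟩ := H
    refine ⟨⟨⟨⟨?_, ?_, ?_, h3, ?_⟩, ?_⟩, ?_⟩, ?_⟩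
    · dsimp only; omega
    · dsimp only; omega
    · dsimp only; omega
    · dsimp only; linear_combination h6
    · dsimp only; omega
    · dsimp only; omega
    · ext <;> dsimp only <;> omega
  · rintro a x b v ⟨⟨H, h7⟩, h8⟩
    have ho := H.odd hm
    obtain ⟨h1, h2, h3, h4, h5⟩ := H
    obtain ⟨k, rfl⟩ : ∃ k, a = 2 * k := ⟨a / 2, by omega⟩
    have hk' : 2 * k / 2 = k := by omega
    dsimp only
    rw [hk']
    refine ⟨⟨⟨⟨⟨?_, ?_, ?_, ?_, ?_, ?_⟩, ?_⟩, ?_⟩, ?_⟩, ?_⟩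
    · omega
    · omega
    · omega
    · omega
    · omega
    · linear_combination h5
    · omega
    · omega
    · omega
    · ext <;> dsimp only <;> omega

theorem plus_pos_gap {m : ℤ} (hm : m % 2 = 1) :
    quadCount (fun h g u k => (PlusSol m h g u k ∧ 0 < k) ∧ h < 2 * k) =
      quadCount (fun a x b v => (PosSol m a x b v ∧ ¬ 2 * x < v) ∧ a % 2 = 1) := by
  refine quadCount_eq_of_inverse (fun v => (v.1, v.2.1, 2 * v.2.2.2 - v.1, v.2.2.1))
    (fun v => (v.1, v.2.1, v.2.2.2, (v.2.2.1 + v.1) / 2)) ?_ ?_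
  · rintro h g u k ⟨⟨H, h7⟩, h8⟩
    have ho := H.odd hm
    obtain ⟨h1, h2, h3, h4, h5, h6⟩ := H
    refine ⟨⟨⟨⟨h1, ?_, ?_, h2, ?_⟩, ?_⟩, ho⟩, ?_⟩
    · dsimp only; omega
    · dsimp only; omega
    · dsimp only; linear_combination h6
    · dsimp only; omega
    · ext <;> dsimp only; omega
  · rintro a x b v ⟨⟨H, h7⟩, h8⟩
    have ho := H.odd hm
    obtain ⟨h1, h2, h3, h4, h5⟩ := H
    obtain ⟨k, hk⟩ : ∃ k, b = 2 * k - a := ⟨(b + a) / 2, by omega⟩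
    have hk' : (b + a) / 2 = k := by omega
    dsimp only
    rw [hk']
    refine ⟨⟨⟨⟨h1, h4, ?_, ho.2, ?_, ?_⟩, ?_⟩, ?_⟩, ?_⟩
    · omega
    · omega
    · subst hk; linear_combination h5
    · omega
    · omega
    · rw [← hk]

theorem plus_neg_gap {m : ℤ} (hm : m % 2 = 1) :
    quadCount (fun h g u k => (PlusSol m h g u k ∧ 0 < k) ∧ ¬ h < 2 * k) =
      quadCount (fun a x b v => (PosSol m a x b v ∧ ¬ 2 * x < v) ∧ ¬ a % 2 = 1) := by
  refine quadCount_eq_of_inverse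
    (fun v => (2 * v.2.2.2, v.2.1, v.1 - 2 * v.2.2.2, 2 * v.2.1 - v.2.2.1))
    (fun v => (v.2.2.1 + v.1, v.2.1, 2 * v.2.1 - v.2.2.2, v.1 / 2)) ?_ ?_
  · rintro h g u k ⟨⟨H, h7⟩, h8⟩
    have ho := H.odd hm
    obtain ⟨h1, h2, h3, h4, h5, h6⟩ := H
    refine ⟨⟨⟨⟨?_, ?_, ?_, h3, ?_⟩, ?_⟩, ?_⟩, ?_⟩
    · dsimp only; omega
    · dsimp only; omega
    · dsimp only; omega
    · dsimp only; linear_combination h6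
    · dsimp only; omega
    · dsimp only; omega
    · ext <;> dsimp only <;> omega
  · rintro a x b v ⟨⟨H, h7⟩, h8⟩
    have ho := H.odd hm
    obtain ⟨h1, h2, h3, h4, h5⟩ := H
    obtain ⟨k, rfl⟩ : ∃ k, a = 2 * k := ⟨a / 2, by omega⟩
    have hk' : 2 * k / 2 = k := by omega
    dsimp only
    rw [hk']
    refine ⟨⟨⟨⟨?_, ?_, ?_, ?_, ?_, ?_⟩, ?_⟩, ?_⟩, ?_⟩
    · omega
    · omega
    · omega
    · omega
    · omega
    · linear_combination h5
    · omega
    · omega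
    · ext <;> dsimp only <;> omega

theorem pos_shear (m : ℤ) :
    quadCount (fun a x b v => PosSol m a x b v ∧ 2 * x < v) =
      quadCount (fun a x b v => (PosSol m a x b v ∧ ¬ a < b) ∧ ¬ a = b) := by
  refine quadCount_eq_of_inverse (fun v => (v.1 + v.2.2.1, v.2.1, v.2.2.1, v.2.2.2 - 2 * v.2.1))
    (fun v => (v.1 - v.2.2.1, v.2.1, v.2.2.1, v.2.2.2 + 2 * v.2.1)) ?_ ?_
  · rintro a x b v ⟨⟨h1, h2, h3, h4, h5⟩, h6⟩
    refine ⟨⟨⟨⟨?_, h2, h3, ?_, ?_⟩, ?_⟩, ?_⟩, ?_⟩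
    · dsimp only; omega
    · dsimp only; omega
    · dsimp only; linear_combination h5
    · dsimp only; omega
    · dsimp only; omega
    · ext <;> dsimp only <;> ring
  · rintro a x b v ⟨⟨⟨h1, h2, h3, h4, h5⟩, h6⟩, h7⟩
    refine ⟨⟨⟨?_, h2, h3, ?_, ?_⟩, ?_⟩, ?_⟩
    · dsimp only; omega
    · dsimp only; omega
    · dsimp only; linear_combination h5
    · dsimp only; omega
    · ext <;> dsimp only <;> ring

theorem minus_zero_pos_gap {m : ℤ} (hm : m % 2 = 1) :
    quadCount (fun h g u k => ((MinusSol m h g u k ∧ ¬ 0 < k) ∧ ¬ g = 0) ∧ 0 < g) =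
      quadCount (fun a x b v => (PosSol m a x b v ∧ ¬ a < b) ∧ a = b) := by
  refine quadCount_eq_of_inverse (fun v => (v.1, v.2.1, v.1, v.2.2.1))
    (fun v => (v.1, v.2.1, v.2.2.2, 0)) ?_ ?_
  · rintro h g u k ⟨⟨⟨⟨h1, h2, h3, h4, h5, h6⟩, h7⟩, -⟩, h8⟩
    obtain rfl : k = 0 := by omega
    refine ⟨⟨⟨⟨h1, h8, h1, h2, ?_⟩, ?_⟩, rfl⟩, rfl⟩
    · dsimp only; linear_combination h6
    · exact lt_irrefl _
  · rintro a x b v ⟨⟨H, h6⟩, rfl⟩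
    have ho := H.odd hm
    obtain ⟨h1, h2, h3, h4, h5⟩ := H
    refine ⟨⟨⟨⟨⟨h1, h4, ?_, ho.2, le_rfl, ?_⟩, ?_⟩, ?_⟩, h2⟩, rfl⟩
    · dsimp only; omega
    · dsimp only; linear_combination h5
    · exact lt_irrefl _
    · dsimp only; omega

theorem minus_zero_small_gap {m : ℤ} (hm : m % 2 = 1) :
    quadCount (fun h g u k => (((MinusSol m h g u k ∧ ¬ 0 < k) ∧ ¬ g = 0) ∧ ¬ 0 < g)
        ∧ 0 < u + 4 * g) =
      quadCount (fun a x b v => (PosSol m a x b v ∧ ¬ a < b) ∧ a = b) := by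
  refine quadCount_eq_of_inverse (fun v => (v.1, -v.2.1, v.1, v.2.2.1 + 4 * v.2.1))
    (fun v => (v.1, -v.2.1, v.2.2.2 + 4 * v.2.1, 0)) ?_ ?_
  · rintro h g u k ⟨⟨⟨⟨⟨h1, h2, h3, h4, h5, h6⟩, h7⟩, h9⟩, h8⟩, h10⟩
    obtain rfl : k = 0 := by omega
    refine ⟨⟨⟨⟨h1, ?_, h1, h10, ?_⟩, ?_⟩, rfl⟩, ?_⟩
    · dsimp only; omega
    · dsimp only; linear_combination h6
    · exact lt_irrefl _
    · ext <;> dsimp only <;> omega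
  · rintro a x b v ⟨⟨H, h6⟩, rfl⟩
    have ho := H.odd hm
    obtain ⟨h1, h2, h3, h4, h5⟩ := H
    refine ⟨⟨⟨⟨⟨⟨h1, ?_, ?_, ?_, le_rfl, ?_⟩, ?_⟩, ?_⟩, ?_⟩, ?_⟩, ?_⟩
    · dsimp only; omega
    · dsimp only; omega
    · dsimp only; omega
    · dsimp only; linear_combination h5
    · exact lt_irrefl _
    · dsimp only; omega
    · dsimp only; omega
    · dsimp only; omega
    · ext <;> dsimp only <;> omega

theorem minus_zero_large_gap (m : ℤ) :
    quadCount (fun h g u k => (((MinusSol m h g u k ∧ ¬ 0 < k) ∧ ¬ g = 0) ∧ ¬ 0 < g)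
        ∧ ¬ 0 < u + 4 * g) =
      quadCount (fun h g u k => PlusSol m h g u k ∧ ¬ 0 < k) := by
  refine quadCount_eq_of_inverse (fun v => (v.1, -v.2.1, -v.2.2.1 - 4 * v.2.1, 0))
    (fun v => (v.1, -v.2.1, 4 * v.2.1 - v.2.2.1, 0)) ?_ ?_
  · rintro h g u k ⟨⟨⟨⟨⟨h1, h2, h3, h4, h5, h6⟩, h7⟩, h9⟩, h8⟩, h10⟩
    obtain rfl : k = 0 := by omega
    refine ⟨⟨⟨h1, ?_, ?_, ?_, le_rfl, ?_⟩, lt_irrefl _⟩, ?_⟩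
    · dsimp only; omega
    · dsimp only; omega
    · dsimp only; omega
    · dsimp only; linear_combination h6
    · ext <;> dsimp only <;> omega
  · rintro h g u k ⟨⟨h1, h2, h3, h4, h5, h6⟩, h7⟩
    obtain rfl : k = 0 := by omega
    refine ⟨⟨⟨⟨⟨⟨h1, ?_, ?_, ?_, le_rfl, ?_⟩, lt_irrefl _⟩, ?_⟩, ?_⟩, ?_⟩, ?_⟩
    · dsimp only; omega
    · dsimp only; omega
    · dsimp only; omega
    · dsimp only; linear_combination h6
    · dsimp only; omega
    · dsimp only; omega
    · dsimp only; omega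
    · ext <;> dsimp only <;> omega

theorem quadCount_mixedSol {m : ℤ} (hm : m % 2 = 1) :
    quadCount (MixedSol m) =
      2 * quadCount (fun h g u k => (MinusSol m h g u k ∧ 0 < k) ∧ g = 0)
        + quadCount (fun h g u k => (MinusSol m h g u k ∧ ¬ 0 < k) ∧ g = 0) := by
  have e1 := quadCount_split (P := MixedSol m) (fun _ y z w => 0 < 2 * w + y - z)
    (fun _ _ _ _ h => h.bound)
  have e2 := quadCount_split (P := MinusSol m) (fun _ _ _ k => 0 < k) (fun _ _ _ _ h => h.bound)
  have e3 := quadCount_split (P := MinusSol m) (fun _ g u k => u + 2 * g ≤ k)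
    (fun _ _ _ _ h => h.bound)
  have e4 := quadCount_split (P := fun h g u k => MinusSol m h g u k ∧ 0 < k)
    (fun _ g u k => k ≤ u + 2 * g) (fun _ _ _ _ h => h.1.bound)
  have e5 := quadCount_split (P := fun h g u k => MinusSol m h g u k ∧ 0 < k)
    (fun _ g u k => g = 0) (fun _ _ _ _ h => h.1.bound)
  have e6 := quadCount_split (P := fun h g u k => (MinusSol m h g u k ∧ 0 < k) ∧ ¬ g = 0)
    (fun _ g u k => 0 < g) (fun _ _ _ _ h => h.1.1.bound)
  have e7 := quadCount_split (P := fun h g u k => MinusSol m h g u k ∧ ¬ 0 < k)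
    (fun _ g u k => g = 0) (fun _ _ _ _ h => h.1.bound)
  have e8 := quadCount_split (P := fun h g u k => (MinusSol m h g u k ∧ ¬ 0 < k) ∧ ¬ g = 0)
    (fun _ g u k => 0 < g) (fun _ _ _ _ h => h.1.1.bound)
  have e9 := quadCount_split
    (P := fun h g u k => ((MinusSol m h g u k ∧ ¬ 0 < k) ∧ ¬ g = 0) ∧ ¬ 0 < g)
    (fun _ g u k => 0 < u + 4 * g) (fun _ _ _ _ h => h.1.1.1.bound)
  have e10 := quadCount_split (P := PlusSol m) (fun _ _ _ k => 0 < k) (fun _ _ _ _ h => h.bound)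
  have e11 := quadCount_split (P := fun h g u k => PlusSol m h g u k ∧ 0 < k)
    (fun h _ _ k => h < 2 * k) (fun _ _ _ _ h => h.1.bound)
  have e12 := quadCount_split (P := PosSol m) (fun a _ b _ => a < b) (fun _ _ _ _ h => h.bound)
  have e13 := quadCount_split (P := PosSol m) (fun _ x _ v => 2 * x < v)
    (fun _ _ _ _ h => h.bound)
  have e14 := quadCount_split (P := fun a x b v => PosSol m a x b v ∧ a < b)
    (fun a _ _ _ => a % 2 = 1) (fun _ _ _ _ h => h.1.bound)
  have e15 := quadCount_split (P := fun a x b v => PosSol m a x b v ∧ ¬ 2 * x < v)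
    (fun a _ _ _ => a % 2 = 1) (fun _ _ _ _ h => h.1.bound)
  have e16 := quadCount_split (P := fun a x b v => PosSol m a x b v ∧ ¬ a < b)
    (fun a _ b _ => a = b) (fun _ _ _ _ h => h.1.bound)
  have f1 := mixed_pos_part hm
  have f2 := mixed_neg_part hm
  have f3 := minus_shift_pos m
  have f4 := minus_shift_nonneg m
  have f5 := minus_pos_gap hm
  have f6 := minus_neg_gap hm
  have f7 := plus_pos_gap hm
  have f8 := plus_neg_gap hm
  have f9 := pos_shear m
  have f10 := minus_zero_pos_gap hm
  have f11 := minus_zero_small_gap hm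
  have f12 := minus_zero_large_gap m
  omega

theorem ncard_eq_sum_fiber {α β : Type*} [DecidableEq β] {A : Set α} (hA : A.Finite) (f : α → β)
    (F : Finset β) (hF : ∀ a ∈ A, f a ∈ F) :
    A.ncard = ∑ b ∈ F, {a | a ∈ A ∧ f a = b}.ncard := by
  classical
  rw [Set.ncard_eq_toFinset_card A hA,
    Finset.card_eq_sum_card_fiberwise (f := f) (t := F) (by simpa [Set.MapsTo] using hF)]
  refine Finset.sum_congr rfl fun b _ => ?_
  rw [← Set.ncard_coe_finset]
  congr 1
  ext a
  simp

theorem quadCount_finite {P : ℤ → ℤ → ℤ → ℤ → Prop}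
    {C : ℤ} (hP : ∀ a b c d, P a b c d → |a| ≤ C ∧ |b| ≤ C ∧ |c| ≤ C ∧ |d| ≤ C) :
    {v : ℤ × ℤ × ℤ × ℤ | P v.1 v.2.1 v.2.2.1 v.2.2.2}.Finite := by
  refine Set.Finite.subset (Set.finite_Icc
    ((-C, -C, -C, -C) : ℤ × ℤ × ℤ × ℤ) (C, C, C, C)) ?_
  rintro ⟨a, b, c, d⟩ h
  obtain ⟨h1, h2, h3, h4⟩ := hP _ _ _ _ h
  rw [abs_le] at h1 h2 h3 h4
  exact ⟨⟨h1.1, h2.1, h3.1, h4.1⟩, h1.2, h2.2, h3.2, h4.2⟩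

theorem ncard_mul_eq (m : ℕ) (hm : 0 < m) :
    {p : ℤ × ℤ | 0 < p.1 ∧ 0 < p.2 ∧ p.1 * p.2 = m}.ncard = m.divisors.card := by
  rw [← Set.ncard_coe_finset]
  refine ncard_eq_of_inverse (fun p => p.1.toNat) (fun d => ((d : ℤ), ((m / d : ℕ) : ℤ))) ?_ ?_
  · rintro ⟨a, b⟩ ⟨h1, h2, h3⟩
    lift a to ℕ using h1.le
    lift b to ℕ using h2.le
    dsimp only at *
    norm_cast at h1 h2 h3
    subst h3
    simp [h1, hm.ne']
  · intro d hd
    have hd := (Finset.mem_coe.1 hd)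
    have := Nat.pos_of_mem_divisors hd
    have h2 := Nat.dvd_of_mem_divisors hd
    refine ⟨⟨Int.natCast_pos.2 this, Int.natCast_pos.2 (Nat.div_pos (Nat.le_of_dvd hm h2) this),
      ?_⟩, rfl⟩
    dsimp only
    exact_mod_cast Nat.mul_div_cancel' h2

theorem minus_zero_zero {m : ℕ} (hm : m % 2 = 1) :
    quadCount (fun h g u k => (MinusSol m h g u k ∧ ¬ 0 < k) ∧ g = 0) = m.divisors.card := by
  rw [← ncard_mul_eq m (by omega)]
  refine ncard_eq_of_inverse (fun v => (v.1, v.2.2.1)) (fun p => (p.1, 0, p.2, 0)) ?_ ?_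
  · rintro ⟨h, g, u, k⟩ ⟨⟨⟨h1, h2, h3, h4, h5, h6⟩, h7⟩, h8⟩
    dsimp only at *
    obtain rfl : k = 0 := by omega
    subst h8
    exact ⟨⟨h1, h2, by linear_combination h6⟩, rfl⟩
  · rintro ⟨h, u⟩ ⟨h1, h2, h3⟩
    dsimp only at *
    have ho : u % 2 = 1 := odd_mul_right (a := h) (c := 0) (m := m) (by omega) (by linarith)
    exact ⟨⟨⟨⟨h1, h2, by simpa, ho, le_rfl, by linear_combination h3⟩, lt_irrefl _⟩, rfl⟩, rfl⟩

theorem minus_pos_zero {m : ℕ} (hm : m % 2 = 1) :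
    quadCount (fun h g u k => (MinusSol m h g u k ∧ 0 < k) ∧ g = 0) =
      ∑ e ∈ m.divisors, (e - 1) / 2 := by
  rw [quadCount, ncard_eq_sum_fiber (quadCount_finite
    (P := fun h g u k => (MinusSol m h g u k ∧ 0 < k) ∧ g = 0) fun _ _ _ _ h => h.1.1.bound)
    (fun v => (v.1 + 2 * v.2.2.2).toNat) m.divisors]
  · refine Finset.sum_congr rfl fun e he => ?_
    have he0 := Nat.pos_of_mem_divisors he
    obtain ⟨c, hc⟩ := Nat.dvd_of_mem_divisors he
    have hc' : (m : ℤ) = e * c := by exact_mod_cast hc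
    have heo : (e : ℤ) % 2 = 1 := odd_mul_left (b := c) (c := 0) (m := m) (by omega) (by linarith)
    have hco : (c : ℤ) % 2 = 1 := odd_mul_right (a := e) (c := 0) (m := m) (by omega) (by linarith)
    trans (Finset.Icc 1 ((e - 1) / 2) : Finset ℕ).card
    · rw [← Set.ncard_coe_finset]
      refine ncard_eq_of_inverse (fun v => v.2.2.2.toNat)
        (fun k => ((e : ℤ) - 2 * k, 0, (c : ℤ), (k : ℤ))) ?_ ?_
      · rintro ⟨h, g, u, k⟩ ⟨⟨⟨⟨h1, h2, h3, h4, h5, h6⟩, h7⟩, h8⟩, h9⟩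
        dsimp only at *
        subst h8
        have h9' : (e : ℤ) = h + 2 * k := by omega
        have hu : (c : ℤ) = u := by
          have : (e : ℤ) * c = e * u := by rw [← hc', h9', ← h6]; ring
          exact mul_left_cancel₀ (by omega) this
        constructor
        · simp only [Finset.coe_Icc, Set.mem_Icc]; omega
        · ext <;> dsimp only <;> omega
      · intro k hk
        simp only [Finset.coe_Icc, Set.mem_Icc] at hk
        refine ⟨⟨⟨⟨⟨?_, ?_, ?_, hco, ?_, ?_⟩, ?_⟩, rfl⟩, ?_⟩, ?_⟩ <;> dsimp only
        · omega
        · omega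
        · omega
        · omega
        · rw [hc']; ring
        · omega
        · omega
        · omega
    · simp
  · rintro ⟨h, g, u, k⟩ ⟨⟨⟨h1, h2, h3, h4, h5, h6⟩, h7⟩, h8⟩
    dsimp only at *
    subst h8
    rw [Nat.mem_divisors]
    refine ⟨?_, by omega⟩
    rw [← Int.natCast_dvd_natCast, Int.toNat_of_nonneg (by omega)]
    exact ⟨u, by rw [← h6]; ring⟩

theorem quadCount_mixedSol_eq_sum_divisors {m : ℕ} (hm : m % 2 = 1) :
    quadCount (MixedSol m) = ∑ e ∈ m.divisors, e := by
  rw [quadCount_mixedSol (by omega), minus_zero_zero hm, minus_pos_zero hm, Finset.mul_sum,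
    Finset.card_eq_sum_ones, ← Finset.sum_add_distrib]
  refine Finset.sum_congr rfl fun e he => ?_
  have : e % 2 = 1 := Nat.odd_iff.1 ((Nat.odd_iff.2 hm).of_dvd_nat (Nat.dvd_of_mem_divisors he))
  omega

/-- The number of representations of `n` as an ordered sum of two squares of integers. -/
noncomputable def twoSquares (n : ℤ) : ℕ := {v : ℤ × ℤ | v.1 ^ 2 + v.2 ^ 2 = n}.ncard

/-- The excess of divisors `≡ 1` over divisors `≡ 3` modulo `4`. -/
def chiSum (n : ℕ) : ℤ := ∑ d ∈ n.divisors, ZMod.χ₄ d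

theorem sq_add_sq_finite (n : ℤ) : {v : ℤ × ℤ | v.1 ^ 2 + v.2 ^ 2 = n}.Finite := by
  refine Set.Finite.subset (Set.finite_Icc ((-n, -n) : ℤ × ℤ) (n, n)) ?_
  rintro ⟨a, b⟩ h
  have h : a ^ 2 + b ^ 2 = n := h
  have ha := abs_le.1 (abs_le_sq_self a)
  have hb := abs_le.1 (abs_le_sq_self b)
  have := sq_nonneg a
  have := sq_nonneg b
  refine ⟨⟨?_, ?_⟩, ?_, ?_⟩ <;> dsimp only <;> linarith

theorem chiSum_prime_mul {p k : ℕ} (hp : p.Prime) (hk : 0 < k) :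
    chiSum (p * k) = (1 + ZMod.χ₄ p) * chiSum k
      - ZMod.χ₄ p * (if p ∣ k then chiSum (k / p) else 0) := by
  have hu : (p * k).divisors = k.divisors ∪ k.divisors.image (p * ·) := by
    ext d
    simp only [Nat.mem_divisors, Finset.mem_union, Finset.mem_image]
    constructor
    · rintro ⟨h, -⟩
      by_cases hd : p ∣ d
      · obtain ⟨e, rfl⟩ := hd
        exact Or.inr ⟨e, ⟨Nat.dvd_of_mul_dvd_mul_left hp.pos h, hk.ne'⟩, rfl⟩
      · exact Or.inl ⟨((hp.coprime_iff_not_dvd.2 hd).symm.dvd_of_dvd_mul_left h), hk.ne'⟩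
    · rintro (h | ⟨e, h, rfl⟩)
      · exact ⟨h.1.mul_left p, (Nat.mul_pos hp.pos hk).ne'⟩
      · exact ⟨Nat.mul_dvd_mul_left p h.1, (Nat.mul_pos hp.pos hk).ne'⟩
  have hinj : ∀ s : Finset ℕ, Set.InjOn (p * ·) (s : Set ℕ) :=
    fun s a _ b _ h => Nat.eq_of_mul_eq_mul_left hp.pos h
  have himg : ∀ s : Finset ℕ, ∑ d ∈ s.image (p * ·), ZMod.χ₄ (d : ZMod 4) =
      ZMod.χ₄ p * ∑ d ∈ s, ZMod.χ₄ (d : ZMod 4) := by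
    intro s
    rw [Finset.sum_image (hinj s), Finset.mul_sum]
    exact Finset.sum_congr rfl fun d _ => by rw [Nat.cast_mul, map_mul]
  have hi : k.divisors ∩ k.divisors.image (p * ·) =
      if p ∣ k then (k / p).divisors.image (p * ·) else ∅ := by
    ext d
    split_ifs with h
    · obtain ⟨e, rfl⟩ := h
      have he : e ≠ 0 := by rintro rfl; simp at hk
      simp only [Nat.mem_divisors, Finset.mem_inter, Finset.mem_image,
        Nat.mul_div_cancel_left e hp.pos]
      constructor
      · rintro ⟨⟨h1, -⟩, c, -, rfl⟩
        exact ⟨c, ⟨Nat.dvd_of_mul_dvd_mul_left hp.pos h1, he⟩, rfl⟩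
      · rintro ⟨c, ⟨h1, -⟩, rfl⟩
        exact ⟨⟨Nat.mul_dvd_mul_left p h1, hk.ne'⟩, c, ⟨h1.mul_left p, hk.ne'⟩, rfl⟩
    · simp only [Nat.mem_divisors, Finset.mem_inter, Finset.mem_image, Finset.notMem_empty,
        iff_false]
      rintro ⟨⟨h1, -⟩, c, -, rfl⟩
      exact h (dvd_of_mul_right_dvd h1)
  have := Finset.sum_union_inter (s₁ := k.divisors) (s₂ := k.divisors.image (p * ·))
    (f := fun d : ℕ => ZMod.χ₄ (d : ZMod 4))
  rw [← hu, hi, himg] at this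
  have hs : ∑ d ∈ (if p ∣ k then (k / p).divisors.image (p * ·) else ∅), ZMod.χ₄ (d : ZMod 4)
      = ZMod.χ₄ p * (if p ∣ k then chiSum (k / p) else 0) := by
    split_ifs with h
    · exact himg _
    · simp
  rw [hs] at this
  simp only [chiSum] at this ⊢
  linear_combination this

/-- Scaled representations as a sum of two squares. -/
theorem ncard_mul_sq_add_sq {p : ℕ} (hp : 0 < p) (k : ℕ) :
    {v : ℤ × ℤ | (p : ℤ) * (v.1 ^ 2 + v.2 ^ 2) = k}.ncard =
      if p ∣ k then twoSquares (k / p : ℕ) else 0 := by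
  split_ifs with h
  · obtain ⟨e, rfl⟩ := h
    rw [Nat.mul_div_cancel_left e hp, twoSquares]
    congr 1
    ext ⟨a, b⟩
    simp [hp.ne']
  · rw [Set.ncard_eq_zero (Set.Finite.subset (sq_add_sq_finite k) ?_)]
    · ext ⟨a, b⟩
      simp only [Set.mem_ofPred_eq, Set.mem_empty_iff_false, iff_false]
      intro h'
      exact h (Int.natCast_dvd_natCast.1 ⟨_, h'.symm⟩)
    · rintro ⟨a, b⟩ h'
      exact absurd (Int.natCast_dvd_natCast.1 ⟨_, h'.symm⟩) h

theorem ncard_sq_add_sq_dvd {p : ℕ} (hp : p.Prime) (k : ℕ) {A : Set (ℤ × ℤ)}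
    (hA : ∀ x y : ℤ, (x, y) ∈ A ↔ x ^ 2 + y ^ 2 = p * k ∧ (p : ℤ) ∣ x ∧ (p : ℤ) ∣ y) :
    A.ncard = if p ∣ k then twoSquares (k / p : ℕ) else 0 := by
  rw [← ncard_mul_sq_add_sq hp.pos]
  have hp0 : (p : ℤ) ≠ 0 := by exact_mod_cast hp.ne_zero
  refine ncard_eq_of_inverse (fun v => (v.1 / p, v.2 / p)) (fun v => (p * v.1, p * v.2)) ?_ ?_
  · rintro ⟨x, y⟩ h
    obtain ⟨h, ⟨a, rfl⟩, b, rfl⟩ := (hA x y).1 h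
    dsimp only
    rw [Int.mul_ediv_cancel_left _ hp0, Int.mul_ediv_cancel_left _ hp0]
    refine ⟨?_, rfl⟩
    apply mul_left_cancel₀ hp0
    simp only
    linear_combination h
  · rintro ⟨a, b⟩ h
    have h : (p : ℤ) * (a ^ 2 + b ^ 2) = k := h
    refine ⟨(hA _ _).2 ⟨by rw [← h]; ring, dvd_mul_right _ _, dvd_mul_right _ _⟩, ?_⟩
    dsimp only
    rw [Int.mul_ediv_cancel_left _ hp0, Int.mul_ediv_cancel_left _ hp0]

theorem twoSquares_prime_mul_three {p : ℕ} (hp : p.Prime) (h3 : p % 4 = 3) (k : ℕ) :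
    twoSquares (p * k : ℕ) = if p ∣ k then twoSquares (k / p : ℕ) else 0 := by
  refine ncard_sq_add_sq_dvd hp k fun x y => ?_
  simp only [Set.mem_ofPred_eq, Nat.cast_mul, iff_self_and]
  intro h
  have := Fact.mk hp
  have hz : (x : ZMod p) ^ 2 + (y : ZMod p) ^ 2 = 0 := by
    have := congrArg (Int.cast : ℤ → ZMod p) h
    push_cast at this
    simpa using this
  have hx : (x : ZMod p) = 0 := by
    by_contra hx
    exact ZMod.mod_four_ne_three_of_sq_eq_neg_sq' (x := (y : ZMod p)) hx
      (by linear_combination hz) h3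
  have hy : (y : ZMod p) = 0 := by
    rw [hx] at hz
    simpa using hz
  exact ⟨(ZMod.intCast_zmod_eq_zero_iff_dvd x p).1 hx, (ZMod.intCast_zmod_eq_zero_iff_dvd y p).1 hy⟩

theorem ncard_sq_add_sq_dvd_rotate {p : ℕ} (hp : p.Prime) (k : ℕ) {s t : ℤ}
    (hst : s ^ 2 + t ^ 2 = p) :
    {v : ℤ × ℤ | v.1 ^ 2 + v.2 ^ 2 = p * k ∧ (p : ℤ) ∣ s * v.1 + t * v.2}.ncard =
      twoSquares k := by
  have hp0 : (p : ℤ) ≠ 0 := by exact_mod_cast hp.ne_zero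
  refine ncard_eq_of_inverse (fun v => ((s * v.1 + t * v.2) / p, (s * v.2 - t * v.1) / p))
    (fun v => (s * v.1 - t * v.2, t * v.1 + s * v.2)) ?_ ?_
  · rintro ⟨x, y⟩ ⟨h1, h2⟩
    dsimp only at h1 h2 ⊢
    have h3 : (p : ℤ) ∣ s * y - t * x := by
      refine (Nat.prime_iff_prime_int.1 hp).dvd_of_dvd_pow (n := 2) ?_
      have : (s * y - t * x) ^ 2 = p * (p * k) - (s * x + t * y) ^ 2 := by
        rw [← h1]; nth_rewrite 1 [← hst]; ring
      rw [this]
      exact dvd_sub (dvd_mul_right _ _) (dvd_pow h2 two_ne_zero)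
    obtain ⟨a, ha⟩ := h2
    obtain ⟨b, hb⟩ := h3
    rw [ha, hb, Int.mul_ediv_cancel_left _ hp0, Int.mul_ediv_cancel_left _ hp0]
    have hx : s * a - t * b = x := by
      apply mul_left_cancel₀ hp0
      linear_combination (-s) * ha + t * hb + x * hst
    have hy : t * a + s * b = y := by
      apply mul_left_cancel₀ hp0
      linear_combination (-t) * ha - s * hb + y * hst
    refine ⟨?_, by rw [hx, hy]⟩
    apply mul_left_cancel₀ hp0
    rw [← h1, ← hx, ← hy, ← hst]
    ring
  · rintro ⟨a, b⟩ h
    have h : a ^ 2 + b ^ 2 = k := h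
    have e1 : s * (s * a - t * b) + t * (t * a + s * b) = p * a := by rw [← hst]; ring
    have e2 : s * (t * a + s * b) - t * (s * a - t * b) = p * b := by rw [← hst]; ring
    refine ⟨⟨?_, ?_⟩, ?_⟩ <;> dsimp only
    · rw [← hst, ← h]; ring
    · rw [e1]; exact dvd_mul_right _ _
    · rw [e1, e2, Int.mul_ediv_cancel_left _ hp0, Int.mul_ediv_cancel_left _ hp0]

theorem twoSquares_prime_mul_one {p : ℕ} (hp : p.Prime) (h1 : p % 4 = 1) (k : ℕ) :
    twoSquares (p * k : ℕ) + (if p ∣ k then twoSquares (k / p : ℕ) else 0) =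
      2 * twoSquares k := by
  have := Fact.mk hp
  obtain ⟨s, t, hst⟩ := Nat.Prime.sq_add_sq (p := p) (by omega)
  have hst : (s : ℤ) ^ 2 + (t : ℤ) ^ 2 = p := by exact_mod_cast hst
  have hst' : (s : ℤ) ^ 2 + (-t : ℤ) ^ 2 = p := by rw [← hst]; ring
  have hpr : Prime (p : ℤ) := Nat.prime_iff_prime_int.1 hp
  have hs : ¬ (p : ℤ) ∣ s := by
    intro h
    have ht : (p : ℤ) ∣ t := by
      refine (Nat.prime_iff_prime_int.1 hp).dvd_of_dvd_pow (n := 2) ?_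
      rw [show (t : ℤ) ^ 2 = p - s ^ 2 by rw [← hst]; ring]
      exact dvd_sub dvd_rfl (dvd_pow h two_ne_zero)
    have : (p : ℤ) * p ∣ p * 1 := by
      rw [mul_one]
      nth_rewrite 3 [← hst]
      rw [sq, sq]
      exact dvd_add (mul_dvd_mul h h) (mul_dvd_mul ht ht)
    exact hpr.not_dvd_one (Int.dvd_of_mul_dvd_mul_left hpr.ne_zero this)
  have h2 : ¬ (p : ℤ) ∣ 2 := by
    intro h
    have := Int.le_of_dvd two_pos h
    have := hp.two_le
    omega
  have hdvd : ∀ x y : ℤ, x ^ 2 + y ^ 2 = p * k →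
      (p : ℤ) ∣ s * x + t * y ∨ (p : ℤ) ∣ s * x + -t * y := by
    intro x y h
    refine hpr.dvd_or_dvd ⟨s ^ 2 * k - y ^ 2, ?_⟩
    linear_combination (s : ℤ) ^ 2 * h - y ^ 2 * hst
  set U : Set (ℤ × ℤ) := {v | v.1 ^ 2 + v.2 ^ 2 = p * k ∧ (p : ℤ) ∣ s * v.1 + t * v.2}
  set V : Set (ℤ × ℤ) := {v | v.1 ^ 2 + v.2 ^ 2 = p * k ∧ (p : ℤ) ∣ s * v.1 + -t * v.2}
  have hUV : U ∪ V = {v : ℤ × ℤ | v.1 ^ 2 + v.2 ^ 2 = (p * k : ℕ)} := by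
    ext ⟨x, y⟩
    simp only [U, V, Set.mem_union, Set.mem_ofPred_eq, Nat.cast_mul]
    constructor
    · rintro (h | h) <;> exact h.1
    · intro h
      rcases hdvd x y h with h' | h'
      · exact Or.inl ⟨h, h'⟩
      · exact Or.inr ⟨h, h'⟩
  have hI : (U ∩ V).ncard = if p ∣ k then twoSquares (k / p : ℕ) else 0 := by
    refine ncard_sq_add_sq_dvd hp k fun x y => ?_
    simp only [U, V, Set.mem_inter_iff, Set.mem_ofPred_eq]
    constructor
    · rintro ⟨⟨h, ha⟩, -, hb⟩
      have hx : (p : ℤ) ∣ x := by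
        have h3 : (p : ℤ) ∣ 2 * (s * x) := by
          have := dvd_add ha hb
          rwa [show s * x + t * y + (s * x + -t * y) = 2 * (s * x) by ring] at this
        exact (hpr.dvd_or_dvd ((hpr.dvd_or_dvd h3).resolve_left h2)).resolve_left hs
      refine ⟨h, hx, (Nat.prime_iff_prime_int.1 hp).dvd_of_dvd_pow (n := 2) ?_⟩
      rw [show y ^ 2 = p * k - x ^ 2 by rw [← h]; ring]
      exact dvd_sub (dvd_mul_right _ _) (dvd_pow hx two_ne_zero)
    · rintro ⟨h, hx, hy⟩
      exact ⟨⟨h, dvd_add (hx.mul_left _) (hy.mul_left _)⟩, h,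
        dvd_add (hx.mul_left _) (hy.mul_left _)⟩
  have hU : U.Finite := (sq_add_sq_finite (p * k)).subset fun v h => h.1
  have hV : V.Finite := (sq_add_sq_finite (p * k)).subset fun v h => h.1
  have := Set.ncard_union_add_ncard_inter U V hU hV
  rw [hUV, hI, ncard_sq_add_sq_dvd_rotate hp k hst, ncard_sq_add_sq_dvd_rotate hp k hst'] at this
  rw [twoSquares, this, two_mul]

theorem twoSquares_one : twoSquares 1 = 4 := by
  have : {v : ℤ × ℤ | v.1 ^ 2 + v.2 ^ 2 = 1} =
      (({(1, 0), (-1, 0), (0, 1), (0, -1)} : Finset (ℤ × ℤ)) : Set (ℤ × ℤ)) := by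
    ext ⟨a, b⟩
    simp only [Set.mem_ofPred_eq, Finset.coe_insert, Finset.coe_singleton, Set.mem_insert_iff,
      Set.mem_singleton_iff, Prod.mk.injEq]
    constructor
    · intro h
      have ha := abs_le.1 (abs_le_sq_self a)
      have hb := abs_le.1 (abs_le_sq_self b)
      have := sq_nonneg a
      have := sq_nonneg b
      have : -1 ≤ a := by linarith
      have : a ≤ 1 := by linarith
      have : -1 ≤ b := by linarith
      have : b ≤ 1 := by linarith
      interval_cases a <;> interval_cases b <;> simp_all
    · rintro (⟨rfl, rfl⟩ | ⟨rfl, rfl⟩ | ⟨rfl, rfl⟩ | ⟨rfl, rfl⟩) <;> norm_num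
  rw [twoSquares, this, Set.ncard_coe_finset]
  rfl

theorem twoSquares_eq {k : ℕ} (hk : k % 2 = 1) : (twoSquares k : ℤ) = 4 * chiSum k := by
  induction k using Nat.strong_induction_on with
  | _ k ih =>
    rcases eq_or_ne k 1 with rfl | h1
    · have : twoSquares ((1 : ℕ) : ℤ) = 4 := by exact_mod_cast twoSquares_one
      rw [this]
      simp [chiSum]
    obtain ⟨p, hp, e, rfl⟩ := Nat.exists_prime_and_dvd h1
    have he : 0 < e := Nat.pos_of_ne_zero (by rintro rfl; simp at hk)
    have hpo : p % 2 = 1 := Nat.odd_iff.1 (Nat.odd_mul.1 (Nat.odd_iff.2 hk)).1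
    have heo : e % 2 = 1 := Nat.odd_iff.1 (Nat.odd_mul.1 (Nat.odd_iff.2 hk)).2
    have hlt : e < p * e := by nlinarith [hp.two_le]
    have ih1 := ih e hlt heo
    have ih2 : (((if p ∣ e then twoSquares (e / p : ℕ) else 0 : ℕ)) : ℤ) =
        4 * (if p ∣ e then chiSum (e / p) else 0) := by
      split_ifs with h
      · obtain ⟨f, rfl⟩ := h
        rw [Nat.mul_div_cancel_left f hp.pos]
        exact ih f (lt_of_le_of_lt (Nat.le_mul_of_pos_left f hp.pos) hlt)
          (Nat.odd_iff.1 (Nat.odd_mul.1 (Nat.odd_iff.2 heo)).2)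
      · simp
    rw [chiSum_prime_mul hp he]
    have hp4 : p % 4 = 1 ∨ p % 4 = 3 := by omega
    rcases hp4 with h | h
    · rw [ZMod.χ₄_nat_one_mod_four h]
      have := congrArg (Nat.cast : ℕ → ℤ) (twoSquares_prime_mul_one hp h e)
      rw [Nat.cast_add, Nat.cast_mul 2, ih2, ih1] at this
      rw [Nat.cast_ofNat] at this
      linear_combination this
    · rw [ZMod.χ₄_nat_three_mod_four h]
      have := twoSquares_prime_mul_three hp h e
      rw [this, ih2]
      ring

/-- Positive odd solutions of `ab + cd = n`. -/
def OddSol (n a b c d : ℤ) : Prop :=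
  (0 < a ∧ 0 < b ∧ 0 < c ∧ 0 < d) ∧ (a % 2 = 1 ∧ b % 2 = 1 ∧ c % 2 = 1 ∧ d % 2 = 1) ∧
    a * b + c * d = n

theorem OddSol.bound {n a b c d : ℤ} (H : OddSol n a b c d) :
    |a| ≤ n ∧ |b| ≤ n ∧ |c| ≤ n ∧ |d| ≤ n := by
  obtain ⟨⟨h1, h2, h3, h4⟩, -, h5⟩ := H
  rw [abs_of_pos h1, abs_of_pos h2, abs_of_pos h3, abs_of_pos h4]
  have := mul_pos h1 h2
  have := mul_pos h3 h4
  refine ⟨?_, ?_, ?_, ?_⟩ <;> nlinarith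

theorem oddSol_finite (n : ℤ) :
    {v : ℤ × ℤ × ℤ × ℤ | OddSol n v.1 v.2.1 v.2.2.1 v.2.2.2}.Finite :=
  quadCount_finite (P := OddSol n) fun _ _ _ _ h => h.bound

/-- The finite set of positive odd solutions of `ab + cd = n`. -/
noncomputable def oddSols (n : ℤ) : Finset (ℤ × ℤ × ℤ × ℤ) := (oddSol_finite n).toFinset

theorem mem_oddSols {n a b c d : ℤ} : (a, b, c, d) ∈ oddSols n ↔ OddSol n a b c d := by
  simp [oddSols]

/-- The value of `χ₄ a * χ₄ c` at odd integers `a`, `c`. -/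
def chiProd (a c : ℤ) : ℤ := if (a - c) % 4 = 0 then 1 else -1

theorem chi_mul_chi {a c : ℤ} (ha : a % 2 = 1) (hc : c % 2 = 1) :
    ZMod.χ₄ a * ZMod.χ₄ c = chiProd a c := by
  have ha : a % 4 = 1 ∨ a % 4 = 3 := by omega
  have hc : c % 4 = 1 ∨ c % 4 = 3 := by omega
  rcases ha with ha | ha <;> rcases hc with hc | hc <;>
    simp only [chiProd, ZMod.χ₄_int_one_mod_four, ZMod.χ₄_int_three_mod_four, ha, hc]
  · rw [if_pos (by omega)]; rfl
  · rw [if_neg (by omega)]; rfl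
  · rw [if_neg (by omega)]; rfl
  · rw [if_pos (by omega)]; rfl

theorem oddSol_dichotomy {n a b c d : ℤ} (hn : n % 4 = 2) (H : OddSol n a b c d) :
    (a - c) % 4 = 0 ↔ ¬ (b + d) % 4 = 0 := by
  obtain ⟨-, ⟨h1, h2, h3, h4⟩, h5⟩ := H
  have ha : a % 4 = 1 ∨ a % 4 = 3 := by omega
  have hb : b % 4 = 1 ∨ b % 4 = 3 := by omega
  have hc : c % 4 = 1 ∨ c % 4 = 3 := by omega
  have hd : d % 4 = 1 ∨ d % 4 = 3 := by omega
  have h6 : ((a % 4) * (b % 4) + (c % 4) * (d % 4)) % 4 = 2 := by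
    rw [← hn, ← h5]
    simp [Int.add_emod, Int.mul_emod]
  rcases ha with ha | ha <;> rcases hb with hb | hb <;> rcases hc with hc | hc <;>
    rcases hd with hd | hd <;> rw [ha, hb, hc, hd] at h6 <;> omega

/-- The sign-reversing involution on odd solutions with `c < a`. -/
def flipSol (v : ℤ × ℤ × ℤ × ℤ) : ℤ × ℤ × ℤ × ℤ :=
  let t := v.1 / (v.1 - v.2.2.1)
  (v.2.1 + t * (v.2.1 + v.2.2.2), v.1 - t * (v.1 - v.2.2.1),
    -v.2.2.2 + t * (v.2.1 + v.2.2.2), -v.2.2.1 + t * (v.1 - v.2.2.1))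

theorem flipSol_oddSol {n a b c d : ℤ} (H : OddSol n a b c d) (hac : c < a) :
    ∃ a' b' c' d', flipSol (a, b, c, d) = (a', b', c', d') ∧ OddSol n a' b' c' d' ∧ c' < a' ∧
      a' - c' = b + d ∧ flipSol (a', b', c', d') = (a, b, c, d) := by
  obtain ⟨⟨h1, h2, h3, h4⟩, ⟨o1, o2, o3, o4⟩, h5⟩ := H
  set t := a / (a - c) with ht
  have hx : 0 < a - c := by omega
  have hy : 0 < b + d := by omega
  have ht1 : 1 ≤ t := by
    rw [ht, Int.le_ediv_iff_mul_le hx]; omega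
  have hlt := Int.emod_lt_of_pos a hx
  have hge := Int.emod_nonneg a hx.ne'
  rw [Int.emod_def, ← ht, mul_comm] at hlt hge
  obtain ⟨x, hx2⟩ : ∃ x, t * (a - c) = 2 * (t * x) := ⟨(a - c) / 2, by
    rw [mul_left_comm]; congr 1; omega⟩
  obtain ⟨y, hy2⟩ : ∃ y, t * (b + d) = 2 * (t * y) := ⟨(b + d) / 2, by
    rw [mul_left_comm]; congr 1; omega⟩
  have hty : b + d ≤ t * (b + d) := le_mul_of_one_le_left hy.le ht1
  have ht2 : (b + t * (b + d)) / (b + t * (b + d) - (-d + t * (b + d))) = t := by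
    rw [show b + t * (b + d) - (-d + t * (b + d)) = b + d by ring, Int.add_mul_ediv_right _ _ hy.ne',
      Int.ediv_eq_zero_of_lt h2.le (by omega), zero_add]
  refine ⟨_, _, _, _, rfl, ⟨⟨?_, ?_, ?_, ?_⟩, ⟨?_, ?_, ?_, ?_⟩, ?_⟩, ?_, ?_, ?_⟩ <;>
    dsimp only [flipSol] <;> rw [← ht]
  iterate 8 omega
  · rw [← h5]; ring
  · omega
  · ring
  · rw [ht2]
    ext <;> dsimp only <;> ring

theorem sum_oddSols_lt {n : ℤ} (hn : n % 4 = 2) :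
    ∑ v ∈ oddSols n with v.2.2.1 < v.1, chiProd v.1 v.2.2.1 = 0 := by
  have key : ∀ v ∈ (oddSols n).filter (fun v => v.2.2.1 < v.1),
      chiProd v.1 v.2.2.1 + chiProd (flipSol v).1 (flipSol v).2.2.1 = 0 ∧
        flipSol v ∈ (oddSols n).filter (fun v => v.2.2.1 < v.1) ∧ flipSol (flipSol v) = v := by
    rintro ⟨a, b, c, d⟩ hv
    rw [Finset.mem_filter, mem_oddSols] at hv
    obtain ⟨a', b', c', d', e1, e2, e3, e4, e5⟩ := flipSol_oddSol hv.1 hv.2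
    rw [e1, Finset.mem_filter, mem_oddSols]
    refine ⟨?_, ⟨e2, e3⟩, e5⟩
    have := oddSol_dichotomy hn hv.1
    dsimp only [chiProd]
    rw [e4]
    split_ifs <;> first | rfl | omega
  refine Finset.sum_involution (fun v _ => flipSol v) (fun v hv => (key v hv).1) ?_
    (fun v hv => (key v hv).2.1) (fun v hv => (key v hv).2.2)
  intro v hv h h'
  have := (key v hv).1
  rw [h'] at this
  omega

theorem sum_oddSols_gt {n : ℤ} (hn : n % 4 = 2) :
    ∑ v ∈ oddSols n with v.1 < v.2.2.1, chiProd v.1 v.2.2.1 = 0 := by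
  rw [← sum_oddSols_lt hn]
  refine Finset.sum_nbij' (fun v => (v.2.2.1, v.2.2.2, v.1, v.2.1))
    (fun v => (v.2.2.1, v.2.2.2, v.1, v.2.1)) ?_ ?_ (fun _ _ => rfl) (fun _ _ => rfl) ?_
  iterate 2
    rintro ⟨a, b, c, d⟩ hv
    rw [Finset.mem_filter, mem_oddSols] at hv ⊢
    obtain ⟨⟨⟨h1, h2, h3, h4⟩, ⟨o1, o2, o3, o4⟩, h5⟩, h6⟩ := hv
    exact ⟨⟨⟨h3, h4, h1, h2⟩, ⟨o3, o4, o1, o2⟩, by rw [← h5]; ring⟩, h6⟩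
  · rintro ⟨a, b, c, d⟩ -
    dsimp only [chiProd]
    split_ifs <;> first | rfl | omega

theorem card_oddSols_eq {m : ℕ} (hm : m % 2 = 1) :
    quadCount (fun a b c d => OddSol (2 * m : ℕ) a b c d ∧ a = c) = ∑ e ∈ m.divisors, e := by
  rw [quadCount, ncard_eq_sum_fiber (quadCount_finite
    (P := fun a b c d => OddSol (2 * m : ℕ) a b c d ∧ a = c) fun _ _ _ _ h => h.1.bound)
    (fun v => v.1.toNat) m.divisors, ← Nat.sum_div_divisors m fun e => e]
  · refine Finset.sum_congr rfl fun e he => ?_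
    have he0 := Nat.pos_of_mem_divisors he
    obtain ⟨c, hc⟩ := Nat.dvd_of_mem_divisors he
    have hc' : (m : ℤ) = e * c := by exact_mod_cast hc
    have heo : (e : ℤ) % 2 = 1 := odd_mul_left (b := c) (c := 0) (m := m) (by omega) (by linarith)
    have hco : (c : ℤ) % 2 = 1 := odd_mul_right (a := e) (c := 0) (m := m) (by omega) (by linarith)
    rw [hc, Nat.mul_div_cancel_left c he0]
    trans (Finset.range c).card
    · rw [← Set.ncard_coe_finset]
      refine ncard_eq_of_inverse (fun v => (v.2.1 / 2).toNat)
        (fun k => ((e : ℤ), 2 * (k : ℤ) + 1, (e : ℤ), 2 * c - 2 * (k : ℤ) - 1)) ?_ ?_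
      · rintro ⟨a, b, c', d⟩ ⟨⟨⟨⟨h1, h2, h3, h4⟩, ⟨o1, o2, o3, o4⟩, h5⟩, h6⟩, h7⟩
        dsimp only at *
        subst h6
        have h8 : (e : ℤ) = a := by omega
        have hu : 2 * (c : ℤ) = b + d := by
          refine mul_left_cancel₀ h1.ne' ?_
          rw [mul_add, h5, ← h8]; push_cast; ring
        constructor
        · simp only [Finset.coe_range, Set.mem_Iio]; omega
        · ext <;> dsimp only <;> omega
      · intro k hk
        simp only [Finset.coe_range, Set.mem_Iio] at hk
        refine ⟨⟨⟨⟨⟨?_, ?_, ?_, ?_⟩, ⟨?_, ?_, ?_, ?_⟩, ?_⟩, rfl⟩, ?_⟩, ?_⟩ <;> dsimp only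
        iterate 8 omega
        · push_cast; ring
        · omega
        · omega
    · simp
  · rintro ⟨a, b, c, d⟩ ⟨⟨⟨h1, h2, h3, h4⟩, ⟨o1, o2, o3, o4⟩, h5⟩, h6⟩
    dsimp only at *
    subst h6
    rw [Nat.mem_divisors]
    refine ⟨?_, by omega⟩
    rw [← Int.natCast_dvd_natCast, Int.toNat_of_nonneg (by omega)]
    refine ⟨(b + d) / 2, ?_⟩
    have : 2 * (m : ℤ) = 2 * (a * ((b + d) / 2)) := by
      rw [mul_left_comm, Int.mul_ediv_cancel' (by omega), mul_add, h5]
      push_cast; rfl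
    omega

theorem sum_oddSols {m : ℕ} (hm : m % 2 = 1) :
    ∑ v ∈ oddSols (2 * m : ℕ), chiProd v.1 v.2.2.1 = ∑ e ∈ m.divisors, (e : ℤ) := by
  have hn : ((2 * m : ℕ) : ℤ) % 4 = 2 := by omega
  rw [← Finset.sum_filter_add_sum_filter_not _ (fun v => v.2.2.1 < v.1), sum_oddSols_lt hn,
    zero_add, ← Finset.sum_filter_add_sum_filter_not _ (fun v => v.1 < v.2.2.1)]
  rw [Finset.filter_filter, Finset.filter_filter]
  rw [Finset.filter_congr (q := fun v => v.1 < v.2.2.1) (fun v _ => by omega), sum_oddSols_gt hn,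
    zero_add, ← Nat.cast_sum, ← card_oddSols_eq hm, quadCount, Finset.sum_congr rfl (g := fun _ => 1)]
  · rw [Finset.sum_const, ← Set.ncard_coe_finset, nsmul_eq_mul, mul_one]
    congr 2
    ext ⟨a, b, c, d⟩
    simp only [Finset.coe_filter, mem_oddSols, Set.mem_ofPred_eq]
    exact and_congr_right fun _ => by omega
  · rintro ⟨a, b, c, d⟩ h
    simp only [Finset.mem_filter] at h
    obtain rfl : a = c := by omega
    simp [chiProd]

theorem sum_chiSum_mul_chiSum {m : ℕ} (hm : m % 2 = 1) :
    ∑ k ∈ Finset.range (2 * m) with k % 2 = 1, chiSum k * chiSum (2 * m - k) =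
      ∑ e ∈ m.divisors, (e : ℤ) := by
  rw [← sum_oddSols hm]
  simp only [chiSum, Finset.sum_mul_sum, ← Finset.sum_product']
  rw [Finset.sum_sigma']
  have key : ∀ v ∈ ((Finset.range (2 * m)).filter (fun k => k % 2 = 1)).sigma
      (fun k => k.divisors ×ˢ (2 * m - k).divisors), ∃ a b c d : ℕ,
      v = ⟨a * b, a, c⟩ ∧ (2 * m - a * b) = c * d ∧ OddSol (2 * m : ℕ) a b c d := by
    rintro ⟨k, a, c⟩ h
    simp only [Finset.mem_sigma, Finset.mem_filter, Finset.mem_range, Finset.mem_product,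
      Nat.mem_divisors] at h
    obtain ⟨⟨hk, hko⟩, ⟨⟨b, rfl⟩, h1⟩, ⟨d, hd⟩, h2⟩ := h
    refine ⟨a, b, c, d, rfl, hd, ?_⟩
    have o1 := Nat.odd_mul.1 (Nat.odd_iff.2 hko)
    have o2 := Nat.odd_mul.1 (Nat.odd_iff.2 (show c * d % 2 = 1 by omega))
    have o3 := Nat.odd_iff.1 o1.1
    have o4 := Nat.odd_iff.1 o1.2
    have o5 := Nat.odd_iff.1 o2.1
    have o6 := Nat.odd_iff.1 o2.2
    exact ⟨⟨by omega, by omega, by omega, by omega⟩, ⟨by omega, by omega, by omega, by omega⟩,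
      by exact_mod_cast (show a * b + c * d = 2 * m by omega)⟩
  refine Finset.sum_bij' (fun v _ => ((v.2.1 : ℤ), ((v.1 / v.2.1 : ℕ) : ℤ), (v.2.2 : ℤ),
      (((2 * m - v.1) / v.2.2 : ℕ) : ℤ)))
    (fun v _ => ⟨(v.1 * v.2.1).toNat, (v.1.toNat, v.2.2.1.toNat)⟩) ?_ ?_ ?_ ?_ ?_
  · intro v h
    obtain ⟨a, b, c, d, rfl, h1, h2⟩ := key v h
    have ha : 0 < a := by exact_mod_cast h2.1.1
    have hc : 0 < c := by exact_mod_cast h2.1.2.2.1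
    dsimp only
    rw [h1, Nat.mul_div_cancel_left _ ha, Nat.mul_div_cancel_left _ hc, mem_oddSols]
    exact h2
  · rintro ⟨a, b, c, d⟩ h
    obtain ⟨⟨h1, h2, h3, h4⟩, ⟨o1, o2, o3, o4⟩, h5⟩ := mem_oddSols.1 h
    lift a to ℕ using h1.le
    lift b to ℕ using h2.le
    lift c to ℕ using h3.le
    lift d to ℕ using h4.le
    norm_cast at *
    simp only [Finset.mem_sigma, Finset.mem_filter, Finset.mem_range, Finset.mem_product,
      Nat.mem_divisors, Int.toNat_natCast]
    have := Nat.mul_pos h1 h2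
    have := Nat.mul_pos h3 h4
    exact ⟨⟨by omega, Nat.odd_iff.1 ((Nat.odd_iff.2 o1).mul (Nat.odd_iff.2 o2))⟩,
      ⟨dvd_mul_right _ _, by omega⟩, ⟨d, by omega⟩, by omega⟩
  · intro v h
    obtain ⟨a, b, c, d, rfl, h1, h2⟩ := key v h
    have ha : 0 < a := by exact_mod_cast h2.1.1
    dsimp only
    rw [Nat.mul_div_cancel_left _ ha, ← Nat.cast_mul]
    simp only [Int.toNat_natCast]
  · rintro ⟨a, b, c, d⟩ h
    obtain ⟨⟨h1, h2, h3, h4⟩, ⟨o1, o2, o3, o4⟩, h5⟩ := mem_oddSols.1 h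
    lift a to ℕ using h1.le
    lift b to ℕ using h2.le
    lift c to ℕ using h3.le
    lift d to ℕ using h4.le
    dsimp only
    norm_cast at *
    rw [Nat.mul_div_cancel_left _ h1, show 2 * m - a * b = c * d by omega,
      Nat.mul_div_cancel_left _ h3]
  · intro v h
    obtain ⟨a, b, c, d, rfl, h1, h2⟩ := key v h
    dsimp only
    rw [← chi_mul_chi h2.2.1.1 h2.2.1.2.2.1]
    push_cast
    rfl

theorem sq_emod_four (x : ℤ) : x ^ 2 % 4 = x % 2 := by
  rcases Int.emod_two_eq_zero_or_one x with h | h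
  · obtain ⟨k, rfl⟩ : ∃ k, x = 2 * k := ⟨x / 2, by omega⟩
    rw [show (2 * k) ^ 2 = 4 * k ^ 2 by ring]
    omega
  · obtain ⟨k, rfl⟩ : ∃ k, x = 2 * k + 1 := ⟨x / 2, by omega⟩
    rw [show (2 * k + 1) ^ 2 = 4 * (k ^ 2 + k) + 1 by ring]
    omega

/-- The number of representations of `n` as the sum of an odd square and an even square. -/
noncomputable def oddEvenSquares (n : ℤ) : ℕ :=
  {v : ℤ × ℤ | (v.1 % 2 = 1 ∧ v.2 % 2 = 0) ∧ v.1 ^ 2 + v.2 ^ 2 = n}.ncard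

theorem twoSquares_eq_two_mul {n : ℤ} (hn : n % 2 = 1) :
    twoSquares n = 2 * oddEvenSquares n := by
  rw [twoSquares, ncard_split (sq_add_sq_finite n) (fun v => v.1 % 2 = 1), two_mul]
  congr 1
  · rw [oddEvenSquares]
    congr 1
    ext ⟨x, y⟩
    have := sq_emod_four x
    have := sq_emod_four y
    simp only [Set.mem_ofPred_eq]
    constructor
    · rintro ⟨h1, h2⟩
      exact ⟨⟨h2, by omega⟩, h1⟩
    · rintro ⟨⟨h1, h2⟩, h3⟩
      exact ⟨h3, h1⟩
  · refine ncard_eq_of_inverse Prod.swap Prod.swap ?_ ?_ <;> rintro ⟨x, y⟩ h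
    · have h1 : x ^ 2 + y ^ 2 = n := h.1
      have h2 : ¬ x % 2 = 1 := h.2
      have := sq_emod_four x
      have := sq_emod_four y
      exact ⟨⟨⟨show y % 2 = 1 by omega, show x % 2 = 0 by omega⟩, by rw [← h1]; exact add_comm _ _⟩,
        rfl⟩
    · have h1 : x ^ 2 + y ^ 2 = n := h.2
      have h2 : y % 2 = 0 := h.1.2
      exact ⟨⟨by rw [← h1]; exact add_comm _ _, show ¬ y % 2 = 1 by omega⟩, rfl⟩

/-- Representations of `n` as a sum of four squares. -/
def FourSq (n x y z w : ℤ) : Prop := x ^ 2 + y ^ 2 + z ^ 2 + w ^ 2 = n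

theorem FourSq.bound {n x y z w : ℤ} (h : FourSq n x y z w) :
    |x| ≤ n ∧ |y| ≤ n ∧ |z| ≤ n ∧ |w| ≤ n := by
  have h : x ^ 2 + y ^ 2 + z ^ 2 + w ^ 2 = n := h
  have := abs_le_sq_self x
  have := abs_le_sq_self y
  have := abs_le_sq_self z
  have := abs_le_sq_self w
  have := sq_nonneg x
  have := sq_nonneg y
  have := sq_nonneg z
  have := sq_nonneg w
  refine ⟨?_, ?_, ?_, ?_⟩ <;> linarith

theorem fourSq_odd_even {m : ℕ} (hm : m % 2 = 1) :
    quadCount (fun x y z w => FourSq (2 * m : ℕ) x y z w ∧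
      (x % 2 = 1 ∧ y % 2 = 0) ∧ z % 2 = 1 ∧ w % 2 = 0) = 4 * ∑ e ∈ m.divisors, e := by
  have h : quadCount (fun x y z w => FourSq (2 * m : ℕ) x y z w ∧
      (x % 2 = 1 ∧ y % 2 = 0) ∧ z % 2 = 1 ∧ w % 2 = 0) =
      ∑ k ∈ Finset.range (2 * m) with k % 2 = 1,
        oddEvenSquares (k : ℕ) * oddEvenSquares (2 * m - k : ℕ) := by
    rw [quadCount, ncard_eq_sum_fiber (quadCount_finite
      (P := fun x y z w => FourSq (2 * m : ℕ) x y z w ∧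
        (x % 2 = 1 ∧ y % 2 = 0) ∧ z % 2 = 1 ∧ w % 2 = 0) fun _ _ _ _ h => h.1.bound)
      (fun v => (v.1 ^ 2 + v.2.1 ^ 2).toNat)
      ((Finset.range (2 * m)).filter fun k => k % 2 = 1)]
    · refine Finset.sum_congr rfl fun k hk => ?_
      rw [Finset.mem_filter, Finset.mem_range] at hk
      rw [oddEvenSquares, oddEvenSquares, ← Set.ncard_prod]
      refine ncard_eq_of_inverse (fun v => ((v.1, v.2.1), (v.2.2.1, v.2.2.2)))
        (fun v => (v.1.1, v.1.2, v.2.1, v.2.2)) ?_ ?_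
      · rintro ⟨x, y, z, w⟩ ⟨⟨h1, h2, h3⟩, h4⟩
        dsimp only [FourSq] at *
        have := sq_nonneg x
        have := sq_nonneg y
        exact ⟨⟨⟨h2, show x ^ 2 + y ^ 2 = _ by omega⟩, h3, show z ^ 2 + w ^ 2 = _ by omega⟩, rfl⟩
      · rintro ⟨⟨x, y⟩, z, w⟩ ⟨⟨h1, h2⟩, h3, h4⟩
        dsimp only at *
        exact ⟨⟨⟨show x ^ 2 + y ^ 2 + z ^ 2 + w ^ 2 = _ by omega, h1, h3⟩, by dsimp only; omega⟩, rfl⟩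
    · rintro ⟨x, y, z, w⟩ ⟨h1, ⟨h2, h3⟩, h4, h5⟩
      dsimp only [FourSq] at *
      rw [Finset.mem_filter, Finset.mem_range]
      have := sq_nonneg x
      have := sq_nonneg y
      have := sq_nonneg z
      have := sq_nonneg w
      have := sq_emod_four x
      have := sq_emod_four y
      have := sq_emod_four z
      have := sq_emod_four w
      omega
  rw [h]
  have h2 : ∀ k : ℕ, k % 2 = 1 → (oddEvenSquares k : ℤ) = 2 * chiSum k := by
    intro k hk
    have e1 := twoSquares_eq hk
    rw [twoSquares_eq_two_mul (by omega), Nat.cast_mul, Nat.cast_ofNat] at e1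
    omega
  have h3 := sum_chiSum_mul_chiSum hm
  have : ((∑ k ∈ Finset.range (2 * m) with k % 2 = 1,
        oddEvenSquares (k : ℕ) * oddEvenSquares (2 * m - k : ℕ) : ℕ) : ℤ) =
      4 * ∑ e ∈ m.divisors, (e : ℤ) := by
    rw [← h3, Nat.cast_sum, Finset.mul_sum]
    refine Finset.sum_congr rfl fun k hk => ?_
    rw [Finset.mem_filter, Finset.mem_range] at hk
    rw [Nat.cast_mul, h2 _ hk.2, h2 _ (by omega)]
    ring
  apply Nat.cast_injective (R := ℤ)
  rw [this, Nat.cast_mul, Nat.cast_sum]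
  rfl

theorem fourSq_even {m : ℕ} (hm : m % 2 = 1) :
    quadCount (fun x y z w => FourSq (2 * m : ℕ) x y z w ∧ w % 2 = 0) =
      12 * ∑ e ∈ m.divisors, e := by
  have e0 := fourSq_odd_even hm
  have hmod : ∀ {x y z w : ℤ}, FourSq (2 * m : ℕ) x y z w →
      (x % 2 + y % 2 + z % 2 + w % 2) % 4 = 2 := by
    intro x y z w h
    have h : x ^ 2 + y ^ 2 + z ^ 2 + w ^ 2 = (2 * m : ℕ) := h
    have := sq_emod_four x
    have := sq_emod_four y
    have := sq_emod_four z
    have := sq_emod_four w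
    omega
  rw [quadCount_split (P := fun x y z w => FourSq (2 * m : ℕ) x y z w ∧ w % 2 = 0)
    (fun _ y _ _ => y % 2 = 0) (fun _ _ _ _ h => h.1.bound),
    quadCount_split (P := fun x y z w => (FourSq (2 * m : ℕ) x y z w ∧ w % 2 = 0) ∧ ¬ y % 2 = 0)
    (fun x _ _ _ => x % 2 = 0) (fun _ _ _ _ h => h.1.1.bound)]
  have e1 : quadCount (fun x y z w => (FourSq (2 * m : ℕ) x y z w ∧ w % 2 = 0) ∧ y % 2 = 0) =
      4 * ∑ e ∈ m.divisors, e := by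
    rw [← e0]
    refine quadCount_congr fun x y z w => ⟨?_, ?_⟩
    · rintro ⟨⟨h1, h2⟩, h3⟩
      have := hmod h1
      exact ⟨h1, ⟨by omega, h3⟩, by omega, h2⟩
    · rintro ⟨h1, ⟨h2, h3⟩, h4, h5⟩
      exact ⟨⟨h1, h5⟩, h3⟩
  have e2 : quadCount (fun x y z w => ((FourSq (2 * m : ℕ) x y z w ∧ w % 2 = 0) ∧ ¬ y % 2 = 0) ∧
      x % 2 = 0) = 4 * ∑ e ∈ m.divisors, e := by
    rw [← e0]
    refine quadCount_eq_of_inverse (fun v => (v.2.1, v.1, v.2.2)) (fun v => (v.2.1, v.1, v.2.2))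
      ?_ ?_
    · rintro x y z w ⟨⟨⟨h1, h2⟩, h3⟩, h4⟩
      have := hmod h1
      refine ⟨⟨?_, ⟨?_, h4⟩, ?_, h2⟩, rfl⟩ <;> dsimp only
      · rw [← h1, FourSq]; ring
      · omega
      · omega
    · rintro x y z w ⟨h1, ⟨h2, h3⟩, h4, h5⟩
      refine ⟨⟨⟨⟨?_, h5⟩, ?_⟩, h3⟩, rfl⟩ <;> dsimp only
      · rw [← h1, FourSq]; ring
      · omega
  have e3 : quadCount (fun x y z w => ((FourSq (2 * m : ℕ) x y z w ∧ w % 2 = 0) ∧ ¬ y % 2 = 0) ∧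
      ¬ x % 2 = 0) = 4 * ∑ e ∈ m.divisors, e := by
    rw [← e0]
    refine quadCount_eq_of_inverse (fun v => (v.1, v.2.2.1, v.2.1, v.2.2.2))
      (fun v => (v.1, v.2.2.1, v.2.1, v.2.2.2)) ?_ ?_
    · rintro x y z w ⟨⟨⟨h1, h2⟩, h3⟩, h4⟩
      have := hmod h1
      refine ⟨⟨?_, ⟨?_, ?_⟩, ?_, h2⟩, rfl⟩ <;> dsimp only
      · rw [← h1, FourSq]; ring
      · omega
      · omega
      · omega
    · rintro x y z w ⟨h1, ⟨h2, h3⟩, h4, h5⟩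
      refine ⟨⟨⟨⟨?_, h5⟩, ?_⟩, ?_⟩, rfl⟩ <;> dsimp only
      · rw [← h1, FourSq]; ring
      · omega
      · omega
  rw [e1, e2, e3]
  ring

/-- The number of representations of an integer as a sum of three squares. -/
noncomputable def threeSquares (n : ℤ) : ℕ :=
  {v : ℤ × ℤ × ℤ | v.1 ^ 2 + v.2.1 ^ 2 + v.2.2 ^ 2 = n}.ncard

/-- The number of solutions of `x(y+z) + 2yz = m` with `x, z > 0` and `y ≥ 0`. -/
noncomputable def mixedCount (m : ℤ) : ℕ :=
  {v : ℤ × ℤ × ℤ | 0 < v.1 ∧ 0 ≤ v.2.1 ∧ 0 < v.2.2 ∧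
    v.1 * (v.2.1 + v.2.2) + 2 * v.2.1 * v.2.2 = m}.ncard

theorem fourSq_even_eq_sum (m : ℤ) :
    quadCount (fun x y z w => FourSq (2 * m) x y z w ∧ w % 2 = 0) =
      ∑ t ∈ Finset.Icc (-(2 * m)) (2 * m), threeSquares (2 * (m - 2 * t ^ 2)) := by
  rw [quadCount, ncard_eq_sum_fiber (quadCount_finite
    (P := fun x y z w => FourSq (2 * m) x y z w ∧ w % 2 = 0) fun _ _ _ _ h => h.1.bound)
    (fun v => v.2.2.2 / 2) (Finset.Icc (-(2 * m)) (2 * m))]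
  · refine Finset.sum_congr rfl fun t ht => ?_
    refine ncard_eq_of_inverse (fun v => (v.1, v.2.1, v.2.2.1))
      (fun v => (v.1, v.2.1, v.2.2, 2 * t)) ?_ ?_
    · rintro ⟨x, y, z, w⟩ ⟨⟨h1, h2⟩, h3⟩
      dsimp only [FourSq] at *
      obtain rfl : w = 2 * t := by omega
      exact ⟨show x ^ 2 + y ^ 2 + z ^ 2 = _ by linear_combination h1, rfl⟩
    · rintro ⟨x, y, z⟩ h
      have h : x ^ 2 + y ^ 2 + z ^ 2 = 2 * (m - 2 * t ^ 2) := h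
      refine ⟨⟨⟨?_, ?_⟩, ?_⟩, rfl⟩ <;> dsimp only [FourSq]
      · linear_combination h
      · omega
      · omega
  · rintro ⟨x, y, z, w⟩ ⟨h1, h2⟩
    have := abs_le.1 h1.bound.2.2.2
    dsimp only at *
    rw [Finset.mem_Icc]
    omega

theorem mixedSol_eq_sum (m : ℤ) :
    quadCount (MixedSol m) = ∑ t ∈ Finset.Icc (-(2 * m)) (2 * m), mixedCount (m - 2 * t ^ 2) := by
  rw [quadCount, ncard_eq_sum_fiber (quadCount_finite
    (P := MixedSol m) fun _ _ _ _ h => h.bound)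
    (fun v => v.2.2.2) (Finset.Icc (-(2 * m)) (2 * m))]
  · refine Finset.sum_congr rfl fun t ht => ?_
    refine ncard_eq_of_inverse (fun v => (v.1, v.2.1, v.2.2.1))
      (fun v => (v.1, v.2.1, v.2.2, t)) ?_ ?_
    · rintro ⟨x, y, z, w⟩ ⟨⟨h1, h2, h3, h4⟩, h5⟩
      dsimp only at *
      subst h5
      exact ⟨⟨h1, h2, h3, by linear_combination h4⟩, rfl⟩
    · rintro ⟨x, y, z⟩ ⟨h1, h2, h3, h4⟩
      exact ⟨⟨⟨h1, h2, h3, by linear_combination h4⟩, rfl⟩, rfl⟩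
  · rintro ⟨x, y, z, w⟩ h
    have h0 := h.1
    have h' := h.bound
    have := abs_le.1 h'.2.2.2
    have := abs_le.1 h'.1
    dsimp only at *
    rw [Finset.mem_Icc]
    omega

theorem threeSquares_two_mul {m : ℕ} (hm : m % 2 = 1) :
    threeSquares (2 * m) = 12 * mixedCount m := by
  induction m using Nat.strong_induction_on with
  | _ m ih =>
    have h1 := fourSq_even hm
    have h2 := quadCount_mixedSol_eq_sum_divisors hm
    rw [mixedSol_eq_sum] at h2
    rw [Nat.cast_mul, Nat.cast_ofNat, fourSq_even_eq_sum, ← h2, Finset.mul_sum] at h1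
    have h0 : (0 : ℤ) ∈ Finset.Icc (-(2 * (m : ℤ))) (2 * m) := by
      rw [Finset.mem_Icc]; omega
    rw [← Finset.add_sum_erase _ _ h0, ← Finset.add_sum_erase _ _ h0] at h1
    rw [Finset.sum_congr rfl (g := fun t => 12 * mixedCount (m - 2 * t ^ 2))] at h1
    · simpa using h1
    · intro t ht
      have ht0 : 0 < t ^ 2 := by
        have := Finset.ne_of_mem_erase ht
        positivity
      rcases lt_or_ge ((m : ℤ) - 2 * t ^ 2) 0 with hneg | hpos
      · have e1 : threeSquares (2 * (m - 2 * t ^ 2)) = 0 := by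
          rw [threeSquares]
          convert Set.ncard_empty (ℤ × ℤ × ℤ)
          rw [Set.eq_empty_iff_forall_notMem]
          intro v hv
          have hv : v.1 ^ 2 + v.2.1 ^ 2 + v.2.2 ^ 2 = 2 * (m - 2 * t ^ 2) := hv
          have := sq_nonneg v.1
          have := sq_nonneg v.2.1
          have := sq_nonneg v.2.2
          linarith
        have e2 : mixedCount (m - 2 * t ^ 2) = 0 := by
          rw [mixedCount]
          convert Set.ncard_empty (ℤ × ℤ × ℤ)
          rw [Set.eq_empty_iff_forall_notMem]
          rintro ⟨x, y, z⟩ ⟨h1, h2, h3, h4⟩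
          dsimp only at *
          have : 0 ≤ x * (y + z) + 2 * y * z := by positivity
          linarith
        rw [e1, e2]
      · obtain ⟨k, hk⟩ := Int.eq_ofNat_of_zero_le hpos
        rw [hk]
        exact ih k (by omega) (by omega)

theorem mixedCount_lt {m : ℤ} (hm : m % 2 = 1) :
    {v : ℤ × ℤ × ℤ | (0 < v.1 ∧ 0 < v.2.1 ∧ 0 < v.2.2 ∧
      v.1 * (v.2.1 + v.2.2) + 2 * v.2.1 * v.2.2 = m) ∧ v.2.1 < v.2.2}.ncard =
    {p : ℤ × ℤ × ℤ | p.1 > p.2.1 ∧ p.2.1 > p.2.2 ∧ p.2.2 > 0 ∧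
      p.1 * p.2.1 + p.1 * p.2.2 + p.2.1 * p.2.2 = 2 * m}.ncard := by
  refine ncard_eq_of_inverse
    (fun v => if v.1 < 2 * v.2.1 then (2 * v.2.2, 2 * v.2.1, v.1) else
      if v.1 < 2 * v.2.2 then (2 * v.2.2, v.1, 2 * v.2.1) else (v.1, 2 * v.2.2, 2 * v.2.1))
    (fun p => if p.2.2 % 2 = 1 then (p.2.2, p.2.1 / 2, p.1 / 2) else
      if p.2.1 % 2 = 1 then (p.2.1, p.2.2 / 2, p.1 / 2) else (p.1, p.2.2 / 2, p.2.1 / 2)) ?_ ?_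
  · rintro ⟨x, y, z⟩ ⟨⟨h1, h2, h3, h4⟩, h5⟩
    dsimp only at *
    have hx : x % 2 = 1 := odd_mul_left (b := y + z) (c := y * z) hm (by linarith)
    have hr : ∀ a : ℤ, ¬ 2 * a % 2 = 1 := fun a => by omega
    by_cases c1 : x < 2 * y
    · rw [if_pos c1, if_pos hx, Int.mul_ediv_cancel_left _ two_ne_zero,
        Int.mul_ediv_cancel_left _ two_ne_zero]
      refine ⟨⟨?_, ?_, ?_, ?_⟩, rfl⟩ <;> dsimp only <;> first | omega | linear_combination 2 * h4
    · rw [if_neg c1]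
      by_cases c2 : x < 2 * z
      · rw [if_pos c2, if_neg (hr _), if_pos hx, Int.mul_ediv_cancel_left _ two_ne_zero,
          Int.mul_ediv_cancel_left _ two_ne_zero]
        refine ⟨⟨?_, ?_, ?_, ?_⟩, rfl⟩ <;> dsimp only <;> first | omega | linear_combination 2 * h4
      · rw [if_neg c2, if_neg (hr _), if_neg (hr _), Int.mul_ediv_cancel_left _ two_ne_zero,
          Int.mul_ediv_cancel_left _ two_ne_zero]
        refine ⟨⟨?_, ?_, ?_, ?_⟩, rfl⟩ <;> dsimp only <;> first | omega | linear_combination 2 * h4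
  · rintro ⟨r, s, t⟩ ⟨h1, h2, h3, h4⟩
    dsimp only at *
    have h6 : ((r % 4) * (s % 4) + (r % 4) * (t % 4) + (s % 4) * (t % 4)) % 4 = 2 := by
      have : (r * s + r * t + s * t) % 4 = 2 := by omega
      rw [← this]
      simp [Int.add_emod, Int.mul_emod]
    have key : (r % 2 = 0 ∧ s % 2 = 0 ∧ t % 2 = 1) ∨ (r % 2 = 0 ∧ s % 2 = 1 ∧ t % 2 = 0) ∨
        (r % 2 = 1 ∧ s % 2 = 0 ∧ t % 2 = 0) := by
      have hr : r % 4 = 0 ∨ r % 4 = 1 ∨ r % 4 = 2 ∨ r % 4 = 3 := by omega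
      have hs : s % 4 = 0 ∨ s % 4 = 1 ∨ s % 4 = 2 ∨ s % 4 = 3 := by omega
      have ht : t % 4 = 0 ∨ t % 4 = 1 ∨ t % 4 = 2 ∨ t % 4 = 3 := by omega
      rcases hr with hr | hr | hr | hr <;> rcases hs with hs | hs | hs | hs <;>
        rcases ht with ht | ht | ht | ht <;> rw [hr, hs, ht] at h6 <;> omega
    rcases key with ⟨k1, k2, k3⟩ | ⟨k1, k2, k3⟩ | ⟨k1, k2, k3⟩
    · obtain ⟨a, rfl⟩ := Int.dvd_of_emod_eq_zero k1
      obtain ⟨b, rfl⟩ := Int.dvd_of_emod_eq_zero k2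
      rw [if_pos k3, Int.mul_ediv_cancel_left _ two_ne_zero, Int.mul_ediv_cancel_left _ two_ne_zero,
        if_pos (by dsimp only; omega)]
      refine ⟨⟨⟨?_, ?_, ?_, ?_⟩, ?_⟩, rfl⟩ <;> dsimp only <;> first | omega | skip
      refine mul_left_cancel₀ two_ne_zero ?_
      linear_combination h4
    · obtain ⟨a, rfl⟩ := Int.dvd_of_emod_eq_zero k1
      obtain ⟨b, rfl⟩ := Int.dvd_of_emod_eq_zero k3
      rw [if_neg (by omega), if_pos k2, Int.mul_ediv_cancel_left _ two_ne_zero,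
        Int.mul_ediv_cancel_left _ two_ne_zero, if_neg (by dsimp only; omega),
        if_pos (by dsimp only; omega)]
      refine ⟨⟨⟨?_, ?_, ?_, ?_⟩, ?_⟩, rfl⟩ <;> dsimp only <;> first | omega | skip
      refine mul_left_cancel₀ two_ne_zero ?_
      linear_combination h4
    · obtain ⟨a, rfl⟩ := Int.dvd_of_emod_eq_zero k2
      obtain ⟨b, rfl⟩ := Int.dvd_of_emod_eq_zero k3
      rw [if_neg (by omega), if_neg (by omega), Int.mul_ediv_cancel_left _ two_ne_zero,
        Int.mul_ediv_cancel_left _ two_ne_zero, if_neg (by dsimp only; omega),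
        if_neg (by dsimp only; omega)]
      refine ⟨⟨⟨?_, ?_, ?_, ?_⟩, ?_⟩, rfl⟩ <;> dsimp only <;> first | omega | skip
      refine mul_left_cancel₀ two_ne_zero ?_
      linear_combination h4

theorem mixedCount_eq {m : ℕ} (hm : m % 2 = 1) :
    mixedCount m = m.divisors.card + 2 * {p : ℤ × ℤ × ℤ | p.1 > p.2.1 ∧ p.2.1 > p.2.2 ∧ p.2.2 > 0 ∧
      p.1 * p.2.1 + p.1 * p.2.2 + p.2.1 * p.2.2 = 2 * (m : ℤ)}.ncard := by
  have hfin : {v : ℤ × ℤ × ℤ | 0 < v.1 ∧ 0 ≤ v.2.1 ∧ 0 < v.2.2 ∧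
      v.1 * (v.2.1 + v.2.2) + 2 * v.2.1 * v.2.2 = m}.Finite := by
    refine Set.Finite.subset (Set.finite_Icc ((0, 0, 0) : ℤ × ℤ × ℤ) (m, m, m)) ?_
    rintro ⟨x, y, z⟩ ⟨h1, h2, h3, h4⟩
    have hb := MixedSol.bound (m := m) (w := 0) ⟨h1, h2, h3, by linear_combination h4⟩
    dsimp only at *
    rw [abs_of_pos h1, abs_of_nonneg h2, abs_of_pos h3] at hb
    exact ⟨⟨h1.le, h2, h3.le⟩, hb.1, hb.2.1, hb.2.2.1⟩
  rw [mixedCount, ncard_split hfin (fun v => v.2.1 = 0)]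
  congr 1
  · rw [← ncard_mul_eq m (by omega)]
    refine ncard_eq_of_inverse (fun v => (v.1, v.2.2)) (fun p => (p.1, 0, p.2)) ?_ ?_
    · rintro ⟨x, y, z⟩ ⟨⟨h1, h2, h3, h4⟩, h5⟩
      dsimp only at *
      subst h5
      exact ⟨⟨h1, h3, by linear_combination h4⟩, rfl⟩
    · rintro ⟨x, z⟩ ⟨h1, h2, h3⟩
      exact ⟨⟨⟨h1, le_rfl, h2, by linear_combination h3⟩, rfl⟩, rfl⟩
  · rw [ncard_split (hfin.subset fun v hv => hv.1) (fun v => v.2.1 < v.2.2), two_mul]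
    congr 1
    · rw [← mixedCount_lt (by omega)]
      congr 1
      ext ⟨x, y, z⟩
      simp only [Set.mem_ofPred_eq]
      constructor
      · rintro ⟨⟨⟨h1, h2, h3, h4⟩, h5⟩, h6⟩
        exact ⟨⟨h1, by omega, h3, h4⟩, h6⟩
      · rintro ⟨⟨h1, h2, h3, h4⟩, h6⟩
        exact ⟨⟨⟨h1, by omega, h3, h4⟩, by omega⟩, h6⟩
    · rw [← mixedCount_lt (by omega)]
      refine ncard_eq_of_inverse (fun v => (v.1, v.2.2, v.2.1)) (fun v => (v.1, v.2.2, v.2.1)) ?_ ?_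
      · rintro ⟨x, y, z⟩ ⟨⟨⟨h1, h2, h3, h4⟩, h5⟩, h6⟩
        dsimp only at *
        have ho : (y + z) % 2 = 1 :=
          odd_mul_right (a := x) (c := y * z) (m := m) (by omega) (by linarith)
        refine ⟨⟨⟨h1, h3, ?_, by linear_combination h4⟩, ?_⟩, rfl⟩ <;> dsimp only <;> omega
      · rintro ⟨x, y, z⟩ ⟨⟨h1, h2, h3, h4⟩, h5⟩
        dsimp only at *
        refine ⟨⟨⟨⟨h1, h3.le, h2, by linear_combination h4⟩, ?_⟩, ?_⟩, rfl⟩ <;> dsimp only <;> omega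

/-- Proposition 6.2: for `n ≡ 2 (mod 4)`,
`r₃(n) = 12 d(n/2) + 24 #{(r,s,t) ∈ ℤ³ : r > s > t > 0, rs+rt+st = n}`. -/
theorem r3_two_mod_four (n : ℕ) (hn : 0 < n) (h : n % 4 = 2) :
    r3 n = 12 * (n / 2).divisors.card
      + 24 * Set.ncard {p : ℤ × ℤ × ℤ |
          p.1 > p.2.1 ∧ p.2.1 > p.2.2 ∧ p.2.2 > 0 ∧
          p.1 * p.2.1 + p.1 * p.2.2 + p.2.1 * p.2.2 = (n : ℤ)} := by
  have hm : n / 2 % 2 = 1 := by omega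
  have e : (n : ℤ) = 2 * ((n / 2 : ℕ) : ℤ) := by omega
  have h1 := threeSquares_two_mul hm
  rw [mixedCount_eq hm, ← e] at h1
  rw [show r3 n = threeSquares n from rfl, h1]
  ring
end

section
/- For every odd positive integer n, r_3(n) = 6·d(n) + 4·Σ (−1)^{r+s+t}, where the sum is over ordered triples of positive integers (r,s,t) with rs + rt + st = n and d(n) denotes the number of positive divisors of n. -/
namespace ThreeSquares

open Filter Topology

/-- A summable weight on `ℤ` dominating all the series used below. -/
noncomputable def weight (a : ℝ) (k : ℤ) : ℝ := (1 + |(k : ℝ)|) * a ^ k.natAbs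

lemma summable_weight {a : ℝ} (h0 : 0 < a) (h1 : a < 1) : Summable (weight a) := by
  have hn : ‖a‖ < 1 := by rwa [Real.norm_of_nonneg h0.le]
  have h : Summable fun n : ℕ => (1 + (n : ℝ)) * a ^ n := by
    have := (summable_pow_mul_geometric_of_norm_lt_one 1 hn).add
      (summable_geometric_of_lt_one h0.le h1)
    refine this.congr fun n => ?_
    ring
  refine Summable.of_nat_of_neg ?_ ?_ <;> simpa [weight] using h

lemma summable_of_abs_le_weight {a : ℝ} (h0 : 0 < a) (h1 : a < 1) {f : ℤ → ℝ} (C : ℝ)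
    (h : ∀ k, |f k| ≤ C * weight a k) : Summable f :=
  ((summable_weight h0 h1).mul_left C).of_norm_bounded h

lemma abs_neg_one_zpow (k : ℤ) : |(-1 : ℝ) ^ k| = 1 := by
  rcases Int.even_or_odd k with h | h
  · simp [h.neg_one_zpow]
  · simp [h.neg_one_zpow]

lemma neg_one_zpow_mul_self (k : ℤ) : (-1 : ℝ) ^ k * (-1) ^ k = 1 := by
  rcases Int.even_or_odd k with h | h
  · simp [h.neg_one_zpow]
  · simp [h.neg_one_zpow]

lemma neg_one_zpow_neg (k : ℤ) : (-1 : ℝ) ^ (-k) = (-1) ^ k := by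
  rcases Int.even_or_odd k with h | h
  · simp [h.neg_one_zpow]
  · simp [h.neg_one_zpow]

lemma neg_one_zpow_add (k l : ℤ) : (-1 : ℝ) ^ (k + l) = (-1) ^ k * (-1) ^ l :=
  zpow_add₀ (by norm_num) k l

lemma neg_one_zpow_sub (k l : ℤ) : (-1 : ℝ) ^ (k - l) = (-1) ^ k * (-1) ^ l := by
  rw [sub_eq_add_neg, neg_one_zpow_add, neg_one_zpow_neg]

lemma zpow_le_pow_natAbs {a : ℝ} (h0 : 0 < a) (h1 : a < 1) {k e : ℤ}
    (h : (k.natAbs : ℤ) ≤ e) : a ^ e ≤ a ^ k.natAbs := by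
  rw [← zpow_natCast]
  exact zpow_le_zpow_right_of_le_one₀ h0 h1.le h

lemma natAbs_le_sq (k : ℤ) : (k.natAbs : ℤ) ≤ k ^ 2 := by
  rw [← Int.natAbs_sq]; exact_mod_cast Nat.le_self_pow two_ne_zero _

lemma natAbs_le_sq_sub (k : ℤ) : (k.natAbs : ℤ) ≤ k ^ 2 - k + 1 := by
  rcases le_total 0 k with h | h
  · rw [Int.natAbs_of_nonneg h]; nlinarith [sq_nonneg (k - 1)]
  · rw [Int.ofNat_natAbs_of_nonpos h]; nlinarith [sq_nonneg k]

lemma zpow_sq_le_weight {a : ℝ} (h0 : 0 < a) (h1 : a < 1) (k : ℤ) :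
    a ^ (k ^ 2) ≤ weight a k := by
  unfold weight
  have := zpow_le_pow_natAbs h0 h1 (natAbs_le_sq k)
  have h2 : 0 ≤ a ^ k.natAbs := by positivity
  nlinarith [abs_nonneg (k : ℝ)]

lemma zpow_sq_sub_le {a : ℝ} (h0 : 0 < a) (h1 : a < 1) (k : ℤ) :
    a ^ (k ^ 2 - k) ≤ a⁻¹ * a ^ k.natAbs := by
  have := zpow_le_pow_natAbs h0 h1 (natAbs_le_sq_sub k)
  rw [zpow_add₀ h0.ne', zpow_one] at this
  rw [← mul_le_mul_iff_left₀ h0]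
  calc _ ≤ _ := this
    _ = _ := by field_simp

lemma summable_linear_mul_zpow_sq_sub {a : ℝ} (h0 : 0 < a) (h1 : a < 1) :
    Summable fun k : ℤ => (1 + |(k : ℝ)|) * a ^ (k ^ 2 - k) := by
  refine summable_of_abs_le_weight h0 h1 a⁻¹ fun k => ?_
  have := zpow_sq_sub_le h0 h1 k
  rw [abs_of_nonneg (by positivity), weight]
  calc _ ≤ (1 + |(k : ℝ)|) * (a⁻¹ * a ^ k.natAbs) := by gcongr
    _ = _ := by ring

lemma summable_mul_zpow_sq_sub {a : ℝ} (h0 : 0 < a) (h1 : a < 1) {f : ℤ → ℝ} (C : ℝ)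
    (hf : ∀ k, |f k| ≤ C * (1 + |(k : ℝ)|)) : Summable fun k : ℤ => f k * a ^ (k ^ 2 - k) := by
  refine ((summable_linear_mul_zpow_sq_sub h0 h1).mul_left C).of_norm_bounded fun k => ?_
  have : 0 < a ^ (k ^ 2 - k) := by positivity
  rw [norm_mul, Real.norm_eq_abs, Real.norm_eq_abs, abs_of_pos this, ← mul_assoc]
  gcongr
  exact hf k

lemma summable_zpow_sq_sub {a : ℝ} (h0 : 0 < a) (h1 : a < 1) :
    Summable fun k : ℤ => a ^ (k ^ 2 - k) := by
  simpa using summable_mul_zpow_sq_sub h0 h1 (f := fun _ => 1) 1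
    (by intro k; simp)

lemma summable_zpow_sq {a : ℝ} (h0 : 0 < a) (h1 : a < 1) :
    Summable fun k : ℤ => a ^ (k ^ 2) :=
  summable_of_abs_le_weight h0 h1 1 fun k => by
    rw [abs_of_pos (by positivity), one_mul]; exact zpow_sq_le_weight h0 h1 k

lemma Summable.of_sign {f : ℤ → ℝ} (hf : Summable f) (s : ℤ → ℤ) :
    Summable fun k => (-1 : ℝ) ^ s k * f k :=
  hf.abs.of_norm_bounded fun k => by simp

/-- Product of two absolutely convergent series over `ℤ`, summed along antidiagonals. -/
lemma tsum_mul_tsum_int {f g : ℤ → ℝ} (hf : Summable f) (hg : Summable g) :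
    (∑' k, f k) * (∑' k, g k) = ∑' m : ℤ, ∑' k : ℤ, f k * g (m - k) := by
  have hs : Summable fun x : ℤ × ℤ => f x.1 * g x.2 :=
    summable_mul_of_summable_norm hf.norm hg.norm
  rw [tsum_mul_tsum_of_summable_norm hf.norm hg.norm]
  let e : ℤ × ℤ ≃ ℤ × ℤ :=
    { toFun := fun x => (x.2, x.1 - x.2)
      invFun := fun x => (x.1 + x.2, x.1)
      left_inv := fun x => by ext <;> simp
      right_inv := fun x => by ext <;> simp }
  rw [← e.tsum_eq]
  exact (e.summable_iff.2 hs).tsum_prod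

lemma bounded_variation_shift {g : ℤ → ℝ} (hd : Summable fun m => g (m - 1) - g m) (k : ℤ) :
    (Summable fun m => g (m - k) - g m) ∧
      (∑' m, (g (m - k) - g m) = k * ∑' m, (g (m - 1) - g m)) ∧
      ∑' m, |g (m - k) - g m| ≤ |(k : ℝ)| * ∑' m, |g (m - 1) - g m| := by
  set d : ℤ → ℝ := fun m => g (m - 1) - g m with hd'
  have sh : ∀ j : ℤ, Summable fun m => d (m - j) := fun j =>
    (Equiv.subRight j).summable_iff.2 hd
  have sht : ∀ j : ℤ, ∑' m, d (m - j) = ∑' m, d m := fun j => (Equiv.subRight j).tsum_eq d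
  have sha : ∀ j : ℤ, ∑' m, |d (m - j)| = ∑' m, |d m| := fun j =>
    (Equiv.subRight j).tsum_eq fun m => |d m|
  induction k using Int.induction_on with
  | zero => simp
  | succ i ih =>
    obtain ⟨h1, h2, h3⟩ := ih
    have e : (fun m => g (m - (i + 1)) - g m) = fun m => d (m - i) + (g (m - i) - g m) := by
      funext m; simp only [hd']; rw [sub_sub]; ring
    have e' : ∀ m, |g (m - (i + 1)) - g m| ≤ |d (m - i)| + |g (m - i) - g m| := fun m => by
      rw [congrFun e m]; exact abs_add_le _ _
    refine ⟨e ▸ (sh i).add h1, ?_, ?_⟩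
    · rw [e, (sh i).tsum_add h1, sht, h2]; push_cast; ring
    · refine (Summable.tsum_le_tsum e' (e ▸ (sh i).add h1).abs ((sh i).abs.add h1.abs)).trans ?_
      rw [(sh i).abs.tsum_add h1.abs, sha]
      have : |(((i : ℤ) + 1 : ℤ) : ℝ)| = |((i : ℤ) : ℝ)| + 1 := by
        push_cast; rw [abs_of_nonneg (by positivity), abs_of_nonneg (by positivity)]
      rw [this]; linarith
  | pred i ih =>
    obtain ⟨h1, h2, h3⟩ := ih
    have e : (fun m => g (m - (-i - 1)) - g m)
        = fun m => (g (m - (-i)) - g m) - d (m - (-i - 1)) := by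
      funext m; simp only [hd']; rw [show m - (-(i : ℤ) - 1) - 1 = m - -i by ring]; ring
    have e' : ∀ m, |g (m - (-i - 1)) - g m| ≤ |g (m - (-i)) - g m| + |d (m - (-i - 1))| :=
      fun m => by
        rw [congrFun e m]; exact abs_sub _ _
    refine ⟨e ▸ h1.sub (sh _), ?_, ?_⟩
    · rw [e, h1.tsum_sub (sh _), sht, h2]; push_cast; ring
    · refine (Summable.tsum_le_tsum e' (e ▸ h1.sub (sh _)).abs (h1.abs.add (sh _).abs)).trans ?_
      rw [h1.abs.tsum_add (sh _).abs, sha]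
      have : |((-(i : ℤ) - 1 : ℤ) : ℝ)| = |((-(i : ℤ) : ℤ) : ℝ)| + 1 := by
        have hi : (0 : ℝ) ≤ i := i.cast_nonneg
        push_cast
        rw [abs_neg, abs_of_nonneg hi, abs_of_nonpos (by linarith)]
        ring
      rw [this]; linarith

/-- Summation by parts: a null sequence `a` convolved with a function `g` of bounded variation. -/
lemma tsum_conv_bounded_variation {a g : ℤ → ℝ} {M : ℝ} (ha : Summable a)
    (hka : Summable fun k : ℤ => (k : ℝ) * a k) (h0 : ∑' k, a k = 0) (hM : ∀ n, |g n| ≤ M)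
    (hd : Summable fun m => g (m - 1) - g m) :
    ∑' m : ℤ, ∑' k : ℤ, a k * g (m - k) = (∑' m, (g (m - 1) - g m)) * ∑' k : ℤ, k * a k := by
  have hs : ∀ m, Summable fun k => a k * g (m - k) := fun m =>
    (ha.abs.mul_right M).of_norm_bounded fun k => by
      rw [norm_mul, Real.norm_eq_abs, Real.norm_eq_abs]
      gcongr
      exact hM _
  have h1 : ∀ m, ∑' k, a k * g (m - k) = ∑' k, a k * (g (m - k) - g m) := fun m => by
    simp only [mul_sub]
    rw [(hs m).tsum_sub (ha.mul_right _), tsum_mul_right, h0]; simp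
  have hb := bounded_variation_shift hd
  have hs2 : Summable fun x : ℤ × ℤ => a x.1 * (g (x.2 - x.1) - g x.2) := by
    rw [← summable_abs_iff, summable_prod_of_nonneg (fun _ => abs_nonneg _)]
    simp only [abs_mul]
    refine ⟨fun k => (hb k).1.abs.mul_left _, ?_⟩
    refine (hka.abs.mul_right (∑' m, |g (m - 1) - g m|)).of_nonneg_of_le
      (fun k => tsum_nonneg fun m => by positivity) fun k => ?_
    rw [tsum_mul_left, abs_mul]
    nlinarith [(hb k).2.2, abs_nonneg (a k)]
  simp_rw [h1]
  rw [Summable.tsum_comm (f := fun k m => a k * (g (m - k) - g m)) hs2, ← tsum_mul_left]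
  refine tsum_congr fun k => ?_
  rw [tsum_mul_left, (hb k).2.1]
  ring

lemma tsum_int_telescope {g : ℤ → ℝ} {l l' : ℝ} (hd : Summable fun m => g (m - 1) - g m)
    (hb : Tendsto (fun N : ℕ => g (-N)) atTop (𝓝 l))
    (ht : Tendsto (fun N : ℕ => g N) atTop (𝓝 l')) :
    ∑' m, (g (m - 1) - g m) = l - l' := by
  have h1 : ∀ N : ℕ, ∑ m ∈ Finset.Ioc (-N : ℤ) N, (g (m - 1) - g m) = g (-N) - g N := by
    intro N
    induction N with
    | zero => simp
    | succ n ih =>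
      have : Finset.Ioc (-((n + 1 : ℕ) : ℤ)) ((n + 1 : ℕ) : ℤ)
          = insert (-(n : ℤ)) (insert ((n : ℤ) + 1) (Finset.Ioc (-n : ℤ) n)) := by
        ext x; simp only [Finset.mem_Ioc, Finset.mem_insert]; push_cast; omega
      rw [this, Finset.sum_insert (by simp; omega), Finset.sum_insert (by simp), ih]
      push_cast
      rw [show -(n : ℤ) - 1 = -1 + -n by ring, show (n : ℤ) + 1 - 1 = n by ring,
        show (-1 + -n : ℤ) = -(n : ℤ) - 1 by ring, show -((n : ℤ) + 1) = -n - 1 by ring]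
      ring
  have h2 : Tendsto (fun N : ℕ => Finset.Ioc (-(N : ℤ)) N) atTop atTop :=
    Finset.tendsto_Ioc_neg_atTop_atTop.comp tendsto_natCast_atTop_atTop
  have h3 := hd.hasSum.comp h2
  simp only [Function.comp_def, h1] at h3
  exact tendsto_nhds_unique h3 (hb.sub ht)

section

lemma summable_conv {f g : ℤ → ℝ} (hf : Summable f) (hg : Summable g) :
    Summable (fun x : ℤ × ℤ => f x.2 * g (x.1 - x.2)) := by
  have hs : Summable fun x : ℤ × ℤ => f x.1 * g x.2 :=
    summable_mul_of_summable_norm hf.norm hg.norm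
  let e : ℤ × ℤ ≃ ℤ × ℤ :=
    { toFun := fun x => (x.2, x.1 - x.2)
      invFun := fun x => (x.1 + x.2, x.1)
      left_inv := fun x => by ext <;> simp
      right_inv := fun x => by ext <;> simp }
  exact e.summable_iff.2 hs

lemma sq_zpow (a : ℝ) (e : ℤ) : (a ^ 2) ^ e = a ^ (2 * e) := by
  rw [zpow_mul]; norm_cast

lemma tsum_reflect (c : ℤ) (f : ℤ → ℝ) : ∑' k, f (c - k) = ∑' k, f k :=
  (Equiv.subLeft c).tsum_eq f

lemma tsum_translate (c : ℤ) (f : ℤ → ℝ) : ∑' k, f (k + c) = ∑' k, f k :=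
  (Equiv.addRight c).tsum_eq f

/-- The theta series `∑ a ^ (k ^ 2)`. -/
noncomputable def thetaThree (a : ℝ) : ℝ := ∑' k : ℤ, a ^ (k ^ 2)

/-- The theta series `∑ (-1) ^ k * a ^ (k ^ 2)`. -/
noncomputable def thetaFour (a : ℝ) : ℝ := ∑' k : ℤ, (-1 : ℝ) ^ k * a ^ (k ^ 2)

/-- The series `∑ a ^ (4 * k ^ 2 - 2 * k)`, running over doubled triangular numbers. -/
noncomputable def triangularTheta (a : ℝ) : ℝ := ∑' k : ℤ, a ^ (4 * k ^ 2 - 2 * k)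

/-- Minus the series of Jacobi for the cube of the Euler product, with nome `a ^ 2`. -/
noncomputable def jacobiCube (a : ℝ) : ℝ :=
  ∑' k : ℤ, (k : ℝ) * ((-1 : ℝ) ^ k * a ^ (k ^ 2 - k))

variable {a : ℝ}

lemma summable_thetaFour (h0 : 0 < a) (h1 : a < 1) :
    Summable fun k : ℤ => (-1 : ℝ) ^ k * a ^ (k ^ 2) :=
  Summable.of_sign (summable_zpow_sq h0 h1) fun k => k

lemma summable_sign_zpow_sq_sub (h0 : 0 < a) (h1 : a < 1) :
    Summable fun k : ℤ => (-1 : ℝ) ^ k * a ^ (k ^ 2 - k) :=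
  Summable.of_sign (summable_zpow_sq_sub h0 h1) fun k => k

lemma summable_jacobiCube (h0 : 0 < a) (h1 : a < 1) :
    Summable fun k : ℤ => (k : ℝ) * ((-1 : ℝ) ^ k * a ^ (k ^ 2 - k)) := by
  have := summable_mul_zpow_sq_sub h0 h1 (f := fun k => (k : ℝ) * (-1) ^ k) 1 fun k => by
    rw [abs_mul, abs_neg_one_zpow]; linarith
  simpa only [mul_assoc] using this

lemma summable_triangularTheta (h0 : 0 < a) (h1 : a < 1) :
    Summable fun k : ℤ => a ^ (4 * k ^ 2 - 2 * k) := by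
  have := (summable_zpow_sq_sub h0 h1).comp_injective
    (mul_right_injective₀ (two_ne_zero (α := ℤ)))
  refine this.congr fun k => ?_
  simp only [Function.comp]
  congr 1; ring

lemma triangularTheta_pos (h0 : 0 < a) (h1 : a < 1) : 0 < triangularTheta a :=
  (summable_triangularTheta h0 h1).tsum_pos (fun k => by positivity) 0 (by positivity)

lemma thetaThree_pos (h0 : 0 < a) (h1 : a < 1) : 0 < thetaThree a :=
  (summable_zpow_sq h0 h1).tsum_pos (fun k => by positivity) 0 (by positivity)

lemma tsum_sign_zpow_sq_sub (a : ℝ) :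
    ∑' k : ℤ, (-1 : ℝ) ^ k * a ^ (k ^ 2 - k) = 0 := by
  have h := tsum_reflect 1 fun k => (-1 : ℝ) ^ k * a ^ (k ^ 2 - k)
  have h2 : ∀ k : ℤ, (-1 : ℝ) ^ (1 - k) * a ^ ((1 - k) ^ 2 - (1 - k))
      = -((-1 : ℝ) ^ k * a ^ (k ^ 2 - k)) := fun k => by
    rw [neg_one_zpow_sub, show (1 - k) ^ 2 - (1 - k) = k ^ 2 - k by ring]; simp
  simp only [h2, tsum_neg] at h
  linarith

lemma hasSum_int_even_add_odd {f : ℤ → ℝ} {x y : ℝ} (he : HasSum (fun k => f (2 * k)) x)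
    (ho : HasSum (fun k => f (2 * k + 1)) y) : HasSum f (x + y) := by
  have hi := mul_right_injective₀ (two_ne_zero' ℤ)
  have ho' := ((add_left_injective (1 : ℤ)).comp hi).hasSum_range_iff.2 ho
  refine (hi.hasSum_range_iff.2 he).add_isCompl (compl_eq_iff_isCompl.1 ?_) ho'
  ext m
  simp only [Set.mem_compl_iff, Set.mem_range, Function.comp]
  constructor
  · intro h
    rcases Int.even_or_odd' m with ⟨p, rfl | rfl⟩
    · exact absurd ⟨p, rfl⟩ h
    · exact ⟨p, rfl⟩
  · rintro ⟨p, rfl⟩ ⟨r, hr⟩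
    omega

lemma tsum_zpow_sq_sub (h0 : 0 < a) (h1 : a < 1) :
    ∑' k : ℤ, a ^ (k ^ 2 - k) = 2 * triangularTheta a := by
  have he : HasSum (fun k : ℤ => a ^ ((2 * k) ^ 2 - 2 * k)) (triangularTheta a) := by
    unfold triangularTheta
    convert (summable_triangularTheta h0 h1).hasSum using 3; ring
  have ho : HasSum (fun k : ℤ => a ^ ((2 * k + 1) ^ 2 - (2 * k + 1))) (triangularTheta a) := by
    rw [← (Equiv.neg ℤ).hasSum_iff]
    unfold triangularTheta
    convert (summable_triangularTheta h0 h1).hasSum using 2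
    simp only [Function.comp, Equiv.neg_apply]
    congr 1; ring
  have h := hasSum_int_even_add_odd (f := fun k => a ^ (k ^ 2 - k)) he ho
  rw [h.tsum_eq]; ring

/-- Convolving the series `a ^ (2 * (k ^ 2 - k))` and `a ^ (2 * k ^ 2)`. -/
lemma tsum_conv_theta (h0 : 0 < a) (m : ℤ) :
    ∑' k : ℤ, (a ^ 2) ^ (k ^ 2 - k) * (a ^ 2) ^ ((m - k) ^ 2)
      = a ^ (m ^ 2 - m) * triangularTheta a := by
  have key : ∀ k e : ℤ, 2 * (k ^ 2 - k) + 2 * (m - k) ^ 2 = (m ^ 2 - m) + e →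
      (a ^ 2) ^ (k ^ 2 - k) * (a ^ 2) ^ ((m - k) ^ 2) = a ^ (m ^ 2 - m) * a ^ e := by
    intro k e h
    rw [sq_zpow, sq_zpow, ← zpow_add₀ h0.ne', ← zpow_add₀ h0.ne', h]
  rw [triangularTheta, ← tsum_mul_left]
  rcases Int.even_or_odd' m with ⟨p, rfl | rfl⟩
  · rw [← tsum_translate p]
    exact tsum_congr fun l => key _ _ (by ring)
  · rw [← tsum_reflect (p + 1)]
    exact tsum_congr fun l => key _ _ (by ring)

lemma jacobiCube_sq_mul_thetaFour (h0 : 0 < a) (h1 : a < 1) :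
    jacobiCube (a ^ 2) * thetaFour (a ^ 2) = triangularTheta a * jacobiCube a := by
  have b0 : 0 < a ^ 2 := by positivity
  have b1 : a ^ 2 < 1 := by nlinarith
  have hg : Summable fun k : ℤ => (k : ℝ) * ((-1 : ℝ) ^ k * (a ^ 2) ^ (k ^ 2)) := by
    refine summable_of_abs_le_weight b0 b1 1 fun k => ?_
    rw [abs_mul, abs_mul, abs_neg_one_zpow, abs_of_pos (zpow_pos b0 _), weight]
    have := zpow_le_pow_natAbs b0 b1 (natAbs_le_sq k)
    have h2 : 0 ≤ (a ^ 2) ^ k.natAbs := by positivity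
    nlinarith [abs_nonneg (k : ℝ)]
  have s1 := summable_conv (summable_jacobiCube b0 b1) (summable_thetaFour b0 b1)
  have s2 := summable_conv (summable_sign_zpow_sq_sub b0 b1) hg
  have e1 := tsum_mul_tsum_int (summable_jacobiCube b0 b1) (summable_thetaFour b0 b1)
  have e2 := tsum_mul_tsum_int (summable_sign_zpow_sq_sub b0 b1) hg
  rw [tsum_sign_zpow_sq_sub, zero_mul] at e2
  rw [jacobiCube, thetaFour, e1, ← add_zero (tsum _), e2, ← s1.prod.tsum_add s2.prod, jacobiCube,
    ← tsum_mul_left]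
  refine tsum_congr fun m => ?_
  rw [← (s1.prod_factor m).tsum_add (s2.prod_factor m)]
  have : ∀ k : ℤ, (k : ℝ) * ((-1 : ℝ) ^ k * (a ^ 2) ^ (k ^ 2 - k)) *
        ((-1 : ℝ) ^ (m - k) * (a ^ 2) ^ ((m - k) ^ 2)) +
      (-1 : ℝ) ^ k * (a ^ 2) ^ (k ^ 2 - k) *
        (((m - k : ℤ) : ℝ) * ((-1 : ℝ) ^ (m - k) * (a ^ 2) ^ ((m - k) ^ 2))) =
      (m * (-1 : ℝ) ^ m) * ((a ^ 2) ^ (k ^ 2 - k) * (a ^ 2) ^ ((m - k) ^ 2)) := fun k => by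
    rw [neg_one_zpow_sub]; push_cast
    linear_combination (m * (-1 : ℝ) ^ m * (a ^ 2) ^ (k ^ 2 - k) * (a ^ 2) ^ ((m - k) ^ 2))
      * neg_one_zpow_mul_self k
  simp only [this]
  rw [tsum_mul_left, tsum_conv_theta h0]; ring

lemma triangularTheta_sq (h0 : 0 < a) (h1 : a < 1) :
    triangularTheta (a ^ 2) * thetaThree (a ^ 2) = triangularTheta a ^ 2 := by
  have b0 : 0 < a ^ 2 := by positivity
  have b1 : a ^ 2 < 1 := by nlinarith
  have e := tsum_mul_tsum_int (summable_zpow_sq_sub b0 b1) (summable_zpow_sq b0 b1)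
  simp only [tsum_conv_theta h0, tsum_mul_right, tsum_zpow_sq_sub b0 b1,
    tsum_zpow_sq_sub h0 h1] at e
  rw [thetaThree]; linarith

lemma thetaFour_mul_thetaThree (h0 : 0 < a) (h1 : a < 1) :
    thetaFour a * thetaThree a = thetaFour (a ^ 2) ^ 2 := by
  rw [thetaFour, thetaThree, tsum_mul_tsum_int (summable_thetaFour h0 h1) (summable_zpow_sq h0 h1)]
  set c : ℤ → ℝ := fun m => ∑' k : ℤ, (-1 : ℝ) ^ k * a ^ (k ^ 2) * a ^ ((m - k) ^ 2) with hc
  have hodd : ∀ p : ℤ, c (2 * p + 1) = 0 := fun p => by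
    have h := tsum_reflect (2 * p + 1)
      fun k => (-1 : ℝ) ^ k * a ^ (k ^ 2) * a ^ ((2 * p + 1 - k) ^ 2)
    have h2 : ∀ k : ℤ, (-1 : ℝ) ^ (2 * p + 1 - k) * a ^ ((2 * p + 1 - k) ^ 2) *
        a ^ ((2 * p + 1 - (2 * p + 1 - k)) ^ 2) =
        -((-1 : ℝ) ^ k * a ^ (k ^ 2) * a ^ ((2 * p + 1 - k) ^ 2)) := fun k => by
      rw [neg_one_zpow_sub, Odd.neg_one_zpow ⟨p, rfl⟩, sub_sub_cancel]; ring
    simp only [h2, tsum_neg] at h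
    simp only [hc]; linarith
  have heven : ∀ p : ℤ, c (2 * p) = ((-1 : ℝ) ^ p * (a ^ 2) ^ (p ^ 2)) * thetaFour (a ^ 2) :=
    fun p => by
      simp only [hc]
      rw [← tsum_translate p, thetaFour, ← tsum_mul_left]
      refine tsum_congr fun l => ?_
      rw [neg_one_zpow_add, mul_assoc, ← zpow_add₀ h0.ne', sq_zpow, sq_zpow,
        show (l + p) ^ 2 + (2 * p - (l + p)) ^ 2 = 2 * p ^ 2 + 2 * l ^ 2 by ring,
        zpow_add₀ h0.ne']
      ring
  rw [← Function.Injective.tsum_eq (g := fun p : ℤ => 2 * p)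
    (mul_right_injective₀ (two_ne_zero (α := ℤ)))]
  · rw [tsum_congr heven, tsum_mul_right, ← thetaFour, ← sq]
  · intro m hm
    rcases Int.even_or_odd' m with ⟨p, rfl | rfl⟩
    · exact ⟨p, rfl⟩
    · exact absurd (hodd p) hm

lemma tendsto_tsum_zpow_nhdsGT_zero {ι : Type*} {c : ι → ℝ} {e : ι → ℤ} (he : ∀ k, 0 ≤ e k)
    (hs : Summable fun k => |c k| * (1 / 2 : ℝ) ^ e k) :
    Tendsto (fun a : ℝ => ∑' k, c k * a ^ e k) (𝓝[>] 0)
      (𝓝 (∑' k, if e k = 0 then c k else 0)) := by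
  refine tendsto_tsum_of_dominated_convergence hs (fun k => ?_) ?_
  · obtain ⟨n, hn⟩ := Int.eq_ofNat_of_zero_le (he k)
    simp only [hn, zpow_natCast, Nat.cast_eq_zero]
    have h : Tendsto (fun a : ℝ => c k * a ^ n) (𝓝 0) (𝓝 (c k * 0 ^ n)) :=
      Continuous.tendsto (by fun_prop) 0
    have h' : c k * 0 ^ n = if n = 0 then c k else 0 := by
      rw [zero_pow_eq]; split_ifs <;> simp
    exact h' ▸ h.mono_left nhdsWithin_le_nhds
  · filter_upwards [Ioo_mem_nhdsGT (show (0 : ℝ) < 1 / 2 by norm_num)] with a ha k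
    obtain ⟨n, hn⟩ := Int.eq_ofNat_of_zero_le (he k)
    simp only [hn, zpow_natCast, norm_mul, norm_pow, Real.norm_eq_abs]
    rw [abs_of_pos ha.1]
    gcongr
    · exact ha.1.le
    · exact ha.2.le

lemma tendsto_thetaFour : Tendsto thetaFour (𝓝[>] 0) (𝓝 1) := by
  have h := tendsto_tsum_zpow_nhdsGT_zero (c := fun k : ℤ => (-1 : ℝ) ^ k)
    (e := fun k : ℤ => k ^ 2)
    (fun k => sq_nonneg k) (by
      simpa [abs_neg_one_zpow] using summable_zpow_sq (a := 1 / 2) (by norm_num) (by norm_num))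
  convert h using 2
  · rfl
  · rw [tsum_eq_single 0 fun k hk => if_neg (pow_ne_zero 2 hk)]; simp

lemma sq_sub_nonneg (k : ℤ) : 0 ≤ k ^ 2 - k := by
  have := natAbs_le_sq k
  have h2 : k ≤ k.natAbs := Int.le_natAbs
  omega

lemma tendsto_triangularTheta : Tendsto triangularTheta (𝓝[>] 0) (𝓝 1) := by
  have hn : ∀ k : ℤ, 0 ≤ 4 * k ^ 2 - 2 * k := fun k => by
    have := sq_sub_nonneg (2 * k); nlinarith
  have h := tendsto_tsum_zpow_nhdsGT_zero (c := fun _ : ℤ => 1)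
    (e := fun k : ℤ => 4 * k ^ 2 - 2 * k)
    hn (by simpa using summable_triangularTheta (a := 1 / 2) (by norm_num) (by norm_num))
  convert h using 2
  · simp [triangularTheta]
  · rw [tsum_eq_single 0 (fun k hk => ?_)]
    · simp
    · rw [if_neg]
      intro h
      have : k * (2 * (2 * k - 1)) = 0 := by linarith
      rcases mul_eq_zero.1 this with h | h <;> omega

lemma tendsto_jacobiCube : Tendsto jacobiCube (𝓝[>] 0) (𝓝 (-1)) := by
  have h := tendsto_tsum_zpow_nhdsGT_zero (c := fun k : ℤ => (k : ℝ) * (-1 : ℝ) ^ k)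
    (e := fun k : ℤ => k ^ 2 - k) sq_sub_nonneg (by
      simpa [abs_mul, abs_neg_one_zpow] using
        (summable_jacobiCube (a := 1 / 2) (by norm_num) (by norm_num)).abs)
  convert h using 2
  · simp [jacobiCube, mul_assoc]
  · rw [tsum_eq_single 1 (fun k hk => ?_)]
    · simp
    · rcases eq_or_ne k 0 with rfl | h0
      · simp
      · rw [if_neg]
        intro h
        have : k * (k - 1) = 0 := by linarith
        rcases mul_eq_zero.1 this with h | h <;> omega

lemma tendsto_iterated_sq (h0 : 0 < a) (h1 : a < 1) :
    Tendsto (fun n : ℕ => a ^ (2 ^ n)) atTop (𝓝[>] 0) := by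
  refine tendsto_nhdsWithin_iff.2 ⟨?_, Eventually.of_forall fun n => by
    simp only [Set.mem_Ioi]; positivity⟩
  exact (tendsto_pow_atTop_nhds_zero_of_lt_one h0.le h1).comp
    (tendsto_pow_atTop_atTop_of_one_lt (by norm_num))

lemma thetaFour_ne_zero (h0 : 0 < a) (h1 : a < 1) : thetaFour a ≠ 0 := by
  intro h
  have hz : ∀ n : ℕ, thetaFour (a ^ (2 ^ n)) = 0 := by
    intro n
    induction n with
    | zero => simpa using h
    | succ n ih =>
      have := thetaFour_mul_thetaThree (a := a ^ (2 ^ n)) (by positivity)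
        (pow_lt_one₀ h0.le h1 (by positivity))
      rw [ih, zero_mul, ← pow_mul, ← pow_succ] at this
      exact pow_eq_zero_iff two_ne_zero |>.1 this.symm
  have := tendsto_thetaFour.comp (tendsto_iterated_sq h0 h1)
  simp only [Function.comp_def, hz] at this
  exact zero_ne_one (tendsto_nhds_unique tendsto_const_nhds this)

lemma jacobiCube_eq (h0 : 0 < a) (h1 : a < 1) :
    jacobiCube a = -(thetaFour (a ^ 2) ^ 2 * triangularTheta a) := by
  set T : ℝ → ℝ := fun a => jacobiCube a / (thetaFour (a ^ 2) ^ 2 * triangularTheta a) with hT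
  have step : ∀ b : ℝ, 0 < b → b < 1 → T (b ^ 2) = T b := by
    intro b b0 b1
    have c0 : 0 < b ^ 2 := by positivity
    have c1 : b ^ 2 < 1 := by nlinarith
    have e1 := jacobiCube_sq_mul_thetaFour b0 b1
    have e2 := triangularTheta_sq b0 b1
    have e3 := thetaFour_mul_thetaThree c0 c1
    have n1 := thetaFour_ne_zero c0 c1
    have n2 := (thetaThree_pos c0 c1).ne'
    have n3 := (triangularTheta_pos b0 b1).ne'
    have n4 := (triangularTheta_pos c0 c1).ne'
    simp only [hT]
    rw [← e3, div_eq_div_iff (by positivity) (by positivity)]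
    linear_combination (thetaFour (b ^ 2) * triangularTheta b) * e1
      - (thetaFour (b ^ 2) * jacobiCube b) * e2
  have hz : ∀ n : ℕ, T (a ^ (2 ^ n)) = T a := by
    intro n
    induction n with
    | zero => simp
    | succ n ih =>
      rw [pow_succ, pow_mul, step _ (by positivity) (pow_lt_one₀ h0.le h1 (by positivity)), ih]
  have hl := tendsto_iterated_sq h0 h1
  have hl2 : Tendsto (fun n : ℕ => (a ^ (2 ^ n)) ^ 2) atTop (𝓝[>] 0) := by
    have := tendsto_iterated_sq (a := a ^ 2) (by positivity) (by nlinarith)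
    refine this.congr fun n => by rw [← pow_mul, ← pow_mul, mul_comm]
  have hlim : Tendsto (fun n : ℕ => T (a ^ (2 ^ n))) atTop (𝓝 (-1 / (1 ^ 2 * 1))) :=
    (tendsto_jacobiCube.comp hl).div
      (((tendsto_thetaFour.comp hl2).pow 2).mul (tendsto_triangularTheta.comp hl)) (by norm_num)
  simp only [hz] at hlim
  have := tendsto_nhds_unique tendsto_const_nhds hlim
  have n1 := thetaFour_ne_zero (a := a ^ 2) (by positivity) (by nlinarith)
  have n3 := (triangularTheta_pos h0 h1).ne'
  simp only [hT] at this
  rw [div_eq_iff (by positivity)] at this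
  linarith

lemma jacobiCube_sq_eq (h0 : 0 < a) (h1 : a < 1) :
    jacobiCube (a ^ 2) = -(thetaFour (a ^ 2) * triangularTheta a ^ 2) := by
  have n1 := thetaFour_ne_zero (a := a ^ 2) (by positivity) (by nlinarith)
  apply mul_right_cancel₀ n1
  rw [jacobiCube_sq_mul_thetaFour h0 h1, jacobiCube_eq h0 h1]; ring

end

section

/-- The logistic sequence `q ^ n / (1 + q ^ n)`. -/
noncomputable def logistic (q : ℝ) (n : ℤ) : ℝ := q ^ n / (1 + q ^ n)

/-- Nonnegative part of the sequence `partialTheta`. -/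
noncomputable def partialThetaNat (q : ℝ) : ℕ → ℝ
  | 0 => -1
  | n + 1 => q ^ (2 * n + 1) * (partialThetaNat q n + 2 * (-1) ^ n)

/-- For `n > 0` this is `q ^ (n ^ 2)` times a truncated series `∑ (-1) ^ z * q ^ (-z ^ 2)`. -/
noncomputable def partialTheta (q : ℝ) : ℤ → ℝ
  | Int.ofNat n => partialThetaNat q n
  | Int.negSucc n => -(partialThetaNat q (n + 1) + 2 * (-1) ^ (n + 1))

variable {q : ℝ}

lemma logistic_neg (h0 : 0 < q) (n : ℤ) : logistic q (-n) = 1 - logistic q n := by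
  have : 0 < q ^ n := by positivity
  simp only [logistic, zpow_neg]
  field_simp
  ring

lemma logistic_eq_mul_neg (h0 : 0 < q) (n : ℤ) : logistic q n = q ^ n * logistic q (-n) := by
  have : 0 < q ^ n := by positivity
  simp only [logistic, zpow_neg]
  field_simp
  ring

lemma logistic_pos (h0 : 0 < q) (n : ℤ) : 0 < logistic q n := by
  unfold logistic; positivity

lemma logistic_le_one (h0 : 0 < q) (n : ℤ) : logistic q n ≤ 1 := by
  have := logistic_neg h0 n
  have := logistic_pos h0 (-n)
  linarith

lemma logistic_le_zpow (h0 : 0 < q) (n : ℤ) : logistic q n ≤ q ^ n := by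
  have h : 0 < q ^ n := by positivity
  rw [logistic_eq_mul_neg h0]
  nlinarith [logistic_le_one h0 (-n)]

lemma partialTheta_natCast (q : ℝ) (n : ℕ) : partialTheta q n = partialThetaNat q n := rfl

lemma partialTheta_neg (q : ℝ) (n : ℤ) :
    partialTheta q (-n) = -(partialTheta q n + 2 * (-1) ^ n) := by
  have h : ∀ n : ℕ, partialTheta q (-(n : ℤ)) = -(partialTheta q n + 2 * (-1) ^ (n : ℤ)) := by
    rintro (_ | n)
    · simp [show partialTheta q 0 = -1 from rfl]; norm_num
    · rw [partialTheta_natCast, zpow_natCast]; rfl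
  rcases Int.eq_nat_or_neg n with ⟨n, rfl | rfl⟩
  · exact h n
  · rw [neg_neg, h n, neg_one_zpow_neg]; ring

lemma partialTheta_add_one (h0 : 0 < q) (n : ℤ) :
    partialTheta q (n + 1) = -(q ^ (2 * n + 1) * partialTheta q (-n)) := by
  have h : ∀ n : ℕ, partialTheta q ((n : ℤ) + 1)
      = -(q ^ (2 * (n : ℤ) + 1) * partialTheta q (-n)) := fun n => by
    rw [partialTheta_neg, partialTheta_natCast, ← Nat.cast_succ, partialTheta_natCast,
      partialThetaNat]
    push_cast [← zpow_natCast]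
    ring
  rcases lt_or_ge n 0 with hn | hn
  · obtain ⟨m, hm⟩ := Int.eq_ofNat_of_zero_le (show 0 ≤ -n - 1 by omega)
    obtain rfl : n = -(m + 1) := by omega
    rw [neg_neg, h m, show (-((m : ℤ) + 1) + 1) = -m by ring, mul_neg, ← mul_assoc,
      ← zpow_add₀ h0.ne']
    ring_nf
    simp
  · obtain ⟨m, rfl⟩ := Int.eq_ofNat_of_zero_le hn
    exact h m

lemma exists_abs_partialTheta_le (h0 : 0 < q) (h1 : q < 1) :
    ∃ C : ℝ, 0 < C ∧ ∀ n : ℤ, |partialTheta q n| ≤ C * (q ^ n * q ^ n.natAbs) := by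
  set B := 2 / (1 - q) with hB
  have hq : 0 < 1 - q := by linarith
  have hB0 : 0 < B := by positivity
  have hBq : B * (1 - q) = 2 := by rw [hB]; field_simp
  have h2 : ∀ n : ℕ, |partialThetaNat q n + 2 * (-1) ^ n| ≤ |partialThetaNat q n| + 2 := fun n => by
    refine (abs_add_le _ _).trans ?_
    simp [abs_mul]
  have hb : ∀ n, |partialThetaNat q n| ≤ B := by
    intro n
    induction n with
    | zero => rw [partialThetaNat]; norm_num; nlinarith
    | succ n ih =>
      rw [partialThetaNat, abs_mul, abs_of_pos (by positivity)]
      have : q ^ (2 * n + 1) ≤ q := pow_le_of_le_one h0.le h1.le (by omega)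
      calc _ ≤ q * (B + 2) := by
            gcongr
            linarith [h2 n]
        _ ≤ B := by nlinarith
  refine ⟨(B + 2) / q, by positivity, fun n => ?_⟩
  rcases lt_or_ge 0 n with hn | hn
  · obtain ⟨m, hm⟩ := Int.eq_ofNat_of_zero_le (show 0 ≤ n - 1 by omega)
    obtain rfl : n = ((m + 1 : ℕ) : ℤ) := by push_cast; omega
    rw [partialTheta_natCast, partialThetaNat, abs_mul, abs_of_pos (by positivity),
      Int.natAbs_natCast, zpow_natCast]
    calc _ ≤ q ^ (2 * m + 1) * (B + 2) := by
          gcongr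
          linarith [h2 m, hb m]
      _ = _ := by field_simp; ring
  · obtain ⟨m, hm⟩ := Int.eq_ofNat_of_zero_le (show 0 ≤ -n by omega)
    obtain rfl : n = -m := by omega
    rw [partialTheta_neg, partialTheta_natCast, abs_neg, Int.natAbs_neg, Int.natAbs_natCast,
      zpow_neg, zpow_natCast, zpow_natCast, inv_mul_cancel₀ (by positivity), mul_one]
    calc _ ≤ B + 2 := by linarith [h2 m, hb m]
      _ ≤ _ := by rw [le_div_iff₀ h0]; nlinarith

lemma exists_abs_partialTheta_bound (h0 : 0 < q) (h1 : q < 1) :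
    ∃ C : ℝ, ∀ n : ℤ, |partialTheta q n| ≤ C := by
  obtain ⟨C, hC, h⟩ := exists_abs_partialTheta_le h0 h1
  refine ⟨C, fun n => (h n).trans ?_⟩
  have : q ^ n * q ^ n.natAbs ≤ 1 := by
    rw [← zpow_natCast, ← zpow_add₀ h0.ne']
    simpa using zpow_le_zpow_right_of_le_one₀ h0 h1.le (show 0 ≤ n + n.natAbs by omega)
  nlinarith

lemma summable_sub_of_reflect {g : ℤ → ℝ} {l : ℝ} (h : ∀ n, g (-n) = l - g n)
    (hs : Summable fun n : ℕ => g n) :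
    (Summable fun m => g (m - 1) - g m) ∧ ∑' m, (g (m - 1) - g m) = l := by
  have hs1 : Summable fun n : ℕ => g ((n : ℤ) + 1) := by
    simpa using (summable_nat_add_iff 1).2 hs
  have hd : Summable fun m => g (m - 1) - g m := by
    refine Summable.of_nat_of_neg ?_ ?_
    · rw [← summable_nat_add_iff 1]
      refine (hs.sub hs1).congr fun n => ?_
      push_cast
      rw [add_sub_cancel_right]
    · refine (hs.sub hs1).congr fun n => ?_
      rw [show -(n : ℤ) - 1 = -(n + 1) by ring, h, h]
      ring
  refine ⟨hd, ?_⟩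
  have ht := hs.tendsto_atTop_zero
  have hb : Tendsto (fun N : ℕ => g (-N)) atTop (𝓝 (l - 0)) := by
    simp only [h]; exact tendsto_const_nhds.sub ht
  rw [tsum_int_telescope hd hb ht]; ring

lemma logistic_sub (h0 : 0 < q) (h1 : q < 1) :
    (Summable fun m => logistic q (m - 1) - logistic q m) ∧
      ∑' m, (logistic q (m - 1) - logistic q m) = 1 := by
  refine summable_sub_of_reflect (logistic_neg h0) ?_
  refine (summable_geometric_of_lt_one h0.le h1).of_nonneg_of_le
    (fun n => (logistic_pos h0 n).le) fun n => ?_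
  simpa using logistic_le_zpow h0 n

lemma partialTheta_sub (h0 : 0 < q) (h1 : q < 1) :
    (Summable fun m => (-1 : ℝ) ^ (m - 1) * partialTheta q (m - 1) - (-1) ^ m * partialTheta q m) ∧
      ∑' m, ((-1 : ℝ) ^ (m - 1) * partialTheta q (m - 1) - (-1) ^ m * partialTheta q m) = -2 := by
  refine summable_sub_of_reflect (g := fun m => (-1 : ℝ) ^ m * partialTheta q m)
    (fun n => ?_) ?_
  · rw [neg_one_zpow_neg, partialTheta_neg]
    linear_combination -2 * neg_one_zpow_mul_self n
  · obtain ⟨C, hC, h⟩ := exists_abs_partialTheta_le h0 h1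
    refine ((summable_geometric_of_lt_one h0.le h1).mul_left C).of_norm_bounded fun n => ?_
    rw [norm_mul, Real.norm_eq_abs, Real.norm_eq_abs, abs_neg_one_zpow, one_mul]
    refine (h n).trans ?_
    rw [zpow_natCast, Int.natAbs_natCast]
    have : q ^ n ≤ 1 := pow_le_one₀ h0.le h1.le
    have : 0 < q ^ n := by positivity
    gcongr
    nlinarith

lemma eq_zero_index_of_periodic_two {f : ℤ → ℝ} (h2 : ∀ m, f (m + 2) = f m) (h1 : f 1 = f 0) (m : ℤ) :
    f m = f 0 := by
  have h : ∀ m, f (m + 1) = f m := by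
    intro m
    induction m using Int.induction_on with
    | zero => simpa using h1
    | succ i ih => rw [ih, ← h2 i]; ring_nf
    | pred i ih => rw [show -(i : ℤ) - 1 + 1 = -i by ring, ← ih, ← h2 (-i - 1)]; ring_nf
  induction m using Int.induction_on with
  | zero => rfl
  | succ i ih => rw [h, ih]
  | pred i ih => rw [← h, sub_add_cancel, ih]

/-- Convolution of `(-1) ^ k * t ^ (k ^ 2 - k)` with the logistic sequence. -/
noncomputable def logisticConv (t : ℝ) (m : ℤ) : ℝ :=
  ∑' k : ℤ, (-1 : ℝ) ^ k * t ^ (k ^ 2 - k) * logistic (t ^ 2) (m - k)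

/-- Convolution of `q ^ (k ^ 2 - k)` with `partialTheta q`. -/
noncomputable def partialThetaConv (q : ℝ) (m : ℤ) : ℝ :=
  ∑' k : ℤ, q ^ (k ^ 2 - k) * partialTheta q (m - k)

/-- Convolution of the sequences `logistic q` and `partialTheta q`. -/
noncomputable def mixedConv (q : ℝ) (m : ℤ) : ℝ :=
  ∑' n : ℤ, logistic q n * partialTheta q (m - n)

variable {t : ℝ}

lemma summable_logisticConv (h0 : 0 < t) (h1 : t < 1) (m : ℤ) :
    Summable fun k : ℤ => (-1 : ℝ) ^ k * t ^ (k ^ 2 - k) * logistic (t ^ 2) (m - k) :=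
  (summable_sign_zpow_sq_sub h0 h1).abs.of_norm_bounded fun k => by
    have b0 : 0 < t ^ 2 := by positivity
    rw [norm_mul, Real.norm_eq_abs, Real.norm_eq_abs, abs_of_pos (logistic_pos b0 _)]
    exact mul_le_of_le_one_right (abs_nonneg _) (logistic_le_one b0 _)

lemma logisticConv_neg (h0 : 0 < t) (h1 : t < 1) (m : ℤ) :
    logisticConv t (-m) = logisticConv t (m + 1) := by
  have b0 : 0 < t ^ 2 := by positivity
  have h := (summable_sign_zpow_sq_sub h0 h1).tsum_sub (summable_logisticConv h0 h1 (-m))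
  rw [tsum_sign_zpow_sq_sub, zero_sub, ← logisticConv, ← tsum_reflect 1] at h
  rw [← neg_inj, ← h, logisticConv, ← tsum_neg]
  refine tsum_congr fun k => ?_
  rw [show -m - (1 - k) = -(m + 1 - k) by ring, logistic_neg b0, neg_one_zpow_sub,
    show (1 - k) ^ 2 - (1 - k) = k ^ 2 - k by ring]
  simp
  ring

lemma logisticConv_eq_mul (h0 : 0 < t) (m : ℤ) :
    logisticConv t m = t ^ (2 * m - 2) * logisticConv t (2 - m) := by
  have b0 : 0 < t ^ 2 := by positivity
  rw [logisticConv, logisticConv, ← tsum_mul_left, ← tsum_reflect 2]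
  refine tsum_congr fun k => ?_
  rw [logistic_eq_mul_neg b0, show -(m - (2 - k)) = 2 - m - k by ring, neg_one_zpow_sub, sq_zpow]
  have : t ^ ((2 - k) ^ 2 - (2 - k)) * t ^ (2 * (m - (2 - k))) =
      t ^ (2 * m - 2) * t ^ (k ^ 2 - k) := by
    rw [← zpow_add₀ h0.ne', ← zpow_add₀ h0.ne']; congr 1; ring
  have e : (-1 : ℝ) ^ (2 : ℤ) = 1 := by norm_num
  rw [e]
  linear_combination ((-1 : ℝ) ^ k * logistic (t ^ 2) (2 - m - k)) * this

lemma logisticConv_eq (h0 : 0 < t) (h1 : t < 1) (m : ℤ) :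
    logisticConv t m = t ^ (m ^ 2 - m) * logisticConv t 0 := by
  have step : ∀ m, logisticConv t (m + 1) = t ^ (2 * m) * logisticConv t m := fun m => by
    rw [logisticConv_eq_mul h0, ← neg_neg (2 - (m + 1)), logisticConv_neg h0 h1]
    ring_nf
  induction m using Int.induction_on with
  | zero => simp
  | succ i ih =>
    rw [step, ih, ← mul_assoc, ← zpow_add₀ h0.ne']; ring_nf
  | pred i ih =>
    have := step (-i - 1)
    rw [sub_add_cancel, ih] at this
    apply mul_left_cancel₀ (zpow_pos h0 (2 * (-(i : ℤ) - 1))).ne'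
    rw [← this, ← mul_assoc, ← zpow_add₀ h0.ne']; ring_nf

lemma logisticConv_zero (h0 : 0 < t) (h1 : t < 1) :
    logisticConv t 0 = -(thetaFour (t ^ 2) ^ 2) / 2 := by
  have b0 : 0 < t ^ 2 := by positivity
  have b1 : t ^ 2 < 1 := by nlinarith
  have h := tsum_conv_bounded_variation (M := 1) (summable_sign_zpow_sq_sub h0 h1)
    (summable_jacobiCube h0 h1) (tsum_sign_zpow_sq_sub t)
    (fun n => by rw [abs_of_pos (logistic_pos b0 n)]; exact logistic_le_one b0 n)
    (logistic_sub b0 b1).1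
  rw [(logistic_sub b0 b1).2, one_mul, ← jacobiCube, jacobiCube_eq h0 h1] at h
  change ∑' m, logisticConv t m = _ at h
  rw [tsum_congr fun m => logisticConv_eq h0 h1 m, tsum_mul_right, tsum_zpow_sq_sub h0 h1] at h
  have n3 := (triangularTheta_pos h0 h1).ne'
  apply mul_left_cancel₀ n3
  linarith

lemma summable_partialThetaConv (h0 : 0 < q) (h1 : q < 1) (m : ℤ) :
    Summable fun k : ℤ => q ^ (k ^ 2 - k) * partialTheta q (m - k) := by
  obtain ⟨C, hC⟩ := exists_abs_partialTheta_bound h0 h1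
  refine ((summable_zpow_sq_sub h0 h1).mul_right C).of_norm_bounded fun k => ?_
  rw [norm_mul, Real.norm_eq_abs, Real.norm_eq_abs, abs_of_pos (by positivity)]
  gcongr
  exact hC _

lemma partialThetaConv_neg (h0 : 0 < q) (h1 : q < 1) (m : ℤ) :
    partialThetaConv q (-m) = -partialThetaConv q (m + 1) := by
  have h := (summable_partialThetaConv h0 h1 (-m)).tsum_add
    ((summable_sign_zpow_sq_sub h0 h1).mul_left (2 * (-1) ^ m))
  rw [tsum_mul_left, tsum_sign_zpow_sq_sub, mul_zero, add_zero, ← partialThetaConv,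
    ← tsum_reflect 1] at h
  rw [← h, partialThetaConv, ← tsum_neg]
  refine tsum_congr fun k => ?_
  rw [show -m - (1 - k) = -(m + 1 - k) by ring, partialTheta_neg, neg_one_zpow_sub,
    neg_one_zpow_sub, neg_one_zpow_add, show (1 - k) ^ 2 - (1 - k) = k ^ 2 - k by ring]
  simp
  ring

lemma partialThetaConv_add_one (h0 : 0 < q) (m : ℤ) :
    partialThetaConv q (m + 1) = -(q ^ (2 * m - 1) * partialThetaConv q (2 - m)) := by
  rw [partialThetaConv, partialThetaConv, ← tsum_mul_left, ← tsum_neg, ← tsum_reflect 2]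
  refine tsum_congr fun k => ?_
  rw [show m + 1 - (2 - k) = m - 2 + k + 1 by ring, partialTheta_add_one h0,
    show -(m - 2 + k) = 2 - m - k by ring]
  have : q ^ ((2 - k) ^ 2 - (2 - k)) * q ^ (2 * (m - 2 + k) + 1) =
      q ^ (2 * m - 1) * q ^ (k ^ 2 - k) := by
    rw [← zpow_add₀ h0.ne', ← zpow_add₀ h0.ne']; congr 1; ring
  linear_combination -partialTheta q (2 - m - k) * this

lemma partialThetaConv_eq (h0 : 0 < t) (h1 : t < 1) (m : ℤ) :
    partialThetaConv (t ^ 2) m = (-1) ^ m * t ^ (m ^ 2 - m) * partialThetaConv (t ^ 2) 0 := by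
  have b0 : 0 < t ^ 2 := by positivity
  have b1 : t ^ 2 < 1 := by nlinarith
  have step : ∀ m, partialThetaConv (t ^ 2) (m + 2)
      = (t ^ 2) ^ (2 * m + 1) * partialThetaConv (t ^ 2) m := fun m => by
    rw [show m + 2 = m + 1 + 1 by ring, partialThetaConv_add_one b0,
      show 2 - (m + 1) = -(m - 1) by ring, partialThetaConv_neg b0 b1]
    ring_nf
  have key := eq_zero_index_of_periodic_two
    (f := fun m => (-1) ^ m * t ^ (-(m ^ 2 - m)) * partialThetaConv (t ^ 2) m)
    (fun m => by
      simp only [step, neg_one_zpow_add]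
      have : t ^ (-((m + 2) ^ 2 - (m + 2))) * (t ^ 2) ^ (2 * m + 1) = t ^ (-(m ^ 2 - m)) := by
        rw [sq_zpow, ← zpow_add₀ h0.ne']; congr 1; ring
      have e : (-1 : ℝ) ^ (2 : ℤ) = 1 := by norm_num
      rw [e]
      linear_combination ((-1) ^ m * partialThetaConv (t ^ 2) m) * this)
    (by
      have := partialThetaConv_neg b0 b1 0
      rw [neg_zero, zero_add] at this
      simp [this]) m
  have e1 := neg_one_zpow_mul_self m
  have e2 : t ^ (-(m ^ 2 - m)) * t ^ (m ^ 2 - m) = 1 := by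
    rw [← zpow_add₀ h0.ne', neg_add_cancel, zpow_zero]
  norm_num at key
  rw [neg_sub] at e2
  rw [← key]
  linear_combination (-(partialThetaConv (t ^ 2) m)) * e1
    - (-1) ^ m * (-1) ^ m * partialThetaConv (t ^ 2) m * e2

lemma partialThetaConv_zero (h0 : 0 < t) (h1 : t < 1) :
    partialThetaConv (t ^ 2) 0 = thetaFour (t ^ 2) * triangularTheta t := by
  have b0 : 0 < t ^ 2 := by positivity
  have b1 : t ^ 2 < 1 := by nlinarith
  obtain ⟨C, hC⟩ := exists_abs_partialTheta_bound b0 b1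
  have h := tsum_conv_bounded_variation (M := C) (g := fun m => (-1) ^ m * partialTheta (t ^ 2) m)
    (summable_sign_zpow_sq_sub b0 b1)
    (summable_jacobiCube b0 b1) (tsum_sign_zpow_sq_sub (t ^ 2))
    (fun n => by rw [abs_mul, abs_neg_one_zpow, one_mul]; exact hC n)
    (partialTheta_sub b0 b1).1
  rw [(partialTheta_sub b0 b1).2, ← jacobiCube, jacobiCube_sq_eq h0 h1] at h
  have h3 : ∀ m : ℤ, ∑' k : ℤ, (-1 : ℝ) ^ k * (t ^ 2) ^ (k ^ 2 - k) *
      ((-1) ^ (m - k) * partialTheta (t ^ 2) (m - k)) =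
      t ^ (m ^ 2 - m) * partialThetaConv (t ^ 2) 0 := fun m => by
    have e := partialThetaConv_eq h0 h1 m
    have e1 := neg_one_zpow_mul_self m
    trans (-1) ^ m * partialThetaConv (t ^ 2) m
    · rw [partialThetaConv, ← tsum_mul_left]
      refine tsum_congr fun k => ?_
      rw [neg_one_zpow_sub]
      linear_combination ((t ^ 2) ^ (k ^ 2 - k) * (-1) ^ m * partialTheta (t ^ 2) (m - k))
        * neg_one_zpow_mul_self k
    · rw [e]; linear_combination (t ^ (m ^ 2 - m) * partialThetaConv (t ^ 2) 0) * e1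
  rw [tsum_congr h3, tsum_mul_right, tsum_zpow_sq_sub h0 h1] at h
  have n3 := (triangularTheta_pos h0 h1).ne'
  apply mul_left_cancel₀ n3
  linarith

end

section

variable {q t : ℝ}

lemma exists_mixed_bound (h0 : 0 < q) (h1 : q < 1) :
    ∃ C : ℝ, 0 < C ∧ ∀ m n : ℤ,
      |logistic q n * partialTheta q (m - n)| ≤ C * (q ^ m * q ^ (m - n).natAbs) := by
  obtain ⟨C, hC, h⟩ := exists_abs_partialTheta_le h0 h1
  refine ⟨C, hC, fun m n => ?_⟩
  rw [abs_mul, abs_of_pos (logistic_pos h0 n)]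
  calc _ ≤ q ^ n * (C * (q ^ (m - n) * q ^ (m - n).natAbs)) := by
        gcongr
        · exact logistic_le_zpow h0 n
        · exact h _
    _ = _ := by rw [zpow_sub₀ h0.ne']; field_simp

lemma summable_pow_natAbs (h0 : 0 < q) (h1 : q < 1) : Summable fun n : ℤ => q ^ n.natAbs := by
  refine summable_of_abs_le_weight h0 h1 1 fun k => ?_
  rw [abs_of_pos (by positivity), weight]
  have : 0 < q ^ k.natAbs := by positivity
  nlinarith [abs_nonneg (k : ℝ)]

lemma summable_mixedConv (h0 : 0 < q) (h1 : q < 1) (m : ℤ) :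
    Summable fun n : ℤ => logistic q n * partialTheta q (m - n) := by
  obtain ⟨C, hC, h⟩ := exists_mixed_bound h0 h1
  refine Summable.of_norm_bounded (g := fun n => C * (q ^ m * q ^ (m - n).natAbs)) ?_ (h m)
  exact (((Equiv.subLeft m).summable_iff.2 (summable_pow_natAbs h0 h1)).mul_left _).mul_left _

lemma tsum_zpow_mul_partialTheta (h0 : 0 < q) (m : ℤ) :
    ∑' n : ℤ, q ^ n * partialTheta q (m - n) = 0 := by
  have h : ∑' n : ℤ, q ^ (-n) * partialTheta q n = 0 := by
    have e := tsum_translate 1 fun n => q ^ (-n) * partialTheta q n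
    have e2 : ∀ n : ℤ, q ^ (-(n + 1)) * partialTheta q (n + 1) =
        -(q ^ (- -n) * partialTheta q (-n)) := fun n => by
      rw [partialTheta_add_one h0, mul_neg, ← mul_assoc, ← zpow_add₀ h0.ne']
      ring_nf
    rw [tsum_congr e2, tsum_neg] at e
    have e3 := (Equiv.neg ℤ).tsum_eq fun n => q ^ (-n) * partialTheta q n
    simp only [Equiv.neg_apply] at e3
    linarith
  rw [← tsum_reflect m]
  have e : ∀ n : ℤ, q ^ (m - n) * partialTheta q (m - (m - n)) =
      q ^ m * (q ^ (-n) * partialTheta q n) := fun n => by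
    rw [sub_sub_cancel, sub_eq_add_neg, zpow_add₀ h0.ne']; ring
  rw [tsum_congr e, tsum_mul_left, h, mul_zero]

lemma mixedConv_reflect (h0 : 0 < q) (h1 : q < 1) (m : ℤ) :
    mixedConv q m = q ^ (2 * m - 1) * mixedConv q (1 - m) := by
  have hl : ∀ n : ℤ, logistic q n * q ^ n = q ^ n - logistic q n := fun n => by
    have e1 := logistic_neg h0 n
    have e2 := logistic_eq_mul_neg h0 n
    rw [e1] at e2
    linarith
  have hs : Summable fun n : ℤ => logistic q n * q ^ n * partialTheta q (m - n) := by
    obtain ⟨C, hC, h⟩ := exists_abs_partialTheta_le h0 h1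
    refine Summable.of_norm_bounded (g := fun n => C * (q ^ m * q ^ (m - n).natAbs)) ?_ fun n => ?_
    · exact (((Equiv.subLeft m).summable_iff.2 (summable_pow_natAbs h0 h1)).mul_left _).mul_left _
    · rw [norm_mul, Real.norm_eq_abs, Real.norm_eq_abs,
        abs_of_pos (mul_pos (logistic_pos h0 n) (zpow_pos h0 n))]
      calc _ ≤ q ^ n * (C * (q ^ (m - n) * q ^ (m - n).natAbs)) := by
            gcongr
            · exact mul_le_of_le_one_left (zpow_pos h0 n).le (logistic_le_one h0 n)
            · exact h _
        _ = _ := by rw [zpow_sub₀ h0.ne']; field_simp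
  have e := (summable_mixedConv h0 h1 m).tsum_add hs
  have e1 : ∀ n : ℤ, logistic q n * partialTheta q (m - n) +
      logistic q n * q ^ n * partialTheta q (m - n) = q ^ n * partialTheta q (m - n) := fun n => by
    rw [hl]; ring
  rw [tsum_congr e1, tsum_zpow_mul_partialTheta h0, ← mixedConv] at e
  have e2 : mixedConv q m = -∑' n : ℤ, logistic q n * q ^ n * partialTheta q (m - n) := by linarith
  rw [e2, mixedConv, ← tsum_mul_left, ← tsum_neg, ← (Equiv.neg ℤ).tsum_eq]
  refine tsum_congr fun n => ?_
  simp only [Equiv.neg_apply]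
  rw [show m - -n = m + n - 1 + 1 by ring, partialTheta_add_one h0,
    show -(m + n - 1) = 1 - m - n by ring, logistic_eq_mul_neg h0 (-n), neg_neg]
  have : q ^ (-n) * q ^ (-n) * q ^ (2 * (m + n - 1) + 1) = q ^ (2 * m - 1) := by
    rw [← zpow_add₀ h0.ne', ← zpow_add₀ h0.ne']; congr 1; ring
  linear_combination logistic q n * partialTheta q (1 - m - n) * this

lemma mixedConv_neg (h0 : 0 < q) (h1 : q < 1) (m : ℤ) : mixedConv q (-m) = mixedConv q m := by
  obtain ⟨T, hT⟩ : ∃ T : ℤ → ℤ → ℝ, ∀ m N, T m N =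
      partialTheta q N + 2 * (-1) ^ N * logistic q (N - m) := ⟨_, fun _ _ => rfl⟩
  have hdiff : ∀ m, Summable (T m) ∧ mixedConv q m - mixedConv q (-m) = ∑' N, T m N := fun m => by
    have s1 := summable_mixedConv h0 h1 m
    have s2 : Summable fun n => logistic q (-n) * partialTheta q (-m - -n) :=
      ((Equiv.neg ℤ).summable_iff (f := fun n => logistic q n * partialTheta q (-m - n))).2
        (summable_mixedConv h0 h1 (-m))
    have e2 := (Equiv.neg ℤ).tsum_eq fun n => logistic q n * partialTheta q (-m - n)
    have e : ∀ n, logistic q n * partialTheta q (m - n) -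
        logistic q (-n) * partialTheta q (-m - -n) = T m (m - n) := fun n => by
      simp only [hT]
      rw [show -m - -n = -(m - n) by ring, partialTheta_neg, logistic_neg h0,
        show m - n - m = -n by ring, logistic_neg h0]
      ring
    simp only [Equiv.neg_apply] at e2
    have s3 := (s1.sub s2).congr (g := fun n => T m (m - n)) e
    refine ⟨((Equiv.subLeft m).summable_iff (f := T m)).1 s3, ?_⟩
    rw [mixedConv, mixedConv, ← e2, ← s1.tsum_sub s2, ← tsum_reflect m (T m)]
    exact tsum_congr e
  have hstep : ∀ m, ∑' N, T (m + 1) N = ∑' N, T m N := fun m => by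
    have h := (hdiff (m + 1)).1.tsum_sub (hdiff m).1
    have hr := tsum_reflect (2 * m + 1) fun N => T (m + 1) N - T m N
    have e : ∀ N, T (m + 1) (2 * m + 1 - N) - T m (2 * m + 1 - N) = -(T (m + 1) N - T m N) :=
      fun N => by
        simp only [hT]
        rw [show 2 * m + 1 - N - (m + 1) = -(N - m) by ring,
          show 2 * m + 1 - N - m = -(N - (m + 1)) by ring, logistic_neg h0, logistic_neg h0,
          neg_one_zpow_sub, Odd.neg_one_zpow ⟨m, rfl⟩]
        ring
    rw [tsum_congr e, tsum_neg] at hr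
    linarith
  have h : ∀ m, ∑' N, T m N = 0 := by
    have h00 : ∑' N, T 0 N = 0 := by rw [← (hdiff 0).2]; simp
    intro m
    induction m using Int.induction_on with
    | zero => exact h00
    | succ i ih => rw [hstep, ih]
    | pred i ih => rw [← hstep, sub_add_cancel, ih]
  have := (hdiff m).2
  rw [h] at this
  linarith

lemma mixedConv_eq (h0 : 0 < q) (h1 : q < 1) (m : ℤ) :
    mixedConv q m = q ^ (m ^ 2) * mixedConv q 0 := by
  have step : ∀ m, mixedConv q (m + 1) = q ^ (2 * m + 1) * mixedConv q m := fun m => by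
    rw [mixedConv_reflect h0 h1, show 1 - (m + 1) = -m by ring, mixedConv_neg h0 h1]
    ring_nf
  induction m using Int.induction_on with
  | zero => simp
  | succ i ih =>
    rw [step, ih, ← mul_assoc, ← zpow_add₀ h0.ne']; ring_nf
  | pred i ih =>
    have := step (-i - 1)
    rw [sub_add_cancel, ih] at this
    apply mul_left_cancel₀ (zpow_pos h0 (2 * (-(i : ℤ) - 1) + 1)).ne'
    rw [← this, ← mul_assoc, ← zpow_add₀ h0.ne']; ring_nf

lemma mixedConv_zero (h0 : 0 < t) (h1 : t < 1) :
    -2 * mixedConv (t ^ 2) 0 = thetaFour (t ^ 2) ^ 3 := by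
  have b0 : 0 < t ^ 2 := by positivity
  have b1 : t ^ 2 < 1 := by nlinarith
  set q := t ^ 2 with hq
  set f : ℤ → ℤ → ℝ := fun k n => q ^ (k ^ 2 - k) * (logistic q n * partialTheta q (-k - n)) with hf
  have hs : Summable (Function.uncurry f) := by
    obtain ⟨C, hC, h⟩ := exists_mixed_bound b0 b1
    have s1 : Summable fun k : ℤ => C * (q ^ (k ^ 2 - k) * q ^ (-k)) := by
      have := ((Equiv.subRight (1 : ℤ)).summable_iff.2 (summable_zpow_sq b0 b1)).mul_left (C * q⁻¹)
      refine this.congr fun k => ?_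
      simp only [Function.comp, Equiv.subRight_apply]
      rw [← zpow_add₀ b0.ne', mul_assoc, ← zpow_neg_one, ← zpow_add₀ b0.ne']
      ring_nf
    have s2 : Summable fun x : ℤ × ℤ =>
        (C * (q ^ (x.1 ^ 2 - x.1) * q ^ (-x.1))) * q ^ x.2.natAbs :=
      s1.mul_of_nonneg (summable_pow_natAbs b0 b1) (fun k => by positivity) fun k => by positivity
    let e : ℤ × ℤ ≃ ℤ × ℤ :=
      { toFun := fun x => (x.1, -x.1 - x.2)
        invFun := fun x => (x.1, -x.1 - x.2)
        left_inv := fun x => by ext <;> simp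
        right_inv := fun x => by ext <;> simp }
    refine Summable.of_norm_bounded (e.summable_iff.2 s2) fun x => ?_
    simp only [Function.uncurry, hf, Function.comp, e, Equiv.coe_fn_mk, norm_mul, Real.norm_eq_abs]
    rw [← abs_mul (logistic q _), abs_of_pos (zpow_pos b0 (x.1 ^ 2 - x.1))]
    calc _ ≤ q ^ (x.1 ^ 2 - x.1) * (C * (q ^ (-x.1) * q ^ (-x.1 - x.2).natAbs)) := by
          gcongr
          exact h _ _
      _ = _ := by ring
  have h := Summable.tsum_comm hs
  have e1 : ∀ n, ∑' k, f k n =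
      (-1) ^ n * t ^ (n ^ 2 + n) * logistic q n * partialThetaConv q 0 := fun n => by
    trans logistic q n * partialThetaConv q (-n)
    · rw [partialThetaConv, ← tsum_mul_left]
      refine tsum_congr fun k => ?_
      simp only [hf]
      rw [show -k - n = -n - k by ring]
      ring
    · rw [partialThetaConv_eq h0 h1, neg_one_zpow_neg, ← hq, neg_sq, sub_neg_eq_add]
      ring
  have e2 : ∀ k, ∑' n, f k n = t ^ (4 * k ^ 2 - 2 * k) * mixedConv q 0 := fun k => by
    simp only [hf]
    rw [tsum_mul_left, ← mixedConv, mixedConv_eq b0 b1, ← mul_assoc, ← zpow_add₀ b0.ne', hq,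
      sq_zpow]
    ring_nf
  have e3 : ∑' n : ℤ, (-1) ^ n * t ^ (n ^ 2 + n) * logistic q n = logisticConv t 0 := by
    rw [logisticConv, ← (Equiv.neg ℤ).tsum_eq]
    refine tsum_congr fun n => ?_
    simp only [Equiv.neg_apply]
    rw [neg_one_zpow_neg, zero_sub, neg_sq, ← sub_eq_add_neg]
  rw [tsum_congr e1, tsum_congr e2, tsum_mul_right, tsum_mul_right, e3, ← triangularTheta,
    logisticConv_zero h0 h1, partialThetaConv_zero h0 h1, ← hq] at h
  have n3 := (triangularTheta_pos h0 h1).ne'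
  apply mul_left_cancel₀ n3
  linear_combination 2 * h

end

section

variable {q : ℝ}

/-- The term `(-1) ^ (x + y) * q ^ (x * y)` with `x = p.1 + 1`, `y = p.2 + 1`. -/
noncomputable def pairTerm (q : ℝ) (p : ℕ × ℕ) : ℝ :=
  (-1) ^ (p.1 + p.2) * q ^ ((p.1 + 1) * (p.2 + 1))

/-- The exponent `r * s + r * z + s * z` with `r = p.1.1 + 1`, `s = p.1.2 + 1`, `z = p.2 + 1`. -/
def tripleExponent (p : (ℕ × ℕ) × ℕ) : ℕ :=
  (p.1.1 + 1) * (p.1.2 + 1) + (p.1.1 + 1) * (p.2 + 1) + (p.1.2 + 1) * (p.2 + 1)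

/-- The term `(-1) ^ (r + s + z) * q ^ (r * s + r * z + s * z)`, with `r`, `s`, `z` as in
`tripleExponent`. -/
noncomputable def tripleTerm (q : ℝ) (p : (ℕ × ℕ) × ℕ) : ℝ :=
  (-1) ^ (p.1.1 + p.1.2 + p.2 + 1) * q ^ tripleExponent p

lemma summable_pairTerm (h0 : 0 < q) (h1 : q < 1) : Summable (pairTerm q) := by
  have hg := summable_geometric_of_lt_one h0.le h1
  refine Summable.of_norm_bounded
    (hg.mul_of_nonneg hg (fun _ => by positivity) fun _ => by positivity) fun p => ?_
  rw [pairTerm, norm_mul, norm_pow, norm_neg, norm_one, one_pow, one_mul,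
    Real.norm_of_nonneg (by positivity), ← pow_add]
  exact pow_le_pow_of_le_one h0.le h1.le (by nlinarith)

lemma summable_tripleTerm (h0 : 0 < q) (h1 : q < 1) : Summable (tripleTerm q) := by
  have hg := summable_geometric_of_lt_one h0.le h1
  have hg2 := hg.mul_of_nonneg hg (fun _ => by positivity) fun _ => by positivity
  refine Summable.of_norm_bounded
    (hg2.mul_of_nonneg hg (fun _ => by positivity) fun _ => by positivity) fun p => ?_
  rw [tripleTerm, norm_mul, norm_pow, norm_neg, norm_one, one_pow, one_mul,
    Real.norm_of_nonneg (by positivity), ← pow_add, ← pow_add]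
  refine pow_le_pow_of_le_one h0.le h1.le ?_
  rw [tripleExponent]
  nlinarith [Nat.zero_le (p.1.1 * p.1.2), Nat.zero_le (p.1.1 * p.2), Nat.zero_le (p.1.2 * p.2)]

lemma hasSum_logistic (h0 : 0 < q) (h1 : q < 1) (n : ℕ) :
    HasSum (fun l : ℕ => (-1) ^ l * (q ^ (n + 1)) ^ (l + 1)) (logistic q (n + 1)) := by
  have hx : 0 < q ^ (n + 1) := by positivity
  have hx1 : q ^ (n + 1) < 1 := pow_lt_one₀ h0.le h1 (by omega)
  have h := (hasSum_geometric_of_abs_lt_one (r := -q ^ (n + 1))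
    (by rwa [abs_neg, abs_of_pos hx])).mul_left (q ^ (n + 1))
  have e : logistic q (n + 1) = q ^ (n + 1) * (1 - -q ^ (n + 1))⁻¹ := by
    rw [logistic, sub_neg_eq_add, div_eq_mul_inv]
    norm_cast
  rw [e]
  refine h.congr_fun fun l => ?_
  rw [neg_pow]; ring

lemma hasSum_one_sub_logistic (h0 : 0 < q) (h1 : q < 1) (n : ℕ) :
    HasSum (fun l : ℤ => (-1) ^ l * (q ^ (n + 1)) ^ l.natAbs) (1 - 2 * logistic q (n + 1)) := by
  have hx : 0 < q ^ (n + 1) := by positivity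
  have hx1 : q ^ (n + 1) < 1 := pow_lt_one₀ h0.le h1 (by omega)
  have hl := hasSum_logistic h0 h1 n
  have h := hasSum_geometric_of_abs_lt_one (r := -q ^ (n + 1)) (by rwa [abs_neg, abs_of_pos hx])
  have e : 1 - 2 * logistic q (n + 1) = (1 - -q ^ (n + 1))⁻¹ + -logistic q (n + 1) := by
    have : logistic q (n + 1) = q ^ (n + 1) / (1 + q ^ (n + 1)) := by
      rw [logistic]; norm_cast
    rw [this, sub_neg_eq_add]; field_simp; ring
  rw [e]
  refine HasSum.of_nat_of_neg_add_one (h.congr_fun fun l => ?_) (hl.neg.congr_fun fun l => ?_)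
  · rw [neg_pow]; simp
  · rw [neg_one_zpow_neg, Int.natAbs_neg, show (l : ℤ) + 1 = ((l + 1 : ℕ) : ℤ) by push_cast; rfl,
      Int.natAbs_natCast, zpow_natCast]
    ring

/-- A pair of natural numbers is determined by its minimum and its difference. -/
def minSubEquiv : ℕ × ℤ ≃ ℕ × ℕ where
  toFun x := (x.1 + (-x.2).toNat, x.1 + x.2.toNat)
  invFun x := (min x.1 x.2, (x.2 : ℤ) - x.1)
  left_inv x := by ext <;> simp; omega
  right_inv x := by ext <;> simp <;> omega

lemma neg_one_pow_toNat_add (l : ℤ) : (-1 : ℝ) ^ ((-l).toNat + l.toNat) = (-1) ^ l := by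
  rcases Int.eq_nat_or_neg l with ⟨j, rfl | rfl⟩
  · simp
  · rw [neg_one_zpow_neg]; simp

lemma hasSum_one_sub_logistic_mul_pow (h0 : 0 < q) (h1 : q < 1) :
    HasSum (fun n : ℕ => (1 - 2 * logistic q (n + 1)) * q ^ ((n + 1) ^ 2)) (∑' p, pairTerm q p) := by
  refine HasSum.prod_fiberwise (minSubEquiv.hasSum_iff.2 (summable_pairTerm h0 h1).hasSum) fun n => ?_
  refine ((hasSum_one_sub_logistic h0 h1 n).mul_right _).congr_fun fun l => ?_
  simp only [Function.comp, minSubEquiv, Equiv.coe_fn_mk, pairTerm]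
  have e : (-1 : ℝ) ^ (n + (-l).toNat + (n + l.toNat)) = (-1) ^ l := by
    rw [← neg_one_pow_toNat_add, show n + (-l).toNat + (n + l.toNat) =
      2 * n + ((-l).toNat + l.toNat) by ring, pow_add, pow_mul]
    simp
  have e2 : (n + (-l).toNat + 1) * (n + l.toNat + 1) = (n + 1) * l.natAbs + (n + 1) ^ 2 := by
    rcases Int.eq_nat_or_neg l with ⟨j, rfl | rfl⟩ <;> simp <;> ring
  rw [e, e2, pow_add, pow_mul]
  ring

lemma hasSum_sign_mul_logistic (h0 : 0 < q) (h1 : q < 1) :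
    HasSum (fun n : ℕ => (-1) ^ n * logistic q (n + 1)) (∑' p, pairTerm q p) := by
  refine HasSum.prod_fiberwise (summable_pairTerm h0 h1).hasSum fun n => ?_
  refine ((hasSum_logistic h0 h1 n).mul_left _).congr_fun fun l => ?_
  simp only [pairTerm]
  rw [pow_add, pow_mul]
  ring

/-- Parametrization of triples `(r, s, z)` by `z`, `min r s` and `s - r`. -/
def tripleEquiv : (ℕ × ℕ) × ℤ ≃ (ℕ × ℕ) × ℕ where
  toFun x := (minSubEquiv (x.1.2, x.2), x.1.1)
  invFun x := ((x.2, (minSubEquiv.symm x.1).1), (minSubEquiv.symm x.1).2)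
  left_inv x := by simp
  right_inv x := by simp

lemma hasSum_sum_range {F : ℕ × ℕ → ℝ} {s : ℝ} (h : HasSum F s) :
    HasSum (fun n : ℕ => ∑ z ∈ Finset.range n, F (z, n - 1 - z)) s := by
  have hb := ((Finset.HasAntidiagonal.sigmaAntidiagonalEquivProd (A := ℕ)).hasSum_iff.2 h).sigma
    (g := fun k => ∑ x ∈ Finset.HasAntidiagonal.antidiagonal k, F x) fun k => Finset.hasSum _ F
  rw [← hasSum_nat_add_iff' 1]
  simpa [Finset.Nat.sum_antidiagonal_eq_sum_range_succ_mk] using hb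

lemma hasSum_one_sub_logistic_mul_sum (h0 : 0 < q) (h1 : q < 1) :
    HasSum (fun n : ℕ => (1 - 2 * logistic q (n + 1)) *
      ∑ z ∈ Finset.range n, (-1) ^ (z + 1) * q ^ (((n : ℤ) + 1) ^ 2 - (z + 1) ^ 2))
      (∑' p, tripleTerm q p) := by
  have ha : HasSum (fun x : ℕ × ℕ => (1 - 2 * logistic q ((x.1 + x.2 + 1 : ℕ) + 1)) *
      ((-1) ^ (x.1 + 1) * q ^ ((x.2 + 1) * (x.2 + 2 * x.1 + 3)))) (∑' p, tripleTerm q p) := by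
    refine HasSum.prod_fiberwise (tripleEquiv.hasSum_iff.2 (summable_tripleTerm h0 h1).hasSum)
      fun x => ?_
    refine ((hasSum_one_sub_logistic h0 h1 (x.1 + x.2 + 1)).mul_right _).congr_fun fun l => ?_
    simp only [Function.comp, tripleEquiv, minSubEquiv, Equiv.coe_fn_mk, tripleTerm,
      tripleExponent]
    obtain ⟨z, m⟩ := x
    have e : (-1 : ℝ) ^ (m + (-l).toNat + (m + l.toNat) + z + 1) = (-1) ^ l * (-1) ^ (z + 1) := by
      rw [← neg_one_pow_toNat_add, show m + (-l).toNat + (m + l.toNat) + z + 1 =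
        2 * m + (((-l).toNat + l.toNat) + (z + 1)) by ring, pow_add, pow_mul, pow_add]
      simp
    have e2 : (m + (-l).toNat + 1) * (m + l.toNat + 1) + (m + (-l).toNat + 1) * (z + 1) +
        (m + l.toNat + 1) * (z + 1) =
        (z + m + 1 + 1) * l.natAbs + (m + 1) * (m + 2 * z + 3) := by
      rcases Int.eq_nat_or_neg l with ⟨j, rfl | rfl⟩ <;> simp <;> ring
    simp only
    rw [e, e2, pow_add, pow_mul]
    ring
  refine (hasSum_sum_range ha).congr_fun fun n => ?_
  rw [Finset.mul_sum]
  refine Finset.sum_congr rfl fun z hz => ?_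
  obtain ⟨m, rfl⟩ := Nat.exists_eq_add_of_lt (Finset.mem_range.1 hz)
  have e : z + m + 1 - 1 - z = m := by omega
  rw [e, ← zpow_natCast q]
  push_cast
  ring_nf

lemma partialThetaNat_succ (h0 : 0 < q) (n : ℕ) : partialThetaNat q (n + 1) = q ^ ((n + 1) ^ 2) +
    2 * ∑ z ∈ Finset.range n, (-1) ^ (z + 1) * q ^ (((n : ℤ) + 1) ^ 2 - (z + 1) ^ 2) := by
  induction n with
  | zero => simp [partialThetaNat]; norm_num
  | succ n ih =>
    rw [partialThetaNat, ih, Finset.sum_range_succ]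
    have e : ∀ z : ℕ, (-1) ^ (z + 1) * q ^ ((((n + 1 : ℕ) : ℤ) + 1) ^ 2 - (z + 1) ^ 2) =
        q ^ (2 * (n + 1) + 1) * ((-1) ^ (z + 1) * q ^ (((n : ℤ) + 1) ^ 2 - (z + 1) ^ 2)) :=
      fun z => by
        rw [mul_left_comm, ← zpow_natCast q (2 * (n + 1) + 1), ← zpow_add₀ h0.ne']
        push_cast
        ring_nf
    simp only [e]
    rw [← Finset.mul_sum, sub_self, zpow_zero]
    ring

lemma thetaFour_cube (h0 : 0 < q) (h1 : q < 1) :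
    thetaFour q ^ 3 = 1 - 6 * ∑' p, pairTerm q p - 4 * ∑' p, tripleTerm q p := by
  have ht0 : 0 < √q := Real.sqrt_pos.2 h0
  have ht1 : √q < 1 := by rw [Real.sqrt_lt' one_pos]; simpa
  have h := mixedConv_zero ht0 ht1
  rw [Real.sq_sqrt h0.le] at h
  rw [← h]
  have hs := summable_mixedConv h0 h1 0
  set f : ℤ → ℝ := fun n => logistic q n * partialTheta q (0 - n) with hf
  have hs1 : Summable fun n : ℕ => f (n + 1) :=
    hs.comp_injective (i := fun n : ℕ => (n : ℤ) + 1) fun a b h => by simpa using h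
  have hs2 : Summable fun n : ℕ => f (-(n + 1)) :=
    hs.comp_injective (i := fun n : ℕ => -((n : ℤ) + 1)) fun a b h => by simpa using h
  have hY := tsum_of_add_one_of_neg_add_one hs1 hs2
  have hA := hasSum_one_sub_logistic_mul_pow h0 h1
  have hB := hasSum_one_sub_logistic_mul_sum h0 h1
  have hC := hasSum_sign_mul_logistic h0 h1
  have hD := ((hA.add (hB.mul_left 2)).add (hC.mul_left 2)).unique
    ((hs1.hasSum.add hs2.hasSum).congr_fun fun n => ?_)
  · have f0 : f 0 = -1 / 2 := by
      simp [hf, logistic, show partialTheta q 0 = -1 from rfl]; norm_num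
    rw [mixedConv, hY, f0]
    linarith
  · simp only [hf]
    have e : partialTheta q ((n : ℤ) + 1) = partialThetaNat q (n + 1) :=
      partialTheta_natCast q (n + 1)
    have e2 : (-1 : ℝ) ^ ((n : ℤ) + 1) = -(-1) ^ n := by
      rw [neg_one_zpow_add, zpow_natCast]; simp
    rw [zero_sub, zero_sub, neg_neg, partialTheta_neg, logistic_neg h0, e, e2,
      partialThetaNat_succ h0]
    ring

end

lemma hasSum_fiberwise_exponent {ι : Type*} {s : ι → ℝ} {e : ι → ℕ} {q : ℝ}
    (h : Summable fun i => s i * q ^ e i) :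
    HasSum (fun n => (∑' i : {i // e i = n}, s i) * q ^ n) (∑' i, s i * q ^ e i) := by
  have hs := (Equiv.sigmaFiberEquiv e).hasSum_iff.2 h.hasSum
  refine hs.sigma fun n => ?_
  have hn := (hs.summable.sigma_factor n).hasSum
  have e1 : ∀ c : {i // e i = n}, s c * q ^ e c = s c * q ^ n := fun c => by rw [c.2]
  have e2 : ∑' c : {i // e i = n}, s c * q ^ e c = (∑' c : {i // e i = n}, s c) * q ^ n := by
    rw [tsum_congr e1, tsum_mul_right]
  rw [← e2]
  exact hn

lemma coeff_eq_zero_of_hasSum_zero {d : ℕ → ℝ}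
    (h : ∀ q : ℝ, 0 < q → q < 1 → HasSum (fun n => d n * q ^ n) 0) (n : ℕ) : d n = 0 := by
  have h0 : ∀ d : ℕ → ℝ, (∀ q : ℝ, 0 < q → q < 1 → HasSum (fun n => d n * q ^ n) 0) → d 0 = 0 := by
    intro d h
    have hl := tendsto_tsum_zpow_nhdsGT_zero (c := d) (e := fun n => (n : ℤ))
      (fun k => Int.natCast_nonneg k)
      ((h (1 / 2) (by norm_num) (by norm_num)).summable.abs.congr fun n => by
        rw [abs_mul, abs_of_pos (a := (1 / 2 : ℝ) ^ n) (by positivity), zpow_natCast])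
    have hz : Tendsto (fun a : ℝ => ∑' k : ℕ, d k * a ^ (k : ℤ)) (𝓝[>] 0) (𝓝 0) := by
      refine tendsto_const_nhds.congr' ?_
      filter_upwards [Ioo_mem_nhdsGT (show (0 : ℝ) < 1 by norm_num)] with a ha
      simp only [zpow_natCast]
      exact (h a ha.1 ha.2).tsum_eq.symm
    have := tendsto_nhds_unique hl hz
    rw [tsum_eq_single 0 fun k hk => if_neg (by exact_mod_cast hk)] at this
    simpa using this
  induction n generalizing d with
  | zero => exact h0 d h
  | succ n ih =>
    refine ih (d := fun n => d (n + 1)) fun q hq0 hq1 => ?_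
    have h1 := ((hasSum_nat_add_iff' 1).2 (h q hq0 hq1)).mul_left q⁻¹
    simp only [Finset.range_one, Finset.sum_singleton, h0 d h, zero_mul, sub_zero, mul_zero] at h1
    refine h1.congr_fun fun n => ?_
    rw [pow_succ]
    field_simp

/-- The sum of three squares, as a natural number. -/
def sumSquares (v : ℤ × ℤ × ℤ) : ℕ := v.1.natAbs ^ 2 + (v.2.1.natAbs ^ 2 + v.2.2.natAbs ^ 2)

lemma hasSum_thetaFour_cube {q : ℝ} (h0 : 0 < q) (h1 : q < 1) :
    HasSum (fun v : ℤ × ℤ × ℤ => (-1 : ℝ) ^ (v.1 + v.2.1 + v.2.2) * q ^ sumSquares v)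
      (thetaFour q ^ 3) := by
  have hs := summable_thetaFour h0 h1
  set f : ℤ → ℝ := fun k => (-1 : ℝ) ^ k * q ^ (k ^ 2) with hf
  have hF : HasSum f (thetaFour q) := hs.hasSum
  have h2 : HasSum (fun x : ℤ × ℤ => f x.1 * f x.2) (thetaFour q * thetaFour q) :=
    HasSum.mul (f := f) (g := f) hF hF
      (summable_mul_of_summable_norm (f := f) (g := f) hF.summable.norm hF.summable.norm)
  have h3 : HasSum (fun x : ℤ × ℤ × ℤ => f x.1 * (f x.2.1 * f x.2.2))
      (thetaFour q * (thetaFour q * thetaFour q)) :=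
    HasSum.mul (f := f) (g := fun x : ℤ × ℤ => f x.1 * f x.2) hF h2
      (summable_mul_of_summable_norm (f := f) (g := fun x : ℤ × ℤ => f x.1 * f x.2)
        hF.summable.norm h2.summable.norm)
  rw [show thetaFour q ^ 3 = thetaFour q * (thetaFour q * thetaFour q) by ring]
  refine h3.congr_fun fun v => ?_
  have e : ∀ k : ℤ, q ^ (k ^ 2) = q ^ (k.natAbs ^ 2) := fun k => by
    rw [← zpow_natCast]; congr 1; simp
  simp only [hf]
  rw [sumSquares, neg_one_zpow_add, neg_one_zpow_add, e, e, e, pow_add, pow_add]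
  ring

lemma tsum_sign_sumSquares {n : ℕ} (hn : Odd n) :
    ∑' v : {v // sumSquares v = n}, (-1 : ℝ) ^ (v.1.1 + v.1.2.1 + v.1.2.2) = -r3 n := by
  have hc : ∀ v : ℤ × ℤ × ℤ, (sumSquares v : ℤ) = v.1 ^ 2 + v.2.1 ^ 2 + v.2.2 ^ 2 := fun v => by
    simp [sumSquares, add_assoc]
  have e : ∀ v : {v // sumSquares v = n}, (-1 : ℝ) ^ (v.1.1 + v.1.2.1 + v.1.2.2) = -1 := by
    rintro ⟨v, hv⟩
    have : Odd (v.1 ^ 2 + v.2.1 ^ 2 + v.2.2 ^ 2) := by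
      rw [← hc, hv]; exact_mod_cast hn
    refine Odd.neg_one_zpow ?_
    simp only
    rw [← Int.not_even_iff_odd] at this ⊢
    simpa [Int.even_add, Int.even_pow] using this
  have hr : r3 n = Nat.card {v // sumSquares v = n} := by
    rw [r3, ← Nat.card_coe_set_eq]
    refine Nat.card_congr (Equiv.subtypeEquivRight fun v => ?_)
    rw [Set.mem_ofPred_eq, ← hc]
    norm_cast
  rw [tsum_congr e, tsum_const, hr]
  simp

lemma tsum_sign_pair {n : ℕ} (hn : Odd n) :
    ∑' p : {p : ℕ × ℕ // (p.1 + 1) * (p.2 + 1) = n}, (-1 : ℝ) ^ (p.1.1 + p.1.2) =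
      n.divisors.card := by
  have e : ∀ p : {p : ℕ × ℕ // (p.1 + 1) * (p.2 + 1) = n}, (-1 : ℝ) ^ (p.1.1 + p.1.2) = 1 := by
    rintro ⟨⟨a, b⟩, h⟩
    simp only at h ⊢
    rw [← h, Nat.odd_mul] at hn
    refine Even.neg_one_pow ?_
    have := hn.1.add_odd hn.2
    rw [show a + 1 + (b + 1) = a + b + 2 by ring] at this
    simpa [Nat.even_add] using this
  have hd : n ≠ 0 := by rintro rfl; simp at hn
  have hb : Nat.card {p : ℕ × ℕ // (p.1 + 1) * (p.2 + 1) = n} = Nat.card n.divisors := by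
    refine Nat.card_congr (Equiv.ofBijective
      (fun p => ⟨p.1.1 + 1, Nat.mem_divisors.2 ⟨⟨_, p.2.symm⟩, hd⟩⟩) ⟨?_, ?_⟩)
    · rintro ⟨⟨a, b⟩, h⟩ ⟨⟨a', b'⟩, h'⟩ hab
      simp only [Subtype.mk.injEq, add_left_inj] at hab
      subst hab
      simp only at h h'
      have := Nat.eq_of_mul_eq_mul_left (Nat.succ_pos a) (h.trans h'.symm)
      simp only [Subtype.mk.injEq, Prod.mk.injEq, true_and]
      omega
    · rintro ⟨x, hx⟩
      obtain ⟨y, hy⟩ := Nat.dvd_of_mem_divisors hx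
      have hx0 : x ≠ 0 := by rintro rfl; simp at hy; omega
      have hy0 : y ≠ 0 := by rintro rfl; simp at hy; omega
      obtain ⟨a, rfl⟩ := Nat.exists_eq_succ_of_ne_zero hx0
      obtain ⟨b, rfl⟩ := Nat.exists_eq_succ_of_ne_zero hy0
      exact ⟨⟨(a, b), hy.symm⟩, rfl⟩
  rw [tsum_congr e, tsum_const, hb, Nat.card_eq_fintype_card, Fintype.card_coe]
  simp

lemma tsum_sign_triple (n : ℕ) :
    ∑' p : {p // tripleExponent p = n}, (-1 : ℝ) ^ (p.1.1.1 + p.1.1.2 + p.1.2 + 1) =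
      ((∑ᶠ p ∈ {p : ℕ × ℕ × ℕ | 1 ≤ p.1 ∧ 1 ≤ p.2.1 ∧ 1 ≤ p.2.2 ∧
          p.1 * p.2.1 + p.1 * p.2.2 + p.2.1 * p.2.2 = n},
          (-1 : ℤ) ^ (p.1 + p.2.1 + p.2.2) : ℤ) : ℝ) := by
  set S := {p : ℕ × ℕ × ℕ | 1 ≤ p.1 ∧ 1 ≤ p.2.1 ∧ 1 ≤ p.2.2 ∧
    p.1 * p.2.1 + p.1 * p.2.2 + p.2.1 * p.2.2 = n} with hS
  have hfin : S.Finite := by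
    refine (Set.finite_Iic (n, n, n)).subset ?_
    rintro ⟨r, s, z⟩ ⟨h1, h2, h3, h4⟩
    simp only at h1 h2 h3 h4
    refine ⟨?_, ?_, ?_⟩ <;> simp only <;> nlinarith
  have : Fintype S := hfin.fintype
  let φ : {p // tripleExponent p = n} ≃ S :=
    { toFun := fun p => ⟨(p.1.1.1 + 1, p.1.1.2 + 1, p.1.2 + 1), by
        refine ⟨by simp, by simp, by simp, p.2⟩⟩
      invFun := fun p => ⟨((p.1.1 - 1, p.1.2.1 - 1), p.1.2.2 - 1), by
        obtain ⟨⟨r, s, z⟩, h1, h2, h3, h4⟩ := p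
        simp only at h1 h2 h3 h4
        simp only [tripleExponent]
        rw [Nat.sub_add_cancel h1, Nat.sub_add_cancel h2, Nat.sub_add_cancel h3, h4]⟩
      left_inv := fun p => by simp
      right_inv := fun p => by
        obtain ⟨⟨r, s, z⟩, h1, h2, h3, h4⟩ := p
        simp only at h1 h2 h3
        simp [Nat.sub_add_cancel h1, Nat.sub_add_cancel h2, Nat.sub_add_cancel h3] }
  rw [← finsum_set_coe_eq_finsum_mem, finsum_eq_sum_of_fintype]
  push_cast
  rw [← tsum_fintype (L := SummationFilter.unconditional _), ← φ.tsum_eq]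
  refine tsum_congr fun p => ?_
  simp only [φ, Equiv.coe_fn_mk]
  ring

lemma coefficient_identity {n : ℕ} (hn : n ≠ 0) :
    ∑' v : {v // sumSquares v = n}, (-1 : ℝ) ^ (v.1.1 + v.1.2.1 + v.1.2.2) =
      -6 * (∑' p : {p : ℕ × ℕ // (p.1 + 1) * (p.2 + 1) = n}, (-1 : ℝ) ^ (p.1.1 + p.1.2)) -
      4 * ∑' p : {p // tripleExponent p = n}, (-1 : ℝ) ^ (p.1.1.1 + p.1.1.2 + p.1.2 + 1) := by
  have h := coeff_eq_zero_of_hasSum_zero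
    (d := fun n => (∑' v : {v // sumSquares v = n}, (-1 : ℝ) ^ (v.1.1 + v.1.2.1 + v.1.2.2)) -
      ((if n = 0 then 1 else 0) -
      6 * (∑' p : {p : ℕ × ℕ // (p.1 + 1) * (p.2 + 1) = n}, (-1 : ℝ) ^ (p.1.1 + p.1.2)) -
      4 * ∑' p : {p // tripleExponent p = n}, (-1 : ℝ) ^ (p.1.1.1 + p.1.1.2 + p.1.2 + 1)))
    (fun q h0 h1 => by
      have hA := hasSum_fiberwise_exponent (hasSum_thetaFour_cube h0 h1).summable
      have hB := hasSum_fiberwise_exponent (s := fun p : ℕ × ℕ => (-1 : ℝ) ^ (p.1 + p.2))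
        (e := fun p => (p.1 + 1) * (p.2 + 1)) (summable_pairTerm h0 h1)
      have hC := hasSum_fiberwise_exponent
        (s := fun p : (ℕ × ℕ) × ℕ => (-1 : ℝ) ^ (p.1.1 + p.1.2 + p.2 + 1))
        (e := tripleExponent) (summable_tripleTerm h0 h1)
      have hD := hasSum_ite_eq (0 : ℕ) (1 : ℝ)
      have hE := hA.sub ((hD.sub (hB.mul_left 6)).sub (hC.mul_left 4))
      have hz := thetaFour_cube h0 h1
      rw [← (hasSum_thetaFour_cube h0 h1).tsum_eq] at hz
      simp only [pairTerm, tripleTerm] at hz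
      rw [hz, sub_self] at hE
      refine hE.congr_fun fun n => ?_
      rcases eq_or_ne n 0 with rfl | hn
      · simp
      · simp only [hn, if_false]; ring) n
  simp only [hn, if_false] at h
  linarith

end ThreeSquares

/-- Corollary 6.3: for odd positive `n`,
`r₃(n) = 6 d(n) + 4 Σ_{rs+rt+st = n} (−1)^{r+s+t}`, the sum over ordered triples of
positive integers. -/
theorem r3_odd (n : ℕ) (hn : 0 < n) (hodd : Odd n) :
    (r3 n : ℤ) = 6 * n.divisors.card
      + 4 * ∑ᶠ p ∈ {p : ℕ × ℕ × ℕ | 1 ≤ p.1 ∧ 1 ≤ p.2.1 ∧ 1 ≤ p.2.2 ∧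
          p.1 * p.2.1 + p.1 * p.2.2 + p.2.1 * p.2.2 = n},
          (-1 : ℤ) ^ (p.1 + p.2.1 + p.2.2) := by
  have h := ThreeSquares.coefficient_identity hn.ne'
  rw [ThreeSquares.tsum_sign_sumSquares hodd, ThreeSquares.tsum_sign_pair hodd,
    ThreeSquares.tsum_sign_triple] at h
  have h2 : ((r3 n : ℤ) : ℝ) = ((6 * n.divisors.card
      + 4 * ∑ᶠ p ∈ {p : ℕ × ℕ × ℕ | 1 ≤ p.1 ∧ 1 ≤ p.2.1 ∧ 1 ≤ p.2.2 ∧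
          p.1 * p.2.1 + p.1 * p.2.2 + p.2.1 * p.2.2 = n},
          (-1 : ℤ) ^ (p.1 + p.2.1 + p.2.2) : ℤ) : ℝ) := by
    push_cast at h ⊢
    linarith
  exact_mod_cast h2
end
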